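/- arXiv:math/0301220 — 7 statements merged into one kernel-verified Lean document; each statement's English description precedes it below -/
import Mathlib

section
/- Let n ≥ 2 be a natural number and let Φ : U → ℝ³ be a C^n diffeomorphism from an open neighborhood U of the origin in ℝ³ onto an open subset of ℝ³ with Φ(0) = 0. Then for every integer i with 1 < i ≤ n there exist two-variable real polynomials P_i and Q_i of total degree at most 2i − 1, depending only on Φ and i, with the following property: whenever (k,m) ∈ ℝ² and y, z : (−ε, ε) → ℝ are C^n functions with y(0) = z(0) = 0, y′(0) = k, z′(0) = m, such that (x, y(x), z(x)) ∈ U for all x ∈ (−ε,ε) and the image Φ(x, y(x), z(x)) lies on a single straight line through the origin for all x ∈ (−ε,ε), one has y^{(i)}(0) = P_i(k,m) and z^{(i)}(0) = Q_i(k,m). -/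
open Set

theorem MultilinearMap.exists_mvPolynomial_eval_eq {σ ι κ R : Type*} [CommRing R] [Fintype ι]
    [Fintype κ] (f : MultilinearMap R (fun _ : ι => κ → R) R)
    (p : ι → κ → MvPolynomial σ R) (d : ι → ℕ) (hd : ∀ j a, (p j a).totalDegree ≤ d j) :
    ∃ q : MvPolynomial σ R, q.totalDegree ≤ ∑ j, d j ∧
      ∀ v, MvPolynomial.eval v q = f fun j a => MvPolynomial.eval v (p j a) := by
  classical
  refine ⟨∑ r : ι → κ, MvPolynomial.C (f fun j => Pi.single (r j) 1) * ∏ j, p j (r j), ?_, ?_⟩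
  · refine MvPolynomial.totalDegree_finsetSum_le fun r _ => ?_
    refine (MvPolynomial.totalDegree_mul _ _).trans ?_
    rw [MvPolynomial.totalDegree_C, zero_add]
    exact (MvPolynomial.totalDegree_finsetProd _ _).trans (Finset.sum_le_sum fun j _ => hd j _)
  · intro v
    have h : (fun j a => MvPolynomial.eval v (p j a)) =
        fun j => ∑ a, MvPolynomial.eval v (p j a) • (Pi.single a 1 : κ → R) := by
      funext j
      exact pi_eq_sum_univ' _
    rw [h, f.map_sum]
    simp [MultilinearMap.map_smul_univ, mul_comm, map_prod]

theorem OrderedFinpartition.sum_partSize {n : ℕ} (c : OrderedFinpartition n) :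
    ∑ j, c.partSize j = n := by
  simpa using c.sum_sigma_eq_sum (fun _ => (1 : ℕ))

theorem OrderedFinpartition.partSize_lt {n : ℕ} (c : OrderedFinpartition n) (hc : 2 ≤ c.length)
    (j : Fin c.length) : c.partSize j < n := by
  have : Nontrivial (Fin c.length) := Fin.nontrivial_iff_two_le.2 hc
  obtain ⟨l, hl⟩ := exists_ne j
  have h := Finset.add_le_sum (fun s _ => Nat.zero_le (c.partSize s))
    (Finset.mem_univ j) (Finset.mem_univ l) hl.symm
  rw [c.sum_partSize] at h
  have := c.partSize_pos l
  lia

/-- The nonlinear part of Faà di Bruno's formula preserves the degree bounds `j ↦ 2 * j - 1`,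
with room for one additional factor of degree one. -/
theorem exists_mvPolynomial_eval_sum_orderedFinpartition {σ κ : Type*} [Fintype κ]
    (T : FormalMultilinearSeries ℝ (κ → ℝ) (κ → ℝ)) (hT : T 1 = 0) {i : ℕ} (hi : 0 < i)
    (p : ℕ → κ → MvPolynomial σ ℝ)
    (hp : ∀ j, 0 < j → j < i → ∀ a, (p j a).totalDegree ≤ 2 * j - 1) :
    ∃ r : κ → MvPolynomial σ ℝ, (∀ a, (r a).totalDegree ≤ 2 * i - 2) ∧
      ∀ (v : σ → ℝ) (g : ℕ → κ → ℝ),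
        (∀ j, 0 < j → j < i → g j = fun a => MvPolynomial.eval v (p j a)) →
        ∑ c : OrderedFinpartition i, T c.length (fun s => g (c.partSize s)) =
          fun a => MvPolynomial.eval v (r a) := by
  have hterm (c : OrderedFinpartition i) (a : κ) : ∃ q : MvPolynomial σ ℝ,
      q.totalDegree ≤ 2 * i - 2 ∧ ∀ (v : σ → ℝ) (g : ℕ → κ → ℝ),
        (∀ j, 0 < j → j < i → g j = fun a => MvPolynomial.eval v (p j a)) →
        T c.length (fun s => g (c.partSize s)) a = MvPolynomial.eval v q := by
    obtain hc | hc : c.length = 1 ∨ 2 ≤ c.length := by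
      have := c.length_pos hi
      lia
    · refine ⟨0, by simp, fun v g _ => ?_⟩
      have : ∀ l, l = 1 → ∀ w, T l w = 0 := by
        rintro _ rfl w
        simp [hT]
      simp [this _ hc]
    · obtain ⟨q, hq, hqe⟩ := MultilinearMap.exists_mvPolynomial_eval_eq
        ((LinearMap.proj a).compMultilinearMap (T c.length).toMultilinearMap)
        (fun s => p (c.partSize s)) (fun s => 2 * c.partSize s - 1)
        (fun s => hp _ (c.partSize_pos s) (c.partSize_lt hc s))
      refine ⟨q, hq.trans ?_, fun v g hg => ?_⟩
      · have h : ∑ s, (2 * c.partSize s - 1) + c.length = 2 * i := by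
          calc _ = ∑ s : Fin c.length, ((2 * c.partSize s - 1) + 1) := by
                simp [Finset.sum_add_distrib]
            _ = ∑ s, 2 * c.partSize s :=
                Finset.sum_congr rfl fun s _ => by have := c.partSize_pos s; lia
            _ = 2 * i := by rw [← Finset.mul_sum, c.sum_partSize]
        lia
      · have h : (fun s => g (c.partSize s)) =
            fun s b => MvPolynomial.eval v (p (c.partSize s) b) :=
          funext fun s => hg _ (c.partSize_pos s) (c.partSize_lt hc s)
        rw [hqe, h]
        rfl
  choose q hq hqe using hterm
  refine ⟨fun a => ∑ c, q c a,
    fun a => MvPolynomial.totalDegree_finsetSum_le fun c _ => hq c a, fun v g hg => ?_⟩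
  ext a
  rw [Finset.sum_apply, map_sum]
  exact Finset.sum_congr rfl fun c _ => hqe c a v g hg

theorem iteratedDerivWithin_mem_submodule {F : Type*} [NormedAddCommGroup F] [NormedSpace ℝ F]
    {L : Submodule ℝ F} (hL : IsClosed (L : Set F)) {f : ℝ → F} {s : Set ℝ}
    (hf : ∀ x ∈ s, f x ∈ L) (i : ℕ) : ∀ x ∈ s, iteratedDerivWithin i f s x ∈ L := by
  induction i with
  | zero => simpa using hf
  | succ i ih =>
    intro x _
    rw [iteratedDerivWithin_succ]
    have h := range_derivWithin_subset_closure_span_image (iteratedDerivWithin i f s)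
      (s := s) (t := s) (by rw [inter_self]; exact subset_closure) (mem_range_self x)
    refine closure_minimal ?_ hL h
    exact Submodule.span_le.2 (image_subset_iff.2 ih)

theorem ContinuousLinearMap.iteratedDerivWithin_comp_left {𝕜 F G : Type*}
    [NontriviallyNormedField 𝕜] [NormedAddCommGroup F] [NormedSpace 𝕜 F] [NormedAddCommGroup G]
    [NormedSpace 𝕜 G] {n : WithTop ℕ∞} {f : 𝕜 → F} {s : Set 𝕜} {x : 𝕜} (g : F →L[𝕜] G)
    (hf : ContDiffWithinAt 𝕜 n f s x) (hs : UniqueDiffOn 𝕜 s) (hx : x ∈ s) {i : ℕ} (hi : i ≤ n) :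
    iteratedDerivWithin i (g ∘ f) s x = g (iteratedDerivWithin i f s x) := by
  simp [iteratedDerivWithin, g.iteratedFDerivWithin_comp_left hf hs hx hi]

theorem iteratedDerivWithin_pi_apply {ι : Type*} [Fintype ι] {n : WithTop ℕ∞} {f : ℝ → ι → ℝ}
    {s : Set ℝ} {x : ℝ} (hf : ContDiffWithinAt ℝ n f s x) (hs : UniqueDiffOn ℝ s) (hx : x ∈ s)
    {i : ℕ} (hi : i ≤ n) (a : ι) :
    iteratedDerivWithin i f s x a = iteratedDerivWithin i (fun t => f t a) s x :=
  ((ContinuousLinearMap.proj (R := ℝ) (φ := fun _ : ι => ℝ) a).iteratedDerivWithin_comp_left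
    hf hs hx hi).symm

/-- `γ` is a `Cⁿ` curve on `(-ε, ε)` in `U` through the origin, parametrized by its first
coordinate, with initial velocity `(1, k, m)`, and `F ∘ γ` lies in a subspace of dimension at
most one. -/
structure IsRectifiedCurve_s0 (n : ℕ) (U : Set (Fin 3 → ℝ)) (F : (Fin 3 → ℝ) → Fin 3 → ℝ)
    (v : Fin 2 → ℝ) (ε : ℝ) (γ : ℝ → Fin 3 → ℝ) : Prop where
  pos : 0 < ε
  contDiffOn : ContDiffOn ℝ n γ (Ioo (-ε) ε)
  map_zero : γ 0 = 0
  apply_zero : ∀ x, γ x 0 = x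
  derivWithin_zero : derivWithin γ (Ioo (-ε) ε) 0 = ![1, v 0, v 1]
  mapsTo : MapsTo γ (Ioo (-ε) ε) U
  exists_line : ∃ L : Submodule ℝ (Fin 3 → ℝ), Module.finrank ℝ L ≤ 1 ∧
    ∀ x ∈ Ioo (-ε) ε, F (γ x) ∈ L

namespace IsRectifiedCurve_s0

variable {n : ℕ} {U : Set (Fin 3 → ℝ)} {F : (Fin 3 → ℝ) → Fin 3 → ℝ} {v : Fin 2 → ℝ} {ε : ℝ}
  {γ : ℝ → Fin 3 → ℝ}

theorem zero_mem (h : IsRectifiedCurve_s0 n U F v ε γ) : (0 : ℝ) ∈ Ioo (-ε) ε := by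
  simpa using h.pos

theorem hasDerivWithinAt (h : IsRectifiedCurve_s0 n U F v ε γ) (hn : n ≠ 0) :
    HasDerivWithinAt γ ![1, v 0, v 1] (Ioo (-ε) ε) 0 := by
  rw [← h.derivWithin_zero]
  exact ((h.contDiffOn 0 h.zero_mem).differentiableWithinAt (by exact_mod_cast hn)).hasDerivWithinAt

theorem iteratedDerivWithin_apply_zero (h : IsRectifiedCurve_s0 n U F v ε γ) {i : ℕ} (hi : 1 < i)
    (hin : i ≤ n) : iteratedDerivWithin i γ (Ioo (-ε) ε) 0 0 = 0 := by
  rw [iteratedDerivWithin_pi_apply (h.contDiffOn 0 h.zero_mem) (uniqueDiffOn_Ioo _ _) h.zero_mem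
    (by exact_mod_cast hin)]
  simp only [h.apply_zero]
  simp [iteratedDerivWithin_fun_id h.zero_mem (uniqueDiffOn_Ioo _ _), show i ≠ 0 by lia,
    show i ≠ 1 by lia]

/-- The iterated derivatives of the image are proportional to the initial velocity. -/
theorem exists_smul_eq (h : IsRectifiedCurve_s0 n U F v ε γ) (hn : n ≠ 0)
    (hF' : HasFDerivAt F (ContinuousLinearMap.id ℝ (Fin 3 → ℝ)) 0) (i : ℕ) :
    ∃ c : ℝ, c • ![1, v 0, v 1] = iteratedDerivWithin i (F ∘ γ) (Ioo (-ε) ε) 0 := by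
  obtain ⟨L, hL, hFL⟩ := h.exists_line
  have hmem := iteratedDerivWithin_mem_submodule (f := F ∘ γ) L.closed_of_finiteDimensional hFL
  have hd : HasDerivWithinAt (F ∘ γ) ![1, v 0, v 1] (Ioo (-ε) ε) 0 := by
    rw [← h.map_zero] at hF'
    exact hF'.comp_hasDerivWithinAt 0 (h.hasDerivWithinAt hn)
  have hv : ![1, v 0, v 1] ∈ L := by
    have h1 := hmem 1 0 h.zero_mem
    rwa [iteratedDerivWithin_one, hd.derivWithin (uniqueDiffOn_Ioo _ _ 0 h.zero_mem)] at h1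
  have hv0 : (⟨_, hv⟩ : L) ≠ 0 := fun h0 => by
    simpa using congrFun (congrArg Subtype.val h0) 0
  have : Nontrivial L := ⟨_, _, hv0⟩
  obtain ⟨c, hc⟩ := (finrank_eq_one_iff_of_nonzero' _ hv0).1
    (le_antisymm hL Module.finrank_pos) ⟨_, hmem i 0 h.zero_mem⟩
  exact ⟨c, congrArg Subtype.val hc⟩

end IsRectifiedCurve_s0

/-- The polynomial dependence for a map whose derivative at the origin is the identity. -/
theorem exists_mvPolynomial_iteratedDerivWithin_eq {n : ℕ} {U : Set (Fin 3 → ℝ)} (hU : IsOpen U)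
    (h0 : (0 : Fin 3 → ℝ) ∈ U) {F : (Fin 3 → ℝ) → Fin 3 → ℝ} (hF : ContDiffOn ℝ n F U)
    (hF' : HasFDerivAt F (ContinuousLinearMap.id ℝ (Fin 3 → ℝ)) 0) (i : ℕ) :
    0 < i → i ≤ n → ∃ p : Fin 3 → MvPolynomial (Fin 2) ℝ,
      (∀ a, (p a).totalDegree ≤ 2 * i - 1) ∧
      ∀ v ε γ, IsRectifiedCurve_s0 n U F v ε γ →
        iteratedDerivWithin i γ (Ioo (-ε) ε) 0 = fun a => MvPolynomial.eval v (p a) := by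
  have hV : ∃ V : Fin 3 → MvPolynomial (Fin 2) ℝ, (∀ a, (V a).totalDegree ≤ 1) ∧
      ∀ v : Fin 2 → ℝ, (fun a => MvPolynomial.eval v (V a)) = ![1, v 0, v 1] := by
    refine ⟨![1, MvPolynomial.X 0, MvPolynomial.X 1], fun a => ?_, fun v => funext fun a => ?_⟩ <;>
      fin_cases a <;> simp
  obtain ⟨V, hVdeg, hVeval⟩ := hV
  induction i using Nat.strong_induction_on with
  | _ i ih =>
  intro hi hin
  obtain rfl | hi1 : i = 1 ∨ 1 < i := by lia
  · refine ⟨V, hVdeg, fun v ε γ h => ?_⟩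
    rw [iteratedDerivWithin_one, h.derivWithin_zero, hVeval]
  choose! p hpdeg hpeval using ih
  set G : (Fin 3 → ℝ) → Fin 3 → ℝ := F - id
  have hGc : ContDiffOn ℝ n G U := hF.sub contDiff_id.contDiffOn
  have hG1 : ftaylorSeriesWithin ℝ G U 0 1 = 0 := by
    ext1 w
    have hG' : HasFDerivAt G (0 : (Fin 3 → ℝ) →L[ℝ] Fin 3 → ℝ) 0 := by
      rw [← sub_self (ContinuousLinearMap.id ℝ (Fin 3 → ℝ))]
      exact hF'.sub (hasFDerivAt_id (0 : Fin 3 → ℝ))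
    have huniq := hU.uniqueDiffWithinAt h0 (𝕜 := ℝ)
    simp [ftaylorSeriesWithin, iteratedFDerivWithin_one_apply huniq,
      hG'.hasFDerivWithinAt.fderivWithin huniq]
  obtain ⟨r, hrdeg, hreval⟩ := exists_mvPolynomial_eval_sum_orderedFinpartition
    (ftaylorSeriesWithin ℝ G U 0) hG1 hi p (fun j hj hji => hpdeg j hji hj (hji.le.trans hin))
  refine ⟨fun a => r 0 * V a - r a, fun a => ?_, fun v ε γ h => ?_⟩
  · refine (MvPolynomial.totalDegree_sub _ _).trans (max_le ?_ ((hrdeg a).trans (by lia)))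
    refine (MvPolynomial.totalDegree_mul _ _).trans ?_
    have := hrdeg 0
    have := hVdeg a
    lia
  have hin' : (i : WithTop ℕ∞) ≤ n := by exact_mod_cast hin
  have hs := uniqueDiffOn_Ioo (-ε) ε
  have hγ := h.contDiffOn 0 h.zero_mem
  have hcomp : iteratedDerivWithin i (G ∘ γ) (Ioo (-ε) ε) 0 =
      fun a => MvPolynomial.eval v (r a) := by
    rw [iteratedDerivWithin_vcomp_eq_sum_orderedFinpartition (t := U)
      (hGc _ (h.mapsTo h.zero_mem)) hγ hU.uniqueDiffOn hs h.zero_mem h.mapsTo hin', h.map_zero]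
    exact hreval v (fun j => iteratedDerivWithin j γ (Ioo (-ε) ε) 0)
      fun j hj hji => hpeval j hji hj (hji.le.trans hin) v ε γ h
  obtain ⟨c, hc⟩ := h.exists_smul_eq (by lia) hF' i
  have hFγ : ContDiffWithinAt ℝ n (F ∘ γ) (Ioo (-ε) ε) 0 :=
    (hF _ (h.mapsTo h.zero_mem)).comp 0 hγ h.mapsTo
  have hsub : iteratedDerivWithin i (G ∘ γ) (Ioo (-ε) ε) 0 =
      c • ![1, v 0, v 1] - iteratedDerivWithin i γ (Ioo (-ε) ε) 0 := by
    rw [hc, ← iteratedDerivWithin_sub h.zero_mem hs (hFγ.of_le hin') (hγ.of_le hin')]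
    rfl
  rw [hcomp] at hsub
  have hc0 : MvPolynomial.eval v (r 0) = c := by
    simpa [h.iteratedDerivWithin_apply_zero hi1 hin] using congrFun hsub 0
  ext a
  have ha := congrFun hsub a
  have hVa := congrFun (hVeval v) a
  simp only [Pi.sub_apply, Pi.smul_apply, smul_eq_mul] at ha
  simp only [map_sub, map_mul, hc0, hVa]
  linarith

/-- Let `Φ : U → ℝ³` be a `Cⁿ` diffeomorphism (`n ≥ 2`) from an open
neighborhood `U` of the origin onto an open subset of `ℝ³`, with `Φ 0 = 0`.  Then for
every `i` with `1 < i ≤ n` there are two-variable polynomials `P`, `Q` of total degree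
at most `2i − 1` (depending only on `Φ` and `i`) such that: whenever `y z : (−ε,ε) → ℝ`
are `Cⁿ` with `y 0 = z 0 = 0`, `y′(0) = k`, `z′(0) = m`, the curve `x ↦ (x, y x, z x)`
lies in `U` and its image under `Φ` lies on a single straight line through the origin,
then `y⁽ⁱ⁾(0) = P(k,m)` and `z⁽ⁱ⁾(0) = Q(k,m)`. -/
theorem taylor_coeffs_of_rectified_curve_are_polynomials
    (n : ℕ) (hn : 2 ≤ n)
    (U : Set (Fin 3 → ℝ)) (hUopen : IsOpen U) (h0U : (0 : Fin 3 → ℝ) ∈ U)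
    (Φ : (Fin 3 → ℝ) → (Fin 3 → ℝ)) (hΦ : ContDiffOn ℝ n Φ U) (hΦ0 : Φ 0 = 0)
    (himage : IsOpen (Φ '' U)) (hinj : Set.InjOn Φ U)
    (Ψ : (Fin 3 → ℝ) → (Fin 3 → ℝ)) (hΨ : ContDiffOn ℝ n Ψ (Φ '' U))
    (hinv : ∀ x ∈ U, Ψ (Φ x) = x) :
    ∀ i : ℕ, 1 < i → i ≤ n →
      ∃ P Q : MvPolynomial (Fin 2) ℝ,
        P.totalDegree ≤ 2 * i - 1 ∧ Q.totalDegree ≤ 2 * i - 1 ∧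
        ∀ (k m ε : ℝ) (y z : ℝ → ℝ), 0 < ε →
          ContDiffOn ℝ n y (Ioo (-ε) ε) → ContDiffOn ℝ n z (Ioo (-ε) ε) →
          y 0 = 0 → z 0 = 0 →
          derivWithin y (Ioo (-ε) ε) 0 = k → derivWithin z (Ioo (-ε) ε) 0 = m →
          (∀ x ∈ Ioo (-ε) ε, ![x, y x, z x] ∈ U) →
          (∃ L : Submodule ℝ (Fin 3 → ℝ), Module.finrank ℝ L = 1 ∧
            ∀ x ∈ Ioo (-ε) ε, Φ ![x, y x, z x] ∈ L) →
          iteratedDerivWithin i y (Ioo (-ε) ε) 0 = MvPolynomial.eval ![k, m] P ∧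
          iteratedDerivWithin i z (Ioo (-ε) ε) 0 = MvPolynomial.eval ![k, m] Q := by
  intro i hi hin
  have hn0 : (n : WithTop ℕ∞) ≠ 0 := by exact_mod_cast (show n ≠ 0 by lia)
  set A : (Fin 3 → ℝ) →L[ℝ] Fin 3 → ℝ := fderiv ℝ Ψ 0
  have hΦd : HasFDerivAt Φ (fderiv ℝ Φ 0) 0 :=
    ((hΦ.contDiffAt (hUopen.mem_nhds h0U)).differentiableAt hn0).hasFDerivAt
  have hΨd : HasFDerivAt Ψ A (Φ 0) := by
    have h0 : Φ 0 ∈ Φ '' U := mem_image_of_mem Φ h0U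
    rw [hΦ0] at h0 ⊢
    exact ((hΨ.contDiffAt (himage.mem_nhds h0)).differentiableAt hn0).hasFDerivAt
  have hAid : A.comp (fderiv ℝ Φ 0) = ContinuousLinearMap.id ℝ (Fin 3 → ℝ) := by
    refine (hΨd.comp 0 hΦd).unique ((hasFDerivAt_id (0 : Fin 3 → ℝ)).congr_of_eventuallyEq ?_)
    filter_upwards [hUopen.mem_nhds h0U] with x hx using hinv x hx
  have hF' : HasFDerivAt (A ∘ Φ) (ContinuousLinearMap.id ℝ (Fin 3 → ℝ)) 0 := by
    rw [← hAid]
    exact A.hasFDerivAt.comp 0 hΦd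
  obtain ⟨p, hpdeg, hpeval⟩ := exists_mvPolynomial_iteratedDerivWithin_eq hUopen h0U
    (A.contDiff.comp_contDiffOn hΦ) hF' i (by lia) hin
  refine ⟨p 1, p 2, hpdeg 1, hpdeg 2, ?_⟩
  rintro k m ε y z hε hy hz hy0 hz0 hk hm hmaps ⟨L, hL, hΦL⟩
  have h0mem : (0 : ℝ) ∈ Ioo (-ε) ε := by simpa using hε
  have hγ : ContDiffOn ℝ n (fun x => ![x, y x, z x]) (Ioo (-ε) ε) := by
    refine contDiffOn_pi.2 fun a => ?_
    fin_cases a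
    exacts [contDiff_id.contDiffOn, hy, hz]
  have hcurve : IsRectifiedCurve_s0 n U (A ∘ Φ) ![k, m] ε fun x => ![x, y x, z x] :=
    { pos := hε
      contDiffOn := hγ
      map_zero := by simp [hy0, hz0]
      apply_zero := fun x => rfl
      derivWithin_zero := by
        rw [derivWithin_pi fun a =>
          differentiableWithinAt_pi.1 ((hγ 0 h0mem).differentiableWithinAt hn0) a]
        ext a
        fin_cases a
        exacts [derivWithin_id' _ _ (uniqueDiffOn_Ioo _ _ 0 h0mem), hk, hm]
      mapsTo := hmaps
      exists_line := ⟨L.map (A : (Fin 3 → ℝ) →ₗ[ℝ] Fin 3 → ℝ),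
        hL ▸ Submodule.finrank_map_le _ _, fun x hx => Submodule.mem_map_of_mem (hΦL x hx)⟩ }
  have hcoord (a : Fin 3) := (iteratedDerivWithin_pi_apply (hγ 0 h0mem) (uniqueDiffOn_Ioo _ _)
    h0mem (by exact_mod_cast hin) a).symm.trans (congrFun (hpeval _ _ _ hcurve) a)
  exact ⟨hcoord 1, hcoord 2⟩
end

section
/- Let Φ = (f, g, h) : U → ℝ³ be a C² diffeomorphism from an open neighborhood U of the origin in ℝ³ onto an open subset of ℝ³, with Φ(0) = 0 and with derivative at 0 equal to the identity. Fix (k,m) ∈ ℝ² and set λ = (1, k, m). Suppose y, z : (−ε,ε) → ℝ are C² functions with y(0) = z(0) = 0, y′(0) = k, z′(0) = m, such that the curve γ(x) = (x, y(x), z(x)) lies in U and satisfies g(γ(x)) = k·f(γ(x)) and h(γ(x)) = m·f(γ(x)) for all x ∈ (−ε,ε). Then y″(0) = k·H_f(λ,λ) − H_g(λ,λ) and z″(0) = m·H_f(λ,λ) − H_h(λ,λ), where H_φ(λ,λ) denotes the second derivative (Hessian quadratic form) of φ at the origin evaluated at (λ, λ). In particular there exist symmetric 3×3 matrices A, B,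 C depending only on Φ with y″(0) = ⟨(B + kA)λ, λ⟩ and z″(0) = ⟨(C + mA)λ, λ⟩. -/
open Set Matrix

/-- The hypotheses on the curve `γ(x) = (x, y x, z x)`: it is `C²`, starts at the origin
with `y′(0) = k`, `z′(0) = m`, lies in `U`, and satisfies `g ∘ γ = k·(f ∘ γ)` and
`h ∘ γ = m·(f ∘ γ)`, where `Φ = (f, g, h)`. -/
def IsRectifiedCurve (Φ : (Fin 3 → ℝ) → (Fin 3 → ℝ)) (U : Set (Fin 3 → ℝ))
    (k m ε : ℝ) (y z : ℝ → ℝ) : Prop :=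
  0 < ε ∧
  ContDiffOn ℝ 2 y (Ioo (-ε) ε) ∧ ContDiffOn ℝ 2 z (Ioo (-ε) ε) ∧
  y 0 = 0 ∧ z 0 = 0 ∧
  derivWithin y (Ioo (-ε) ε) 0 = k ∧ derivWithin z (Ioo (-ε) ε) 0 = m ∧
  (∀ x ∈ Ioo (-ε) ε, ![x, y x, z x] ∈ U) ∧
  (∀ x ∈ Ioo (-ε) ε, Φ ![x, y x, z x] 1 = k * Φ ![x, y x, z x] 0) ∧
  (∀ x ∈ Ioo (-ε) ε, Φ ![x, y x, z x] 2 = m * Φ ![x, y x, z x] 0)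

/-- The Hessian quadratic form of `φ` at the origin (computed within `U`),
evaluated at the pair `(λ, λ)`. -/
noncomputable def hessianAtZero (φ : (Fin 3 → ℝ) → ℝ) (U : Set (Fin 3 → ℝ))
    (lam : Fin 3 → ℝ) : ℝ :=
  iteratedFDerivWithin ℝ 2 φ U 0 ![lam, lam]

/-- Second-order chain rule for a function composed with a curve. -/
theorem iteratedDeriv_two_comp_curve {E : Type*} [NormedAddCommGroup E] [NormedSpace ℝ E]
    {φ : E → ℝ} {γ : ℝ → E} {t : ℝ} (hφ : ContDiffAt ℝ 2 φ (γ t)) (hγ : ContDiffAt ℝ 2 γ t) :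
    iteratedDeriv 2 (φ ∘ γ) t =
      iteratedFDeriv ℝ 2 φ (γ t) ![deriv γ t, deriv γ t]
        + fderiv ℝ φ (γ t) (iteratedDeriv 2 γ t) := by
  have hderiv : deriv (φ ∘ γ) =ᶠ[nhds t] fun s => fderiv ℝ φ (γ s) (deriv γ s) := by
    filter_upwards [hγ.continuousAt.eventually (hφ.eventually (by simp)),
      hγ.eventually (by simp)] with s hφs hγs
    exact fderiv_comp_deriv s (hφs.differentiableAt (by simp)) (hγs.differentiableAt (by simp))
  have hφ_fst : DifferentiableAt ℝ (fderiv ℝ φ) (γ t) :=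
    (hφ.fderiv_right (m := 1) (by norm_num)).differentiableAt (by simp)
  have hγ_fst : DifferentiableAt ℝ (deriv γ) t :=
    (hγ.derivWithin (m := 1) (by norm_num)).differentiableAt (by simp)
  have hcomp := hφ_fst.hasFDerivAt.comp_hasDerivAt t
    (hγ.differentiableAt (by simp)).hasDerivAt
  simp only [iteratedDeriv_succ, iteratedDeriv_zero, iteratedFDeriv_two_apply]
  rw [hderiv.deriv_eq]
  exact (hcomp.clm_apply hγ_fst.hasDerivAt).deriv

/-- Coordinatewise derivative of a curve in `ℝ³`. -/
theorem hasDerivAt_vec3 {a b c : ℝ → ℝ} {da db dc t : ℝ} (ha : HasDerivAt a da t)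
    (hb : HasDerivAt b db t) (hc : HasDerivAt c dc t) :
    HasDerivAt (fun s => ![a s, b s, c s]) ![da, db, dc] t := by
  rw [hasDerivAt_pi]
  intro i
  fin_cases i
  · exact ha
  · exact hb
  · exact hc

/-- First and second derivatives of a `C²` graph curve. -/
theorem graphCurve_derivs {y z : ℝ → ℝ} {t : ℝ} (hy : ContDiffAt ℝ 2 y t)
    (hz : ContDiffAt ℝ 2 z t) :
    ContDiffAt ℝ 2 (fun x => ![x, y x, z x]) t ∧
    deriv (fun x => ![x, y x, z x]) t = ![1, deriv y t, deriv z t] ∧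
    iteratedDeriv 2 (fun x => ![x, y x, z x]) t =
      ![0, iteratedDeriv 2 y t, iteratedDeriv 2 z t] := by
  have hderiv : deriv (fun x => ![x, y x, z x]) =ᶠ[nhds t]
      fun s => ![1, deriv y s, deriv z s] := by
    filter_upwards [hy.eventually (by simp), hz.eventually (by simp)] with s hys hzs
    exact (hasDerivAt_vec3 (hasDerivAt_id s) (hys.differentiableAt (by simp)).hasDerivAt
      (hzs.differentiableAt (by simp)).hasDerivAt).deriv
  refine ⟨?_, hderiv.eq_of_nhds, ?_⟩
  · rw [contDiffAt_pi]
    intro i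
    fin_cases i
    · exact contDiffAt_id
    · exact hy
    · exact hz
  · simp only [iteratedDeriv_succ, iteratedDeriv_zero]
    rw [hderiv.deriv_eq]
    exact (hasDerivAt_vec3 (hasDerivAt_const t 1)
      ((hy.derivWithin (m := 1) (by norm_num)).differentiableAt (by simp)).hasDerivAt
      ((hz.derivWithin (m := 1) (by norm_num)).differentiableAt (by simp)).hasDerivAt).deriv

/-- The Hessian of a `C²` function is represented by a symmetric matrix. -/
theorem exists_symm_matrix_hessianAtZero {φ : (Fin 3 → ℝ) → ℝ} {U : Set (Fin 3 → ℝ)}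
    (hU : IsOpen U) (h0 : (0 : Fin 3 → ℝ) ∈ U) (hφ : ContDiffAt ℝ 2 φ 0) :
    ∃ A : Matrix (Fin 3) (Fin 3) ℝ, A.IsSymm ∧
      ∀ v, hessianAtZero φ U v = (A *ᵥ v) ⬝ᵥ v := by
  let L := (fderiv ℝ (fderiv ℝ φ) 0).toLinearMap₁₂
  refine ⟨LinearMap.toMatrix₂' ℝ L, ?_, fun v => ?_⟩
  · ext i j
    rw [Matrix.transpose_apply, LinearMap.toMatrix₂'_apply, LinearMap.toMatrix₂'_apply]
    exact hφ.isSymmSndFDerivAt (by simp) _ _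
  · rw [dotProduct_comm, ← Matrix.toLinearMap₂'_apply', Matrix.toLinearMap₂'_toMatrix',
      hessianAtZero, iteratedFDerivWithin_of_isOpen 2 hU h0, iteratedFDeriv_two_apply]
    rfl

/-- The second derivatives of a rectified curve in terms of the Hessians of `Φ`. -/
theorem IsRectifiedCurve.iteratedDerivWithin_two {Φ : (Fin 3 → ℝ) → (Fin 3 → ℝ)}
    {U : Set (Fin 3 → ℝ)} {k m ε : ℝ} {y z : ℝ → ℝ} (hc : IsRectifiedCurve Φ U k m ε y z)
    (hU : IsOpen U) (h0U : (0 : Fin 3 → ℝ) ∈ U) (hΦ : ContDiffAt ℝ 2 Φ 0)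
    (hid : fderiv ℝ Φ 0 = ContinuousLinearMap.id ℝ (Fin 3 → ℝ)) :
    iteratedDerivWithin 2 y (Ioo (-ε) ε) 0 =
        k * hessianAtZero (fun p => Φ p 0) U ![1, k, m]
          - hessianAtZero (fun p => Φ p 1) U ![1, k, m] ∧
    iteratedDerivWithin 2 z (Ioo (-ε) ε) 0 =
        m * hessianAtZero (fun p => Φ p 0) U ![1, k, m]
          - hessianAtZero (fun p => Φ p 2) U ![1, k, m] := by
  obtain ⟨hε, hy, hz, hy0, hz0, hdy, hdz, -, hg, hh⟩ := hc
  have h0 : (0 : ℝ) ∈ Ioo (-ε) ε := ⟨by linarith, hε⟩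
  have hnhds : Ioo (-ε) ε ∈ nhds (0 : ℝ) := isOpen_Ioo.mem_nhds h0
  rw [derivWithin_of_isOpen isOpen_Ioo h0] at hdy hdz
  rw [iteratedDerivWithin_of_isOpen isOpen_Ioo h0, iteratedDerivWithin_of_isOpen isOpen_Ioo h0]
  obtain ⟨hγ, hγ_fst, hγ_snd⟩ := graphCurve_derivs (hy.contDiffAt hnhds) (hz.contDiffAt hnhds)
  set γ : ℝ → Fin 3 → ℝ := fun x => ![x, y x, z x] with hγdef
  have hγ0 : γ 0 = 0 := by
    ext i
    fin_cases i <;> simp [hγdef, hy0, hz0]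
  have hcomp (i : Fin 3) : iteratedDeriv 2 ((fun p => Φ p i) ∘ γ) 0 =
      hessianAtZero (fun p => Φ p i) U ![1, k, m]
        + ![0, iteratedDeriv 2 y 0, iteratedDeriv 2 z 0] i := by
    have hΦi : ContDiffAt ℝ 2 (fun p => Φ p i) (γ 0) := by
      rw [hγ0]
      exact contDiffAt_pi.1 hΦ i
    have hfd : fderiv ℝ (fun p => Φ p i) 0 = ContinuousLinearMap.proj i := by
      rw [fderiv_apply (hΦ.differentiableAt (by simp)), hid]
      rfl
    rw [iteratedDeriv_two_comp_curve hΦi hγ, hγ_fst, hγ_snd, hγ0, hdy, hdz, hfd, hessianAtZero,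
      iteratedFDerivWithin_of_isOpen 2 hU h0U]
    rfl
  have hmul (i : Fin 3) (c : ℝ) (h : ∀ x ∈ Ioo (-ε) ε, Φ (γ x) i = c * Φ (γ x) 0) :
      iteratedDeriv 2 ((fun p => Φ p i) ∘ γ) 0 =
        c * iteratedDeriv 2 ((fun p => Φ p 0) ∘ γ) 0 := by
    have heq : ((fun p => Φ p i) ∘ γ) =ᶠ[nhds 0] fun x => c * ((fun p => Φ p 0) ∘ γ) x := by
      filter_upwards [hnhds] with x hx using h x hx
    rw [heq.iteratedDeriv_eq, iteratedDeriv_const_mul_field]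
  have h1 := hmul 1 k hg
  have h2 := hmul 2 m hh
  simp only [hcomp, Matrix.cons_val] at h1 h2
  constructor <;> linarith

/-- Let `Φ = (f,g,h)` be a `C²` diffeomorphism of a neighborhood `U` of
`0` onto an open set, with `Φ 0 = 0` and derivative the identity at `0`.  If the curve
`γ(x) = (x, y x, z x)` satisfies `g∘γ = k·(f∘γ)`, `h∘γ = m·(f∘γ)` with `y′(0) = k`,
`z′(0) = m`, then `y″(0) = k·H_f(λ,λ) − H_g(λ,λ)` and `z″(0) = m·H_f(λ,λ) − H_h(λ,λ)`
for `λ = (1,k,m)`; in particular there are symmetric matrices `A`, `B`, `C` depending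
only on `Φ` with `y″(0) = ⟨(B + kA)λ, λ⟩` and `z″(0) = ⟨(C + mA)λ, λ⟩`. -/
theorem second_deriv_of_rectified_curve
    (U : Set (Fin 3 → ℝ)) (hUopen : IsOpen U) (h0U : (0 : Fin 3 → ℝ) ∈ U)
    (Φ : (Fin 3 → ℝ) → (Fin 3 → ℝ)) (hΦ : ContDiffOn ℝ 2 Φ U) (hΦ0 : Φ 0 = 0)
    (himage : IsOpen (Φ '' U)) (hinj : Set.InjOn Φ U)
    (Ψ : (Fin 3 → ℝ) → (Fin 3 → ℝ)) (hΨ : ContDiffOn ℝ 2 Ψ (Φ '' U))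
    (hinv : ∀ x ∈ U, Ψ (Φ x) = x)
    (hid : fderivWithin ℝ Φ U 0 = ContinuousLinearMap.id ℝ (Fin 3 → ℝ)) :
    (∀ (k m ε : ℝ) (y z : ℝ → ℝ), IsRectifiedCurve Φ U k m ε y z →
      iteratedDerivWithin 2 y (Ioo (-ε) ε) 0 =
          k * hessianAtZero (fun p => Φ p 0) U ![1, k, m]
            - hessianAtZero (fun p => Φ p 1) U ![1, k, m] ∧
      iteratedDerivWithin 2 z (Ioo (-ε) ε) 0 =
          m * hessianAtZero (fun p => Φ p 0) U ![1, k, m]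
            - hessianAtZero (fun p => Φ p 2) U ![1, k, m]) ∧
    ∃ A B C : Matrix (Fin 3) (Fin 3) ℝ, A.IsSymm ∧ B.IsSymm ∧ C.IsSymm ∧
      ∀ (k m ε : ℝ) (y z : ℝ → ℝ), IsRectifiedCurve Φ U k m ε y z →
        iteratedDerivWithin 2 y (Ioo (-ε) ε) 0 =
            ((B + k • A).mulVec ![1, k, m]) ⬝ᵥ ![1, k, m] ∧
        iteratedDerivWithin 2 z (Ioo (-ε) ε) 0 =
            ((C + m • A).mulVec ![1, k, m]) ⬝ᵥ ![1, k, m] := by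
  have hΦat : ContDiffAt ℝ 2 Φ 0 := hΦ.contDiffAt (hUopen.mem_nhds h0U)
  rw [fderivWithin_of_isOpen hUopen h0U] at hid
  have hmatrix (i : Fin 3) :=
    exists_symm_matrix_hessianAtZero hUopen h0U (contDiffAt_pi.1 hΦat i)
  obtain ⟨A, hA, hAv⟩ := hmatrix 0
  obtain ⟨B, hB, hBv⟩ := hmatrix 1
  obtain ⟨C, hC, hCv⟩ := hmatrix 2
  refine ⟨fun k m ε y z hc => hc.iteratedDerivWithin_two hUopen h0U hΦat hid,
    A, -B, -C, hA, hB.neg, hC.neg, fun k m ε y z hc => ?_⟩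
  obtain ⟨hy, hz⟩ := hc.iteratedDerivWithin_two hUopen h0U hΦat hid
  rw [hAv, hBv] at hy
  rw [hAv, hCv] at hz
  simp only [Matrix.add_mulVec, Matrix.neg_mulVec, Matrix.smul_mulVec, add_dotProduct,
    neg_dotProduct, smul_dotProduct, smul_eq_mul]
  constructor <;> linarith
end

section
/- Let ℱ be a family of circles in ℝ³, each passing through the origin, such that distinct circles of ℱ have distinct tangent lines at the origin (a simple bundle). Assume ℱ contains 54 circles C₁, …, C₅₄ whose tangent lines ℓ₁, …, ℓ₅₄ at the origin are generic, meaning that the real vector space of homogeneous polynomials of degree 9 in three variables that vanish identically on ℓ₁ ∪ ⋯ ∪ ℓ₅₄ is one-dimensional. If there exist an open neighborhood U of the origin and a smooth diffeomorphism Φ from U onto an open subset of ℝ³ such that for every C ∈ ℱ the image Φ(C ∩ U) is contained in an affine line of ℝ³, then there exists a point Q ≠ 0 in ℝ³ lying on every circle of ℱ. -/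
open Metric Module
open Filter Topology Asymptotics

/-- The restriction of a multilinear form to the diagonal is a homogeneous polynomial. -/
lemma exists_isHomogeneous_eval_eq_multilinear {ι : Type*} [Fintype ι] [DecidableEq ι] (n : ℕ)
    (m : ContinuousMultilinearMap ℝ (fun _ : Fin n => EuclideanSpace ℝ ι) ℝ) :
    ∃ p : MvPolynomial ι ℝ, p.IsHomogeneous n ∧
      ∀ v : EuclideanSpace ℝ ι, MvPolynomial.eval (fun s => v s) p = m (fun _ => v) := by
  refine ⟨∑ j : Fin n → ι, MvPolynomial.C (m fun s => EuclideanSpace.single (j s) 1) *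
    ∏ s, MvPolynomial.X (j s), ?_, fun v => ?_⟩
  · refine MvPolynomial.IsHomogeneous.sum _ _ _ fun j _ => MvPolynomial.IsHomogeneous.C_mul ?_ _
    simpa using MvPolynomial.IsHomogeneous.prod Finset.univ
      (fun s => (MvPolynomial.X (j s) : MvPolynomial ι ℝ)) (fun _ => 1)
      fun s _ => MvPolynomial.isHomogeneous_X _ _
  · have hv : v = ∑ k, v k • EuclideanSpace.single k (1 : ℝ) := by
      ext i; simp [Pi.single_apply]
    have hm : m (fun _ => v) = m (fun _ => ∑ k, v k • EuclideanSpace.single k (1 : ℝ)) := by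
      rw [← hv]
    rw [hm, m.map_sum]
    simp only [map_sum, map_mul, MvPolynomial.eval_C, map_prod, MvPolynomial.eval_X]
    refine Finset.sum_congr rfl fun j _ => ?_
    rw [m.map_smul_univ, smul_eq_mul, mul_comm]

/-- Taylor's formula along lines through the origin, with homogeneous polynomial coefficients. -/
lemma exists_isHomogeneous_taylor {ι : Type*} [Fintype ι] [DecidableEq ι]
    {g : EuclideanSpace ℝ ι → ℝ} {N : ℕ} (hg : ContDiffAt ℝ N g 0) :
    ∃ p : ℕ → MvPolynomial ι ℝ, (∀ n, (p n).IsHomogeneous n) ∧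
      (∀ n v, MvPolynomial.eval (fun s => v s) (p n) =
        (n.factorial : ℝ)⁻¹ * iteratedFDeriv ℝ n g 0 (fun _ => v)) ∧
      ∀ v : EuclideanSpace ℝ ι, (fun t : ℝ => g (t • v) -
        ∑ k ∈ Finset.range (N + 1), t ^ k * MvPolynomial.eval (fun s => v s) (p k))
          =o[𝓝 0] fun t => t ^ N := by
  choose p hp hpe using fun n =>
    exists_isHomogeneous_eval_eq_multilinear n (iteratedFDeriv ℝ n g 0)
  refine ⟨fun n => MvPolynomial.C (n.factorial : ℝ)⁻¹ * p n, fun n => (hp n).C_mul _,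
    fun n v => by simp [hpe], fun v => ?_⟩
  obtain ⟨u, hu, hgu⟩ := hg.contDiffOn le_rfl (by simp)
  obtain ⟨R, hR, hRu⟩ := Metric.mem_nhds_iff.1 hu
  have hgR : ContDiffOn ℝ N g (ball 0 R) := hgu.mono hRu
  let l : ℝ →L[ℝ] EuclideanSpace ℝ ι := ContinuousLinearMap.toSpanSingleton ℝ v
  have hl : ∀ t, l t = t • v := fun t => by simp [l]
  have hs : Convex ℝ (l ⁻¹' ball 0 R) := (convex_ball _ _).linear_preimage l.toLinearMap
  have hso : IsOpen (l ⁻¹' ball 0 R) := isOpen_ball.preimage l.continuous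
  have h0 : (0 : ℝ) ∈ l ⁻¹' ball 0 R := by simp [hR]
  have key := taylor_isLittleO hs h0 (hgR.comp_continuousLinearMap l)
  rw [hso.nhdsWithin_eq h0] at key
  simp only [sub_zero] at key
  refine key.congr_left fun t => ?_
  rw [taylor_within_apply]
  simp only [Function.comp_apply, hl]
  congr 1
  refine Finset.sum_congr rfl fun k hk => ?_
  rw [iteratedDerivWithin_eq_iteratedFDerivWithin, l.iteratedFDerivWithin_comp_right hgR
    isOpen_ball.uniqueDiffOn hso.uniqueDiffOn (by simpa using hR)
    (by exact_mod_cast Nat.lt_succ_iff.1 (Finset.mem_range.1 hk))]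
  rw [iteratedFDerivWithin_of_isOpen k isOpen_ball (by simpa using hR)]
  simp [hl, hpe]
  ring

/-- A polynomial that is `o(t ^ n)` at the origin has no terms of degree at most `n`. -/
lemma Polynomial.coeff_eq_zero_of_isLittleO {n : ℕ} {p : Polynomial ℝ}
    (hp : (fun t => p.eval t) =o[𝓝[≠] 0] fun t : ℝ => t ^ n) {k : ℕ} (hk : k ≤ n) :
    p.coeff k = 0 := by
  have h0 : ∀ {n : ℕ} {p : Polynomial ℝ},
      (fun t => p.eval t) =o[𝓝[≠] 0] (fun t : ℝ => t ^ n) → p.coeff 0 = 0 := by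
    intro n p hp
    have h1 : (fun t : ℝ => t ^ n) =O[𝓝[≠] 0] fun _ => (1 : ℝ) :=
      ((continuous_pow n).tendsto (0 : ℝ)).isBigO_one ℝ |>.mono nhdsWithin_le_nhds
    have := tendsto_nhds_unique ((isLittleO_one_iff ℝ).1 (hp.trans_isBigO h1))
      ((p.continuous.tendsto 0).mono_left nhdsWithin_le_nhds)
    simpa [Polynomial.coeff_zero_eq_eval_zero] using this.symm
  induction n generalizing p k with
  | zero => rw [Nat.le_zero.1 hk, h0 hp]
  | succ n ih =>
    obtain _ | k := k
    · exact h0 hp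
    have hd : p = p.divX * Polynomial.X := by
      conv_lhs => rw [← p.divX_mul_X_add, h0 hp]
      simp
    rw [← Polynomial.coeff_divX]
    refine ih ?_ (by omega)
    refine (hp.mul_isBigO (isBigO_refl (fun t : ℝ => t⁻¹) (𝓝[≠] 0))).congr' ?_ ?_
    · filter_upwards [self_mem_nhdsWithin] with t (ht : t ≠ 0)
      conv_lhs => rw [hd]
      simp [ht]
    · filter_upwards [self_mem_nhdsWithin] with t (ht : t ≠ 0)
      rw [pow_succ, mul_inv_cancel_right₀ ht]

lemma coeffs_eq_zero_of_isLittleO {a b d : ℝ} {R : Polynomial ℝ}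
    (h : (fun t => a * t ^ 2 + b * t ^ 3 + d * t ^ 4 + R.eval t * t ^ 5)
      =o[𝓝 0] fun t : ℝ => t ^ 4) : a = 0 ∧ b = 0 ∧ d = 0 := by
  have h' : (fun t => Polynomial.eval t (Polynomial.C a * Polynomial.X ^ 2 +
      Polynomial.C b * Polynomial.X ^ 3 + Polynomial.C d * Polynomial.X ^ 4 +
      R * Polynomial.X ^ 5)) =o[𝓝[≠] 0] fun t : ℝ => t ^ 4 := by
    simpa using h.mono nhdsWithin_le_nhds
  have hc := fun k hk => Polynomial.coeff_eq_zero_of_isLittleO h' (k := k) hk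
  have h2 := hc 2 (by norm_num)
  have h3 := hc 3 (by norm_num)
  have h4 := hc 4 (by norm_num)
  simp [Polynomial.coeff_mul_X_pow'] at h2 h3 h4
  exact ⟨h2, h3, h4⟩

/-- Coefficient comparison in the equation `f ∧ v = ‖f‖² κ` satisfied by a parametrized circle
through the origin. -/
lemma circle_taylor_relations {f : ℝ → Fin 3 → ℝ} {v A B D : Fin 3 → ℝ} {i j : Fin 3} {κ : ℝ}
    (hf : ∀ k, (fun t => f t k - (t * v k + t ^ 2 * A k + t ^ 3 * B k + t ^ 4 * D k))
      =o[𝓝 0] fun t : ℝ => t ^ 4)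
    (hκ : ∀ᶠ t in 𝓝 0, f t i * v j - f t j * v i = (∑ k, f t k ^ 2) * κ) :
    A i * v j - A j * v i = (∑ k, v k ^ 2) * κ ∧
    B i * v j - B j * v i = 2 * (∑ k, v k * A k) * κ ∧
    D i * v j - D j * v i = (∑ k, A k ^ 2 + 2 * ∑ k, v k * B k) * κ := by
  have hbd : ∀ k, (fun t => f t k + (t * v k + t ^ 2 * A k + t ^ 3 * B k + t ^ 4 * D k))
      =O[𝓝 0] fun _ : ℝ => (1 : ℝ) := by
    intro k
    have h1 : (fun t : ℝ => t ^ 4) =O[𝓝 0] fun _ => (1 : ℝ) :=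
      ((continuous_pow 4).tendsto (0 : ℝ)).isBigO_one ℝ
    have h2 : (fun t : ℝ => 2 * (t * v k + t ^ 2 * A k + t ^ 3 * B k + t ^ 4 * D k))
        =O[𝓝 0] fun _ => (1 : ℝ) :=
      (Continuous.tendsto (by fun_prop) (0 : ℝ)).isBigO_one ℝ
    refine (((hf k).isBigO.trans h1).add h2).congr_left fun t => ?_
    ring
  have hsq : ∀ k, (fun t => f t k ^ 2 - (t * v k + t ^ 2 * A k + t ^ 3 * B k + t ^ 4 * D k) ^ 2)
      =o[𝓝 0] fun t : ℝ => t ^ 4 := fun k =>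
    ((hf k).mul_isBigO (hbd k)).congr (fun t => by ring) (fun t => by ring)
  have hsum := IsLittleO.sum (s := Finset.univ) fun k _ => hsq k
  have hmain := (((hf i).mul_isBigO (isBigO_refl (fun _ => v j) (𝓝 (0 : ℝ)))).congr_right
    (g₂ := fun t => v j * t ^ 4) (fun t => by ring)).trans_isBigO
      (isBigO_const_mul_self _ _ _)
  have hmain' := (((hf j).mul_isBigO (isBigO_refl (fun _ => v i) (𝓝 (0 : ℝ)))).congr_right
    (g₂ := fun t => v i * t ^ 4) (fun t => by ring)).trans_isBigO
      (isBigO_const_mul_self _ _ _)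
  have hmain'' := hsum.const_mul_left κ
  have htot := (hmain.sub hmain').sub hmain''
  have := coeffs_eq_zero_of_isLittleO
    (a := (∑ k, v k ^ 2) * κ - (A i * v j - A j * v i))
    (b := 2 * (∑ k, v k * A k) * κ - (B i * v j - B j * v i))
    (d := (∑ k, A k ^ 2 + 2 * ∑ k, v k * B k) * κ - (D i * v j - D j * v i))
    (R := Polynomial.C κ * ∑ k, (Polynomial.C (2 * v k * D k + 2 * A k * B k) +
      Polynomial.C (2 * A k * D k + B k ^ 2) * Polynomial.X +
      Polynomial.C (2 * B k * D k) * Polynomial.X ^ 2 + Polynomial.C (D k ^ 2) * Polynomial.X ^ 3))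
    (htot.congr' (by
      filter_upwards [hκ] with t ht
      simp only [Fin.sum_univ_three, Polynomial.eval_mul, Polynomial.eval_add, Polynomial.eval_C,
        Polynomial.eval_pow, Polynomial.eval_X, Pi.add_apply] at ht ⊢
      linear_combination ht) EventuallyEq.rfl)
  refine ⟨?_, ?_, ?_⟩ <;> linarith [this.1, this.2.1, this.2.2]

lemma Fin.exists_sum_eq_add_add {M : Type*} [AddCommMonoid M] {i j : Fin 3} (hij : i ≠ j) :
    ∃ k : Fin 3, ∀ f : Fin 3 → M, ∑ x, f x = f i + f j + f k := by
  obtain ⟨k, hik, hjk, hk⟩ : ∃ k, i ≠ k ∧ j ≠ k ∧ Finset.univ = ({i, j, k} : Finset (Fin 3)) := by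
    decide +revert
  refine ⟨k, fun f => ?_⟩
  rw [hk, Finset.sum_insert (by simp [hij, hik]), Finset.sum_pair hjk, add_assoc]

namespace MvPolynomial

lemma IsHomogeneous.exists_eq_sum_C_mul_X {σ R : Type*} [Fintype σ] [CommSemiring R]
    {p : MvPolynomial σ R} (hp : p.IsHomogeneous 1) : ∃ b : σ → R, p = ∑ i, C (b i) * X i := by
  rw [← mem_homogeneousSubmodule, homogeneousSubmodule_one_eq_span_X,
    Submodule.mem_span_range_iff_exists_fun] at hp
  obtain ⟨b, rfl⟩ := hp
  exact ⟨b, by simp [smul_eq_C_mul]⟩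

lemma exists_eq_C_add_sum_of_totalDegree_eq_one {σ R : Type*} [Fintype σ] [CommSemiring R]
    {p : MvPolynomial σ R} (hp : p.totalDegree = 1) :
    ∃ (a : R) (b : σ → R), b ≠ 0 ∧ p = C a + ∑ i, C (b i) * X i := by
  obtain ⟨b, hb⟩ := (homogeneousComponent_isHomogeneous 1 p).exists_eq_sum_C_mul_X
  have hsum := sum_homogeneousComponent p
  rw [hp, Finset.sum_range_succ, Finset.sum_range_one, homogeneousComponent_zero, hb] at hsum
  refine ⟨_, b, ?_, hsum.symm⟩
  rintro rfl
  rw [← hsum] at hp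
  simp at hp

lemma IsHomogeneous.exists_isHomogeneous_of_dvd {σ R : Type*} [CommSemiring R]
    {p q : MvPolynomial σ R} {m n : ℕ} (hq : q.IsHomogeneous m) (hp : p.IsHomogeneous (m + n))
    (h : q ∣ p) : ∃ r : MvPolynomial σ R, r.IsHomogeneous n ∧ p = q * r := by
  obtain ⟨r, rfl⟩ := h
  let := gradedAlgebra (σ := σ) (R := R)
  have h := DirectSum.coe_decompose_mul_add_of_left_mem (homogeneousSubmodule σ R) (j := n)
    (b := r) ((mem_homogeneousSubmodule _ _).2 hq)
  rw [DirectSum.decompose_of_mem_same _ ((mem_homogeneousSubmodule _ _).2 hp)] at h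
  exact ⟨_, SetLike.coe_mem (DirectSum.decompose (homogeneousSubmodule σ R) r n), h⟩

lemma isHomogeneous_sum_X_sq : (∑ k : Fin 3, X k ^ 2 : MvPolynomial (Fin 3) ℝ).IsHomogeneous 2 :=
  IsHomogeneous.sum _ _ _ fun k _ => isHomogeneous_X_pow k 2

lemma sum_X_sq_ne_zero : (∑ k : Fin 3, X k ^ 2 : MvPolynomial (Fin 3) ℝ) ≠ 0 := by
  intro h
  have := congrArg (eval 1) h
  norm_num [Fin.sum_univ_three] at this

lemma prime_sum_X_sq : Prime (∑ k : Fin 3, X k ^ 2 : MvPolynomial (Fin 3) ℝ) := by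
  rw [← irreducible_iff_prime]
  have hdeg := isHomogeneous_sum_X_sq.totalDegree sum_X_sq_ne_zero
  have hunit : ∀ f : MvPolynomial (Fin 3) ℝ, f ≠ 0 → f.totalDegree = 0 → IsUnit f := by
    intro f hf hd
    rw [totalDegree_eq_zero_iff_eq_C] at hd
    rw [hd] at hf ⊢
    exact (IsUnit.mk0 _ (by simpa using hf)).map C
  refine ⟨fun h => ?_, fun f g hfg => ?_⟩
  · obtain ⟨u, hu⟩ := h.exists_right_inv
    have := congrArg (eval 0) hu
    norm_num [Fin.sum_univ_three] at this
  · have hf : f ≠ 0 := by rintro rfl; exact sum_X_sq_ne_zero (by simpa using hfg)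
    have hg : g ≠ 0 := by rintro rfl; exact sum_X_sq_ne_zero (by simpa using hfg)
    by_contra! hfgu
    have hf0 : f.totalDegree ≠ 0 := fun h => hfgu.1 (hunit f hf h)
    have hg0 : g.totalDegree ≠ 0 := fun h => hfgu.2 (hunit g hg h)
    rw [hfg, totalDegree_mul_of_isDomain hf hg] at hdeg
    obtain ⟨a, b, hb, rfl⟩ := exists_eq_C_add_sum_of_totalDegree_eq_one (p := f) (by omega)
    obtain ⟨i, hi⟩ := Function.ne_iff.1 hb
    obtain ⟨j, hij⟩ := exists_ne i
    let x : Fin 3 → ℝ := Pi.single i (-(a + b j) / b i) + Pi.single j 1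
    have hx : eval x (C a + ∑ k, C (b k) * X k) = 0 := by
      simp only [Pi.zero_apply] at hi
      simp [x, mul_add, Finset.sum_add_distrib, Pi.single_apply]
      field_simp
      ring
    have h0 := congrArg (eval x) hfg
    rw [map_mul, hx, zero_mul, map_sum] at h0
    have h1 := (Finset.sum_eq_zero_iff_of_nonneg (fun k _ => by simp; positivity)).1 h0 j
      (Finset.mem_univ j)
    simp [x, hij] at h1

lemma not_sum_X_sq_dvd_X (i : Fin 3) :
    ¬ (∑ k : Fin 3, X k ^ 2 : MvPolynomial (Fin 3) ℝ) ∣ X i := by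
  rintro ⟨r, hr⟩
  have hr0 : r ≠ 0 := by rintro rfl; simp at hr
  have := congrArg totalDegree hr
  rw [totalDegree_mul_of_isDomain sum_X_sq_ne_zero hr0,
    isHomogeneous_sum_X_sq.totalDegree sum_X_sq_ne_zero, totalDegree_X] at this
  omega

/-- If the third and fourth order relations of a family of circles hold identically, then
`A ∧ X` is divisible by `X₀² + X₁² + X₂²`. -/
lemma sum_X_sq_dvd_wedge {A B D : Fin 3 → MvPolynomial (Fin 3) ℝ}
    (h3 : ∀ i j, (∑ k, X k ^ 2) * (B i * X j - B j * X i) =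
      2 * (∑ k, X k * A k) * (A i * X j - A j * X i))
    (h4 : ∀ i j, (∑ k, X k ^ 2) * (D i * X j - D j * X i) =
      (∑ k, A k ^ 2 + 2 * ∑ k, X k * B k) * (A i * X j - A j * X i)) (i j : Fin 3) :
    (∑ k, X k ^ 2) ∣ A i * X j - A j * X i := by
  have hq := prime_sum_X_sq
  have hq0 := sum_X_sq_ne_zero
  set q : MvPolynomial (Fin 3) ℝ := ∑ k, X k ^ 2 with hqdef
  have h2u : ∀ p : MvPolynomial (Fin 3) ℝ, q ∣ 2 * p → q ∣ p := by
    intro p hp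
    have : p = C (1 / 2) * (2 * p) := by
      rw [← mul_assoc, show (2 : MvPolynomial (Fin 3) ℝ) = C 2 from (map_ofNat C 2).symm, ← C_mul]
      norm_num
    rw [this]
    exact hp.mul_left _
  by_contra hN
  have hXA : q ∣ ∑ k, X k * A k := h2u _ <|
    (hq.dvd_or_dvd (Dvd.intro _ (h3 i j))).resolve_right hN
  have hAB : q ∣ ∑ k, A k ^ 2 + 2 * ∑ k, X k * B k :=
    (hq.dvd_or_dvd (Dvd.intro _ (h4 i j))).resolve_right hN
  obtain ⟨l, hl⟩ := hXA
  have hB : ∀ i j, B i * X j - B j * X i = 2 * l * (A i * X j - A j * X i) := fun i j =>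
    mul_left_cancel₀ hq0 (by rw [h3 i j, hl]; ring)
  have hXB : q ∣ ∑ k, X k * B k := by
    refine (hq.dvd_or_dvd (b := X 0) ⟨B 0 - 2 * l * (A 0 - l * X 0), ?_⟩).resolve_right
      (not_sum_X_sq_dvd_X 0)
    have h01 := hB 0 1
    have h02 := hB 0 2
    simp only [hqdef, Fin.sum_univ_three] at hl ⊢
    linear_combination (-X 1) * h01 - X 2 * h02 + 2 * l * X 0 * hl
  obtain ⟨n, hn⟩ : q ∣ ∑ k, A k ^ 2 := (dvd_add_left (hXB.mul_left 2)).1 hAB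
  refine hN (hq.dvd_of_dvd_pow (n := 2) ?_)
  have hthird : ∀ i j k : Fin 3, q = X i ^ 2 + X j ^ 2 + X k ^ 2 →
      q * n = A i ^ 2 + A j ^ 2 + A k ^ 2 → q * l = X i * A i + X j * A j + X k * A k →
      q ∣ (A i * X j - A j * X i) ^ 2 := fun i j k h₁ h₂ h₃ =>
    ⟨q * n - A k ^ 2 - n * X k ^ 2 - q * l ^ 2 + 2 * l * (X k * A k), by
      linear_combination (-A i ^ 2 - A j ^ 2) * h₁ + (X k ^ 2 - q) * h₂ +
        (q * l + X i * A i + X j * A j - X k * A k) * h₃⟩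
  obtain rfl | hij := eq_or_ne i j
  · simp
  obtain ⟨k, hk⟩ := Fin.exists_sum_eq_add_add (M := MvPolynomial (Fin 3) ℝ) hij
  exact hthird i j k (by rw [hqdef, hk]) (by rw [← hn, hk]) (by rw [← hl, hk])

lemma exists_wedge_eq_of_sum_X_sq_dvd {A : Fin 3 → MvPolynomial (Fin 3) ℝ}
    (hA : ∀ i, (A i).IsHomogeneous 2)
    (h : ∀ i j, (∑ k, X k ^ 2) ∣ A i * X j - A j * X i) :
    ∃ w : Fin 3 → ℝ, ∀ (v : Fin 3 → ℝ) (i j : Fin 3),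
      eval v (A i) * v j - eval v (A j) * v i = (∑ k, v k ^ 2) * (w i * v j - w j * v i) := by
  have hM : ∀ i j, ∃ b : Fin 3 → ℝ,
      A i * X j - A j * X i = (∑ k, X k ^ 2) * ∑ k, C (b k) * X k := by
    intro i j
    have hhom : (A i * X j - A j * X i).IsHomogeneous (2 + 1) :=
      ((hA i).mul (isHomogeneous_X _ j)).sub ((hA j).mul (isHomogeneous_X _ i))
    obtain ⟨r, hr, hr'⟩ := isHomogeneous_sum_X_sq.exists_isHomogeneous_of_dvd hhom (h i j)
    obtain ⟨b, rfl⟩ := hr.exists_eq_sum_C_mul_X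
    exact ⟨b, hr'⟩
  obtain ⟨a, ha⟩ := hM 1 2
  obtain ⟨b, hb⟩ := hM 2 0
  obtain ⟨c, hc⟩ := hM 0 1
  have hplucker : (∑ k, C (a k) * X k) * X 0 + (∑ k, C (b k) * X k) * X 1 +
      (∑ k, C (c k) * X k) * X 2 = (0 : MvPolynomial (Fin 3) ℝ) :=
    mul_left_cancel₀ sum_X_sq_ne_zero <| by
      linear_combination (-X 0) * ha - X 1 * hb - X 2 * hc
  have hev := fun v : Fin 3 → ℝ => congrArg (eval v) hplucker
  simp only [Fin.sum_univ_three, map_add, map_mul, eval_C, eval_X, map_zero] at hev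
  have e0 := hev ![1, 0, 0]
  have e1 := hev ![0, 1, 0]
  have e2 := hev ![0, 0, 1]
  have e01 := hev ![1, 1, 0]
  have e02 := hev ![1, 0, 1]
  have e12 := hev ![0, 1, 1]
  simp at e0 e1 e2 e01 e02 e12
  refine ⟨![c 1, a 2, b 0], fun v i j => ?_⟩
  have hav := congrArg (eval v) ha
  have hbv := congrArg (eval v) hb
  have hcv := congrArg (eval v) hc
  simp only [Fin.sum_univ_three, map_add, map_mul, eval_C, eval_X, map_sub, map_pow]
    at hav hbv hcv ⊢
  obtain ha1 : a 1 = - b 0 := by linarith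
  obtain hb2 : b 2 = - c 1 := by linarith
  obtain hc0 : c 0 = - a 2 := by linarith
  rw [e0, ha1] at hav
  rw [e1, hb2] at hbv
  rw [e2, hc0] at hcv
  fin_cases i <;> fin_cases j <;> simp <;> linarith

/-- If the forms of degree `n + m`, `0 < m`, vanishing on `S` are all proportional, then no
nonzero form of degree `n` vanishes on `S`. -/
lemma eq_zero_of_forall_eq_smul {S : Set (Fin 3 → ℝ)} {p₀ : MvPolynomial (Fin 3) ℝ} {n m : ℕ}
    (hm : m ≠ 0) (hS : ∀ p : MvPolynomial (Fin 3) ℝ, p.IsHomogeneous (n + m) →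
      (∀ v ∈ S, eval v p = 0) → ∃ t : ℝ, p = t • p₀)
    {p : MvPolynomial (Fin 3) ℝ} (hp : p.IsHomogeneous n) (hpS : ∀ v ∈ S, eval v p = 0) :
    p = 0 := by
  have h := fun i : Fin 3 => hS (p * X i ^ m) (hp.mul (isHomogeneous_X_pow i m))
    fun v hv => by simp [hpS v hv]
  obtain ⟨t, ht⟩ := h 0
  obtain ⟨s, hs⟩ := h 1
  by_contra hp0
  have hst : C s * X 0 ^ m = (C t * X 1 ^ m : MvPolynomial (Fin 3) ℝ) := by
    refine mul_left_cancel₀ hp0 ?_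
    simp only [smul_eq_C_mul] at hs ht
    linear_combination C s * ht - C t * hs
  have hs0 : s = 0 := by simpa [hm] using congrArg (eval ![1, 0, 0]) hst
  rw [hs0, zero_smul] at hs
  exact hp0 ((mul_eq_zero.1 hs).resolve_right (pow_ne_zero _ (X_ne_zero 1)))

end MvPolynomial

section Circle

variable {E : Type*} [NormedAddCommGroup E] [InnerProductSpace ℝ E]

/-- The line `T` tangent at the origin to the circle with center `c` in the plane `W`. -/
lemma finrank_inf_orthogonal_singleton [FiniteDimensional ℝ E] {W : Submodule ℝ E} {c : E}
    (hW : finrank ℝ W = 2) (hcW : c ∈ W) (hc : c ≠ 0) :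
    finrank ℝ (W ⊓ (ℝ ∙ c)ᗮ : Submodule ℝ E) = 1 := by
  have h := Submodule.finrank_add_inf_finrank_orthogonal
    ((Submodule.span_singleton_le_iff_mem c W).2 hcW)
  rw [finrank_span_singleton hc, hW, inf_comm] at h
  omega

lemma exists_eq_smul_add_smul_of_mem_plane [FiniteDimensional ℝ E] {W : Submodule ℝ E} {c v x : E}
    (hW : finrank ℝ W = 2) (hcW : c ∈ W) (hc : c ≠ 0) (hv : v ∈ W ⊓ (ℝ ∙ c)ᗮ) (hv0 : v ≠ 0)
    (hx : x ∈ W) : ∃ s : ℝ, x = (inner ℝ c x / ‖c‖ ^ 2) • c + s • v := by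
  have hc' : ‖c‖ ^ 2 ≠ 0 := by simpa using hc
  have hT := finrank_inf_orthogonal_singleton hW hcW hc
  have hy : x - (inner ℝ c x / ‖c‖ ^ 2) • c ∈ W ⊓ (ℝ ∙ c)ᗮ := by
    refine Submodule.mem_inf.2 ⟨W.sub_mem hx (W.smul_mem _ hcW), ?_⟩
    rw [Submodule.mem_orthogonal_singleton_iff_inner_right, inner_sub_right, inner_smul_right,
      real_inner_self_eq_norm_sq]
    field_simp
    ring
  obtain ⟨s, hs⟩ := (finrank_eq_one_iff_of_nonzero' (⟨v, hv⟩ : (W ⊓ (ℝ ∙ c)ᗮ : Submodule ℝ E))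
    (by simpa using hv0)).1 hT ⟨_, hy⟩
  refine ⟨s, ?_⟩
  have := congrArg Subtype.val hs
  simp only [SetLike.mk_smul_mk] at this
  rw [this]
  abel

lemma norm_sub_eq_norm_iff {x c : E} : ‖x - c‖ = ‖c‖ ↔ ‖x‖ ^ 2 = 2 * inner ℝ c x := by
  rw [← sq_eq_sq₀ (norm_nonneg _) (norm_nonneg _), norm_sub_sq_real, real_inner_comm]
  constructor <;> intro h <;> linarith

/-- A circle through the origin with prescribed tangent vector there has a `C¹` parametrization
near the origin. -/
lemma exists_circle_parametrization {W : Submodule ℝ E} {c v : E} (hcW : c ∈ W) (hc : c ≠ 0)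
    (hv : v ∈ W ⊓ (ℝ ∙ c)ᗮ) : ∃ γ : ℝ → E, γ 0 = 0 ∧ HasStrictDerivAt γ v 0 ∧
      ∀ t, γ t ∈ W ∧ ‖γ t - c‖ = ‖c‖ := by
  have hc' : ‖c‖ ^ 2 ≠ 0 := by simpa using hc
  have hcv : inner ℝ c v = 0 := (Submodule.mem_orthogonal_singleton_iff_inner_right).1 hv.2
  set b : ℝ := ‖v‖ ^ 2 / (2 * ‖c‖ ^ 2) with hb
  have hden : ∀ t : ℝ, 1 + t ^ 2 * (b / 2) ≠ 0 := fun t => by positivity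
  refine ⟨fun t => (1 + t ^ 2 * (b / 2))⁻¹ • (t • v + (t ^ 2 * b) • c), by simp, ?_, fun t =>
    ⟨W.smul_mem _ (W.add_mem (W.smul_mem _ hv.1) (W.smul_mem _ hcW)), ?_⟩⟩
  · have hcd : ContDiffAt ℝ 1
        (fun t : ℝ => (1 + t ^ 2 * (b / 2))⁻¹ • (t • v + (t ^ 2 * b) • c)) 0 := by
      refine ContDiffAt.smul (ContDiffAt.inv (by fun_prop) (hden 0)) (by fun_prop)
    refine hcd.hasStrictDerivAt' ?_ (by simp)
    have h1 : HasDerivAt (fun t : ℝ => t ^ 2) 0 0 := by simpa using hasDerivAt_pow 2 (0 : ℝ)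
    have h2 := ((h1.mul_const (b / 2)).const_add 1).inv (hden 0)
    have h3 := ((hasDerivAt_id (0 : ℝ)).smul_const v).add ((h1.mul_const b).smul_const c)
    simpa using! h2.smul h3
  · rw [norm_sub_eq_norm_iff, norm_smul, mul_pow, inner_smul_right, inner_add_right,
      inner_smul_right, inner_smul_right, hcv, real_inner_self_eq_norm_sq, norm_add_sq_real,
      inner_smul_left, inner_smul_right, real_inner_comm, hcv, norm_smul, norm_smul]
    have hb' : ‖v‖ ^ 2 = b * (2 * ‖c‖ ^ 2) := by rw [hb]; field_simp
    have hd : 2 + t ^ 2 * b ≠ 0 := by positivity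
    simp only [mul_pow, Real.norm_eq_abs, sq_abs, hb']
    rw [inv_pow]
    field_simp
    ring

/-- If a local diffeomorphism maps a curve on `C` into a line, then its inverse maps the
corresponding line germ into `C`. -/
lemma eventually_mem_of_map_subset_line {F : Type*} [NormedAddCommGroup F] [InnerProductSpace ℝ F]
    {C U : Set E} (hU : U ∈ 𝓝 (0 : E)) {Φ : E → F} {Ψ : F → E} {Φ' : E →L[ℝ] F}
    (hΦ : HasStrictFDerivAt Φ Φ' 0) (hinv : ∀ x ∈ U, Ψ (Φ x) = x) {γ : ℝ → E} {v : E}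
    (hγ0 : γ 0 = 0) (hγ : HasStrictDerivAt γ v 0) (hγC : ∀ t, γ t ∈ C) (hv : Φ' v ≠ 0) {w : F}
    (hline : ∀ x ∈ C ∩ U, ∃ s : ℝ, Φ x - Φ 0 = s • w) :
    ∀ᶠ t in 𝓝 (0 : ℝ), Ψ (Φ 0 + t • Φ' v) ∈ C := by
  have hγU : ∀ᶠ t in 𝓝 (0 : ℝ), γ t ∈ U :=
    hγ.hasDerivAt.continuousAt.preimage_mem_nhds (by rwa [hγ0])
  have hφ : HasStrictDerivAt (fun t => Φ (γ t) - Φ 0) (Φ' v) 0 := by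
    have h := HasStrictFDerivAt.comp_hasStrictDerivAt (l := Φ) (l' := Φ') (0 : ℝ)
      (by rwa [hγ0]) hγ
    exact h.sub_const _
  let u : ℝ → ℝ := fun t => inner ℝ w (Φ (γ t) - Φ 0) / ‖w‖ ^ 2
  have hu : HasStrictDerivAt u (inner ℝ w (Φ' v) / ‖w‖ ^ 2) 0 := by
    have h := ((innerSL ℝ w).hasStrictFDerivAt.comp_hasStrictDerivAt (0 : ℝ) hφ).div_const
      (‖w‖ ^ 2)
    simpa using! h
  have huw : ∀ᶠ t in 𝓝 (0 : ℝ), Φ (γ t) - Φ 0 = u t • w := by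
    filter_upwards [hγU] with t ht
    obtain ⟨s, hs⟩ := hline _ ⟨hγC t, ht⟩
    obtain rfl | hw := eq_or_ne w 0
    · simp [hs]
    · have hw' : ‖w‖ ^ 2 ≠ 0 := by simpa using hw
      simp only [u, hs, inner_smul_right, real_inner_self_eq_norm_sq]
      rw [mul_div_cancel_right₀ _ hw']
  set a := inner ℝ w (Φ' v) / ‖w‖ ^ 2 with ha
  have haw : Φ' v = a • w :=
    (hφ.hasDerivAt.congr_of_eventuallyEq (huw.mono fun t ht => ht.symm)).unique
      (hu.hasDerivAt.smul_const w)
  have ha0 : a ≠ 0 := by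
    rintro h
    rw [haw, h, zero_smul] at hv
    exact hv rfl
  have hs : HasStrictDerivAt (fun t => u t / a) 1 0 := by
    simpa [ha0] using hu.div_const a
  have hs0 : u 0 / a = 0 := by simp [u, hγ0]
  have hmap := hs.map_nhds_eq one_ne_zero
  rw [hs0] at hmap
  rw [← hmap, eventually_map]
  filter_upwards [huw, hγU] with t ht htU
  rw [haw, smul_smul, div_mul_cancel₀ _ ha0, ← ht, add_sub_cancel, hinv _ htU]
  exact hγC t

end Circle

lemma circle_wedge_eq {W : Submodule ℝ (EuclideanSpace ℝ (Fin 3))}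
    {c v x : EuclideanSpace ℝ (Fin 3)} (hW : finrank ℝ W = 2) (hcW : c ∈ W) (hc : c ≠ 0)
    (hv : v ∈ W ⊓ (ℝ ∙ c)ᗮ) (hx : x ∈ W) (hxc : ‖x - c‖ = ‖c‖) (i j : Fin 3) :
    x i * v j - x j * v i =
      (∑ k, x k ^ 2) * ((c i * v j - c j * v i) / (2 * ‖c‖ ^ 2)) := by
  obtain rfl | hv0 := eq_or_ne v 0
  · simp
  have hc' : ‖c‖ ^ 2 ≠ 0 := by simpa using hc
  obtain ⟨s, hs⟩ := exists_eq_smul_add_smul_of_mem_plane hW hcW hc hv hv0 hx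
  rw [norm_sub_eq_norm_iff, EuclideanSpace.real_norm_sq_eq] at hxc
  rw [hxc]
  have h := fun k => congrArg (fun y : EuclideanSpace ℝ (Fin 3) => y k) hs
  simp only [PiLp.add_apply, PiLp.smul_apply, smul_eq_mul] at h
  rw [h i, h j]
  field_simp
  ring

lemma inversion_mem_circle {W : Submodule ℝ (EuclideanSpace ℝ (Fin 3))}
    {c v w : EuclideanSpace ℝ (Fin 3)} (hcW : c ∈ W) (hc : c ≠ 0)
    (hv : v ∈ W ⊓ (ℝ ∙ c)ᗮ) (hv0 : v ≠ 0)
    (h : ∀ i j, (c i * v j - c j * v i) / (2 * ‖c‖ ^ 2) = w i * v j - w j * v i) :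
    w ≠ 0 ∧ (‖w‖ ^ 2)⁻¹ • w ∈ W ∧ ‖(‖w‖ ^ 2)⁻¹ • w - c‖ = ‖c‖ := by
  have hc' : ‖c‖ ^ 2 ≠ 0 := by simpa using hc
  have hv' : ‖v‖ ^ 2 ≠ 0 := by simpa using hv0
  have hcv : inner ℝ c v = 0 := (Submodule.mem_orthogonal_singleton_iff_inner_right).1 hv.2
  have hw : w = (2 * ‖c‖ ^ 2)⁻¹ • c + (inner ℝ w v / ‖v‖ ^ 2) • v := by
    ext i
    have h0 := h i 0
    have h1 := h i 1
    have h2 := h i 2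
    simp only [PiLp.inner_apply, RCLike.inner_apply, conj_trivial, Fin.sum_univ_three,
      EuclideanSpace.real_norm_sq_eq, PiLp.add_apply, PiLp.smul_apply, smul_eq_mul]
      at h0 h1 h2 hcv hv' hc' ⊢
    field_simp at h0 h1 h2 ⊢
    linear_combination (-v 0) * h0 - v 1 * h1 - v 2 * h2 - v i * hcv
  have hcw : inner ℝ c w = 1 / 2 := by
    rw [hw, inner_add_right, inner_smul_right, inner_smul_right, hcv, real_inner_self_eq_norm_sq]
    field_simp
    ring
  have hw0 : w ≠ 0 := by
    rintro rfl
    norm_num at hcw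
  have hw' : ‖w‖ ^ 2 ≠ 0 := by simpa using hw0
  refine ⟨hw0, W.smul_mem _ ?_, ?_⟩
  · rw [hw]
    exact W.add_mem (W.smul_mem _ hcW) (W.smul_mem _ hv.1)
  · rw [norm_sub_eq_norm_iff, norm_smul, inner_smul_right, hcw, mul_pow, norm_inv, norm_pow,
      norm_norm]
    field_simp

/-- Taylor expansion to order four, along lines through the origin, of a map tangent to the
identity at the origin. -/
lemma exists_taylor_of_tangent_id
    {F : EuclideanSpace ℝ (Fin 3) → EuclideanSpace ℝ (Fin 3)} (hF : ContDiffAt ℝ 4 F 0)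
    (hF0 : F 0 = 0) (hF' : HasFDerivAt F (ContinuousLinearMap.id ℝ _) 0) :
    ∃ A B D : Fin 3 → MvPolynomial (Fin 3) ℝ, (∀ k, (A k).IsHomogeneous 2) ∧
      (∀ k, (B k).IsHomogeneous 3) ∧ (∀ k, (D k).IsHomogeneous 4) ∧
      ∀ (v : EuclideanSpace ℝ (Fin 3)) (k : Fin 3),
        (fun t : ℝ => F (t • v) k - (t * v k + t ^ 2 * MvPolynomial.eval (fun s => v s) (A k) +
          t ^ 3 * MvPolynomial.eval (fun s => v s) (B k) +
          t ^ 4 * MvPolynomial.eval (fun s => v s) (D k))) =o[𝓝 0] fun t => t ^ 4 := by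
  have hcoord : ∀ k, ContDiffAt ℝ (4 : ℕ) (fun x => F x k) 0 := fun k =>
    ((EuclideanSpace.proj (𝕜 := ℝ) k).contDiff.contDiffAt (x := F 0)).comp 0 hF
  choose p hp hpe hpo using fun k => exists_isHomogeneous_taylor (hcoord k)
  have h0 : ∀ k (v : EuclideanSpace ℝ (Fin 3)), MvPolynomial.eval (fun s => v s) (p k 0) = 0 := fun k v => by
    simp [hpe, hF0]
  have h1 : ∀ k (v : EuclideanSpace ℝ (Fin 3)),
      MvPolynomial.eval (fun s => v s) (p k 1) = v k := fun k v => by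
    have h := ((EuclideanSpace.proj (𝕜 := ℝ) k).hasFDerivAt (x := F 0)).comp 0 hF'
    have h' : fderiv ℝ (fun x => F x k) 0 = _ := h.fderiv
    simp [hpe, h']
  refine ⟨fun k => p k 2, fun k => p k 3, fun k => p k 4, fun k => hp k 2, fun k => hp k 3,
    fun k => hp k 4, fun v k => (hpo k v).congr_left fun t => ?_⟩
  simp [Finset.sum_range_succ, h0, h1]

/-- **the 54-circles theorem.** Let `(C i)` be a family of circles in `ℝ³`
(each given by center `c i`, radius `r i > 0` and a two-dimensional affine subspace
`P i ∋ c i`), all passing through the origin, such that distinct circles have distinct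
tangent lines `T i = (P i).direction ⊓ (ℝ∙(c i))ᗮ` at the origin.  Assume the family
contains 54 circles whose tangent lines are generic: the space of homogeneous degree-9
polynomials in three variables vanishing on all 54 lines is one-dimensional.  If some
smooth diffeomorphism `Φ` of a neighborhood `U` of `0` onto an open subset of `ℝ³`
maps every `C i ∩ U` into an affine line, then all the circles `C i` pass through a
common point `Q ≠ 0`. -/
theorem fiftyFour_circles_theorem {ι : Type*}
    (c : ι → EuclideanSpace ℝ (Fin 3)) (r : ι → ℝ)
    (P : ι → AffineSubspace ℝ (EuclideanSpace ℝ (Fin 3)))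
    (hr : ∀ i, 0 < r i) (hcP : ∀ i, c i ∈ P i)
    (hdim : ∀ i, finrank ℝ (P i).direction = 2)
    (C : ι → Set (EuclideanSpace ℝ (Fin 3)))
    (hC : ∀ i, C i = sphere (c i) (r i) ∩ (P i : Set (EuclideanSpace ℝ (Fin 3))))
    (h0 : ∀ i, (0 : EuclideanSpace ℝ (Fin 3)) ∈ C i)
    -- the tangent line of `C i` at the origin
    (T : ι → Submodule ℝ (EuclideanSpace ℝ (Fin 3)))
    (hT : ∀ i, T i = (P i).direction ⊓ (ℝ ∙ (c i))ᗮ)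
    -- the bundle is simple: distinct circles have distinct tangent lines at the origin
    (hsimple : ∀ i j, C i ≠ C j → T i ≠ T j)
    -- 54 circles of the family whose tangent lines at the origin are generic
    (σ : Fin 54 → ι)
    (hgen : ∃ p₀ : MvPolynomial (Fin 3) ℝ, p₀ ≠ 0 ∧ p₀.IsHomogeneous 9 ∧
      (∀ j : Fin 54, ∀ v ∈ T (σ j), MvPolynomial.eval (fun s => v s) p₀ = 0) ∧
      ∀ p : MvPolynomial (Fin 3) ℝ, p.IsHomogeneous 9 →
        (∀ j : Fin 54, ∀ v ∈ T (σ j), MvPolynomial.eval (fun s => v s) p = 0) →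
        ∃ t : ℝ, p = t • p₀)
    -- a smooth diffeomorphism of a neighborhood of `0` onto an open set,
    -- mapping every circle of the family into an affine line
    (U : Set (EuclideanSpace ℝ (Fin 3))) (hUopen : IsOpen U)
    (h0U : (0 : EuclideanSpace ℝ (Fin 3)) ∈ U)
    (Φ Ψ : EuclideanSpace ℝ (Fin 3) → EuclideanSpace ℝ (Fin 3))
    (hΦ : ContDiffOn ℝ (⊤ : ℕ∞) Φ U) (hinj : Set.InjOn Φ U)
    (himage : IsOpen (Φ '' U)) (hΨ : ContDiffOn ℝ (⊤ : ℕ∞) Ψ (Φ '' U))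
    (hinv : ∀ x ∈ U, Ψ (Φ x) = x)
    (hline : ∀ i, ∃ L : AffineSubspace ℝ (EuclideanSpace ℝ (Fin 3)),
      finrank ℝ L.direction = 1 ∧ Φ '' (C i ∩ U) ⊆ (L : Set (EuclideanSpace ℝ (Fin 3)))) :
    ∃ Q : EuclideanSpace ℝ (Fin 3), Q ≠ 0 ∧ ∀ i, Q ∈ C i := by
  have h0P : ∀ i, (0 : EuclideanSpace ℝ (Fin 3)) ∈ P i := fun i => by
    have := h0 i
    rw [hC] at this
    exact this.2
  have hmemP : ∀ i x, x ∈ P i ↔ x ∈ (P i).direction := fun i x => by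
    simpa using (AffineSubspace.vsub_right_mem_direction_iff_mem (h0P i) x).symm
  have hrc : ∀ i, r i = ‖c i‖ := fun i => by
    have := h0 i
    rw [hC] at this
    simpa using this.1.symm
  have hc0 : ∀ i, c i ≠ 0 := fun i => norm_pos_iff.1 (hrc i ▸ hr i)
  have hcW : ∀ i, c i ∈ (P i).direction := fun i => (hmemP i _).1 (hcP i)
  have hmemC : ∀ i x, x ∈ C i ↔ x ∈ (P i).direction ∧ ‖x - c i‖ = ‖c i‖ := fun i x => by
    rw [hC, Set.mem_inter_iff, mem_sphere_iff_norm, hrc i, SetLike.mem_coe, hmemP, and_comm]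
  have hU : U ∈ 𝓝 (0 : EuclideanSpace ℝ (Fin 3)) := hUopen.mem_nhds h0U
  have hΦ0 : ContDiffAt ℝ (⊤ : ℕ∞) Φ 0 := hΦ.contDiffAt hU
  have hΨ0 : ContDiffAt ℝ (⊤ : ℕ∞) Ψ (Φ 0) :=
    hΨ.contDiffAt (himage.mem_nhds (Set.mem_image_of_mem Φ h0U))
  set L := fderiv ℝ Φ 0
  have hΦs : HasStrictFDerivAt Φ L 0 := hΦ0.hasStrictFDerivAt (by simp)
  have hΨL : (fderiv ℝ Ψ (Φ 0)).comp L = ContinuousLinearMap.id ℝ _ := by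
    have h := (hΨ0.differentiableAt (by simp)).hasFDerivAt.comp 0 hΦs.hasFDerivAt
    refine h.unique ((hasFDerivAt_id (0 : EuclideanSpace ℝ (Fin 3))).congr_of_eventuallyEq ?_)
    filter_upwards [hU] with x hx using hinv x hx
  have hLinj : ∀ v, v ≠ 0 → L v ≠ 0 := fun v hv hLv => hv <| by
    simpa [hLv] using (DFunLike.congr_fun hΨL v).symm
  let F : EuclideanSpace ℝ (Fin 3) → EuclideanSpace ℝ (Fin 3) := fun z => Ψ (Φ 0 + L z)
  have hF0 : F 0 = 0 := by simp [F, hinv 0 h0U]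
  have hF : ContDiffAt ℝ 4 F 0 :=
    ContDiffAt.comp (g := Ψ) (f := fun z => Φ 0 + L z) (0 : EuclideanSpace ℝ (Fin 3))
      (by simpa using contDiffAt_infty.1 hΨ0 4) (by fun_prop)
  have hF' : HasFDerivAt F (ContinuousLinearMap.id ℝ _) 0 := by
    rw [← hΨL]
    exact HasFDerivAt.comp (g := Ψ) (f := fun z => Φ 0 + L z) (0 : EuclideanSpace ℝ (Fin 3))
      (by simpa using (hΨ0.differentiableAt (by simp)).hasFDerivAt)
      (L.hasFDerivAt.const_add (Φ 0))
  have hFC : ∀ i, ∀ v ∈ T i, ∀ᶠ t in 𝓝 (0 : ℝ), F (t • v) ∈ C i := by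
    intro i v hv
    obtain rfl | hv0 := eq_or_ne v 0
    · simp [hF0, h0 i]
    rw [hT] at hv
    obtain ⟨γ, hγ0, hγ, hγC⟩ := exists_circle_parametrization (hcW i) (hc0 i) hv
    obtain ⟨l, hl, hΦl⟩ := hline i
    obtain ⟨w, -, hw⟩ := finrank_eq_one_iff'.1 hl
    have hlw : ∀ x ∈ C i ∩ U, ∃ s : ℝ, Φ x - Φ 0 = s • (w : EuclideanSpace ℝ (Fin 3)) := fun x hx => by
      obtain ⟨s, hs⟩ := hw ⟨_, AffineSubspace.vsub_mem_direction
        (hΦl (Set.mem_image_of_mem Φ hx)) (hΦl (Set.mem_image_of_mem Φ ⟨h0 i, h0U⟩))⟩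
      exact ⟨s, by simpa using (congrArg Subtype.val hs).symm⟩
    simpa [F] using eventually_mem_of_map_subset_line hU hΦs hinv hγ0 hγ
      (fun t => (hmemC i _).2 (hγC t)) (hLinj v hv0) hlw
  obtain ⟨A, B, D, hA, hB, hD, hTaylor⟩ := exists_taylor_of_tangent_id hF hF0 hF'
  have hrel := fun i v (hv : v ∈ T i) a b =>
    circle_taylor_relations (f := fun t k => F (t • v) k) (i := a) (j := b) (hTaylor v)
      ((hFC i v hv).mono fun t ht => circle_wedge_eq (hdim i) (hcW i) (hc0 i) (hT i ▸ hv)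
        ((hmemC i _).1 ht).1 ((hmemC i _).1 ht).2 a b)
  obtain ⟨p₀, -, -, -, hp₀⟩ := hgen
  let S : Set (Fin 3 → ℝ) := {x | ∃ j, ∃ v ∈ T (σ j), (fun s => v s) = x}
  have hS : ∀ p : MvPolynomial (Fin 3) ℝ, p.IsHomogeneous 9 →
      (∀ x ∈ S, MvPolynomial.eval x p = 0) → ∃ t : ℝ, p = t • p₀ := fun p hp hpS =>
    hp₀ p hp fun j v hv => hpS _ ⟨j, v, hv, rfl⟩
  have hX := MvPolynomial.isHomogeneous_X (R := ℝ) (σ := Fin 3)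
  have hwedge : ∀ {G : Fin 3 → MvPolynomial (Fin 3) ℝ} {n : ℕ}, (∀ k, (G k).IsHomogeneous n) →
      ∀ a b, (G a * MvPolynomial.X b - G b * MvPolynomial.X a).IsHomogeneous (n + 1) :=
    fun hG a b => ((hG a).mul (hX b)).sub ((hG b).mul (hX a))
  have hdot : ∀ {G : Fin 3 → MvPolynomial (Fin 3) ℝ} {n : ℕ}, (∀ k, (G k).IsHomogeneous n) →
      (2 * ∑ k, MvPolynomial.X k * G k).IsHomogeneous (1 + n) := fun hG => by
    rw [← map_ofNat MvPolynomial.C 2]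
    exact (MvPolynomial.IsHomogeneous.sum _ _ _ fun k _ => (hX k).mul (hG k)).C_mul _
  have h3 : ∀ a b, (∑ k, MvPolynomial.X k ^ 2) * (B a * MvPolynomial.X b - B b * MvPolynomial.X a) =
      2 * (∑ k, MvPolynomial.X k * A k) * (A a * MvPolynomial.X b - A b * MvPolynomial.X a) := by
    intro a b
    rw [← sub_eq_zero]
    refine MvPolynomial.eq_zero_of_forall_eq_smul (n := 6) (m := 3) (by norm_num) hS
      ((MvPolynomial.isHomogeneous_sum_X_sq.mul (hwedge hB a b)).sub
        ((hdot hA).mul (hwedge hA a b))) ?_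
    rintro _ ⟨j, v, hv, rfl⟩
    obtain ⟨e2, e3, -⟩ := hrel _ v hv a b
    simp only [map_sub, map_mul, map_sum, map_pow, MvPolynomial.eval_X, map_ofNat]
    rw [e2, e3]
    ring
  have h4 : ∀ a b, (∑ k, MvPolynomial.X k ^ 2) * (D a * MvPolynomial.X b - D b * MvPolynomial.X a) =
      (∑ k, A k ^ 2 + 2 * ∑ k, MvPolynomial.X k * B k) *
        (A a * MvPolynomial.X b - A b * MvPolynomial.X a) := by
    intro a b
    rw [← sub_eq_zero]
    refine MvPolynomial.eq_zero_of_forall_eq_smul (n := 7) (m := 2) (by norm_num) hS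
      ((MvPolynomial.isHomogeneous_sum_X_sq.mul (hwedge hD a b)).sub
        (((MvPolynomial.IsHomogeneous.sum _ _ _ fun k _ => (hA k).pow 2).add (hdot hB)).mul
          (hwedge hA a b))) ?_
    rintro _ ⟨j, v, hv, rfl⟩
    obtain ⟨e2, -, e4⟩ := hrel _ v hv a b
    simp only [map_sub, map_add, map_mul, map_sum, map_pow, MvPolynomial.eval_X, map_ofNat]
    rw [e2, e4]
    ring
  obtain ⟨w, hw⟩ := MvPolynomial.exists_wedge_eq_of_sum_X_sq_dvd hA
    (MvPolynomial.sum_X_sq_dvd_wedge h3 h4)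
  let y : EuclideanSpace ℝ (Fin 3) := WithLp.toLp 2 w
  have hall : ∀ i, y ≠ 0 ∧ (‖y‖ ^ 2)⁻¹ • y ∈ C i := by
    intro i
    obtain ⟨⟨v, hv⟩, hv0, -⟩ :=
      finrank_eq_one_iff'.1 (finrank_inf_orthogonal_singleton (hdim i) (hcW i) (hc0 i))
    replace hv0 : v ≠ 0 := by simpa using hv0
    rw [hmemC]
    refine inversion_mem_circle (hcW i) (hc0 i) hv hv0 fun a b => ?_
    have hvsq : ∑ k, v k ^ 2 ≠ 0 := by
      rw [← EuclideanSpace.real_norm_sq_eq]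
      simpa using hv0
    refine mul_left_cancel₀ hvsq ?_
    rw [← (hrel i v (hT i ▸ hv) a b).1]
    exact hw (fun s => v s) a b
  have hw0 := (hall (σ 0)).1
  exact ⟨_, smul_ne_zero (by simpa using hw0) hw0, fun i => (hall i).2⟩
end

section
/- Let P, Q ∈ ℝ[X, Y] be real polynomials in two variables. If the polynomial 1 + X² + Y² divides P² + Q² in ℝ[X, Y], then 1 + X² + Y² divides P and 1 + X² + Y² divides Q. -/
open MvPolynomial

/-- Over a domain in which `2 ≠ 0`, `a² + b² = 0` forces `a = 0`, and `k` is not a quotient of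
squares, the monic polynomial `X² + k` divides `p² + q²` only if it divides both `p` and `q`. -/
theorem Polynomial.X_sq_add_C_dvd_of_dvd_sq_add_sq {R : Type*} [CommRing R] [IsDomain R] {k : R}
    (htwo : (2 : R) ≠ 0) (hreal : ∀ a b : R, a ^ 2 + b ^ 2 = 0 → a = 0)
    (hk : ∀ s t : R, k * s ^ 2 = t ^ 2 → s = 0) {p q : Polynomial R}
    (h : (Polynomial.X ^ 2 + Polynomial.C k) ∣ p ^ 2 + q ^ 2) :
    (Polynomial.X ^ 2 + Polynomial.C k) ∣ p ∧ (Polynomial.X ^ 2 + Polynomial.C k) ∣ q := by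
  set M : Polynomial R := Polynomial.X ^ 2 + Polynomial.C k with hM
  have hmonic : M.Monic := Polynomial.monic_X_pow_add_C k two_ne_zero
  have hdeg : M.degree = 2 := Polynomial.degree_X_pow_add_C two_pos k
  have hrem (f : Polynomial R) :
      ∃ b a : R, f %ₘ M = Polynomial.C b * Polynomial.X + Polynomial.C a := by
    refine ⟨_, _, Polynomial.eq_X_add_C_of_degree_le_one (Order.le_of_lt_succ ?_)⟩
    exact (Polynomial.degree_modByMonic_lt f hmonic).trans_eq hdeg
  obtain ⟨b, a, hp⟩ := hrem p
  obtain ⟨d, c, hq⟩ := hrem q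
  have hpM := Polynomial.modByMonic_add_div p M
  have hqM := Polynomial.modByMonic_add_div q M
  have hdvd : M ∣ Polynomial.C (2 * (a * b + c * d)) * Polynomial.X +
      Polynomial.C (a ^ 2 + c ^ 2 - (b ^ 2 + d ^ 2) * k) := by
    obtain ⟨e, he⟩ := h
    rw [hp] at hpM
    rw [hq] at hqM
    refine ⟨e - (p /ₘ M) * (2 * p - M * (p /ₘ M)) - (q /ₘ M) * (2 * q - M * (q /ₘ M))
      - Polynomial.C (b ^ 2 + d ^ 2), ?_⟩
    have hb : Polynomial.C b * Polynomial.X + Polynomial.C a = p - M * (p /ₘ M) := by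
      exact eq_sub_of_add_eq hpM
    have hd : Polynomial.C d * Polynomial.X + Polynomial.C c = q - M * (q /ₘ M) := by
      exact eq_sub_of_add_eq hqM
    have hk' : Polynomial.C k = M - Polynomial.X ^ 2 := by rw [hM]; ring
    simp only [map_add, map_sub, map_mul, map_pow, map_ofNat, hk']
    linear_combination he + (Polynomial.C b * Polynomial.X + Polynomial.C a
      + (p - M * (p /ₘ M))) * hb + (Polynomial.C d * Polynomial.X + Polynomial.C c
      + (q - M * (q /ₘ M))) * hd
  have hzero := Polynomial.eq_zero_of_dvd_of_degree_lt hdvd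
    (hdeg ▸ Polynomial.degree_linear_le.trans_lt (by norm_num))
  have hlin : a * b + c * d = 0 := by
    have := congrArg (Polynomial.coeff · 1) hzero
    simpa [htwo, -map_add, -map_sub, -map_mul, -map_pow, Polynomial.coeff_C] using this
  have hconst : a ^ 2 + c ^ 2 - (b ^ 2 + d ^ 2) * k = 0 := by
    have := congrArg (Polynomial.coeff · 0) hzero
    simpa [-map_add, -map_sub, -map_mul, -map_pow] using this
  have hbd : b ^ 2 + d ^ 2 = 0 := hk _ (a * d - b * c) (by
    linear_combination (-(b ^ 2 + d ^ 2)) * hconst + (a * b + c * d) * hlin)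
  have hac : a ^ 2 + c ^ 2 = 0 := by linear_combination hconst + k * hbd
  rw [← Polynomial.modByMonic_eq_zero_iff_dvd hmonic,
    ← Polynomial.modByMonic_eq_zero_iff_dvd hmonic, hp, hq, hreal a c hac, hreal b d hbd,
    hreal c a (by rwa [add_comm]), hreal d b (by rwa [add_comm])]
  simp

/-- A sum of two squares of real polynomials vanishes only if the polynomials do. -/
theorem MvPolynomial.eq_zero_of_sq_add_sq_eq_zero {σ : Type*} {a b : MvPolynomial σ ℝ}
    (h : a ^ 2 + b ^ 2 = 0) : a = 0 := by
  refine MvPolynomial.funext fun x => ?_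
  have hx := congrArg (eval x) h
  simp only [map_add, map_pow, map_zero] at hx ⊢
  nlinarith [sq_nonneg (eval x a), sq_nonneg (eval x b)]

/-- `1 + X²` is not a square in a real polynomial ring. -/
theorem MvPolynomial.sq_ne_one_add_X_sq {σ : Type*} (i : σ) (u : MvPolynomial σ ℝ) :
    u ^ 2 ≠ 1 + X i ^ 2 := by
  intro h
  have hu : aeval (fun _ => Complex.I) u = 0 := by
    have := congrArg (aeval fun _ => Complex.I) h
    simpa using this
  have hd := congrArg (fun f => aeval (fun _ => Complex.I) (pderiv i f)) h
  simp [Derivation.leibniz_pow, hu] at hd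

/-- The polynomial `1 + X²` is not a quotient of squares. -/
theorem MvPolynomial.eq_zero_of_one_add_X_sq_mul_sq_eq_sq {σ : Type*} {i : σ}
    {s t : MvPolynomial σ ℝ} (h : (1 + X i ^ 2) * s ^ 2 = t ^ 2) : s = 0 := by
  by_contra hs
  obtain ⟨u, rfl⟩ : s ∣ t :=
    (IsIntegrallyClosed.pow_dvd_pow_iff two_ne_zero).1 ⟨1 + X i ^ 2, by rw [← h, mul_comm]⟩
  refine sq_ne_one_add_X_sq i u (mul_right_cancel₀ (pow_ne_zero 2 hs) ?_)
  rw [h]; ring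

/-- If `1 + X² + Y²` divides `P² + Q²` in `ℝ[X, Y]`, then it divides
both `P` and `Q`. -/
theorem one_add_X_sq_add_Y_sq_dvd_of_dvd_sq_add_sq (P Q : MvPolynomial (Fin 2) ℝ)
    (h : ((1 : MvPolynomial (Fin 2) ℝ) + X 0 ^ 2 + X 1 ^ 2) ∣ P ^ 2 + Q ^ 2) :
    ((1 : MvPolynomial (Fin 2) ℝ) + X 0 ^ 2 + X 1 ^ 2) ∣ P ∧
      ((1 : MvPolynomial (Fin 2) ℝ) + X 0 ^ 2 + X 1 ^ 2) ∣ Q := by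
  have himage : finSuccEquiv ℝ 1 (1 + X 0 ^ 2 + X 1 ^ 2) =
      Polynomial.X ^ 2 + Polynomial.C (1 + X 0 ^ 2) := by
    have hX : finSuccEquiv ℝ 1 (X 1) = Polynomial.C (X 0) := finSuccEquiv_X_succ (j := 0)
    simp only [map_add, map_one, map_pow, finSuccEquiv_X_zero, hX]
    ring
  rw [← map_dvd_iff (finSuccEquiv ℝ 1), himage, map_add (finSuccEquiv ℝ 1),
    map_pow (finSuccEquiv ℝ 1), map_pow (finSuccEquiv ℝ 1)] at h
  rw [← map_dvd_iff (finSuccEquiv ℝ 1), ← map_dvd_iff (finSuccEquiv ℝ 1) (b := Q), himage]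
  exact Polynomial.X_sq_add_C_dvd_of_dvd_sq_add_sq two_ne_zero
    (fun _ _ => eq_zero_of_sq_add_sq_eq_zero)
    (fun _ _ => eq_zero_of_one_add_X_sq_mul_sq_eq_sq) h
end

section
/- Let T be a finite set of 54 points in ℝ², and for each (k,m) ∈ T consider the line ℓ_{(k,m)} = ℝ·(1, k, m) through the origin in ℝ³. Assume that the 54 points are 9-good, i.e., the real vector space of homogeneous polynomials of degree 9 in three variables that vanish at (1, k, m) for every (k,m) ∈ T is one-dimensional. Then every real polynomial p in two variables of total degree at most 5 that vanishes at every point of T is identically zero. In particular, two polynomials of degree at most 5 that agree on T agree identically. -/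
open MvPolynomial

/-- The form of degree `d` in one more variable `X 0` obtained by homogenizing `p`
(meaningful when `p.totalDegree ≤ d`). -/
noncomputable def homogenization {R : Type*} [CommSemiring R] {n : ℕ} (d : ℕ)
    (p : MvPolynomial (Fin n) R) : MvPolynomial (Fin (n + 1)) R :=
  ∑ i ∈ Finset.range (d + 1), X 0 ^ (d - i) * rename Fin.succ (homogeneousComponent i p)

theorem isHomogeneous_homogenization {R : Type*} [CommSemiring R] {n : ℕ} (d : ℕ)
    (p : MvPolynomial (Fin n) R) : (homogenization d p).IsHomogeneous d := by
  refine IsHomogeneous.sum _ _ _ fun i hi => ?_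
  have h := (isHomogeneous_X_pow (R := R) (0 : Fin (n + 1)) (d - i)).mul
    ((homogeneousComponent_isHomogeneous i p).rename_isHomogeneous (f := Fin.succ))
  rwa [Nat.sub_add_cancel (Nat.lt_succ_iff.mp (Finset.mem_range.mp hi))] at h

theorem aeval_cons_one_homogenization {R A : Type*} [CommSemiring R] [CommSemiring A]
    [Algebra R A] {n d : ℕ} {p : MvPolynomial (Fin n) R} (hp : p.totalDegree ≤ d)
    (v : Fin n → A) :
    aeval (Fin.cons 1 v : Fin (n + 1) → A) (homogenization d p) = aeval v p := by
  have hsum : ∑ i ∈ Finset.range (d + 1), homogeneousComponent i p = p := by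
    conv_rhs => rw [← sum_homogeneousComponent p]
    refine (Finset.sum_subset (Finset.range_mono (by omega)) fun i _ hi => ?_).symm
    exact homogeneousComponent_eq_zero _ _ (by simpa using hi)
  have hcomp : (Fin.cons 1 v : Fin (n + 1) → A) ∘ Fin.succ = v := rfl
  conv_rhs => rw [← hsum]
  simp [homogenization, aeval_rename, hcomp]

/-- If the forms of degree `d + 1` vanishing at the points `(1, v)`, `v ∈ S`, are all multiples of
a single form, then no nonzero polynomial of degree at most `d` vanishes on `S`. -/
theorem eq_zero_of_vanishing_forms_multiples {K : Type*} [Field K] {n d : ℕ}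
    {S : Set (Fin (n + 1) → K)} {p₀ : MvPolynomial (Fin (n + 2)) K}
    (h₀ : ∀ q : MvPolynomial (Fin (n + 2)) K, q.IsHomogeneous (d + 1) →
      (∀ v ∈ S, eval (Fin.cons 1 v : Fin (n + 2) → K) q = 0) → ∃ t : K, q = t • p₀)
    {p : MvPolynomial (Fin (n + 1)) K} (hp : p.totalDegree ≤ d)
    (hS : ∀ v ∈ S, eval v p = 0) : p = 0 := by
  have key (j : Fin (n + 2)) : ∃ t : K, X j * homogenization d p = t • p₀ := by
    refine h₀ _ ?_ fun v hv => ?_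
    · simpa [add_comm] using (isHomogeneous_X K j).mul (isHomogeneous_homogenization d p)
    · have h := aeval_cons_one_homogenization hp v
      simp only [aeval_eq_eval, hS v hv] at h
      rw [map_mul]
      exact mul_eq_zero_of_right _ h
  obtain ⟨s, hs⟩ := key 0
  obtain ⟨t, ht⟩ := key 1
  have hzero : homogenization d p = 0 := by
    by_contra hne
    have hlin : (t • X 0 : MvPolynomial (Fin (n + 2)) K) = s • X 1 := by
      refine mul_right_cancel₀ hne ?_
      rw [smul_mul_assoc, smul_mul_assoc, hs, ht, smul_comm]
    have hs0 : s = 0 := by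
      have h := congrArg (eval (Pi.single 1 1)) hlin
      simpa [smul_eval] using h.symm
    rw [hs0, zero_smul] at hs
    exact (mul_ne_zero (X_ne_zero _) hne) hs
  have h := aeval_cons_one_homogenization hp (X : Fin (n + 1) → MvPolynomial (Fin (n + 1)) K)
  rw [hzero, map_zero, aeval_X_left_apply] at h
  exact h.symm

/-- If the 54 points of `T ⊆ ℝ²` are `9`-good (the space of homogeneous
degree-`9` polynomials in three variables vanishing at `(1,k,m)` for all `(k,m) ∈ T` is
one-dimensional), then every two-variable polynomial of total degree at most `5`
vanishing on `T` is identically zero; in particular two polynomials of degree at most `5`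
agreeing on `T` agree identically. -/
theorem nine_good_points_determine_deg_five_polys (T : Finset (ℝ × ℝ)) (hT : T.card = 54)
    (hgood : ∃ p₀ : MvPolynomial (Fin 3) ℝ, p₀ ≠ 0 ∧ p₀.IsHomogeneous 9 ∧
      (∀ km ∈ T, eval ![1, km.1, km.2] p₀ = 0) ∧
      ∀ p : MvPolynomial (Fin 3) ℝ, p.IsHomogeneous 9 →
        (∀ km ∈ T, eval ![1, km.1, km.2] p = 0) → ∃ t : ℝ, p = t • p₀) :
    (∀ p : MvPolynomial (Fin 2) ℝ, p.totalDegree ≤ 5 →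
      (∀ km ∈ T, eval ![km.1, km.2] p = 0) → p = 0) ∧
    (∀ p q : MvPolynomial (Fin 2) ℝ, p.totalDegree ≤ 5 → q.totalDegree ≤ 5 →
      (∀ km ∈ T, eval ![km.1, km.2] p = eval ![km.1, km.2] q) → p = q) := by
  obtain ⟨p₀, -, -, -, h₀⟩ := hgood
  have hzero : ∀ p : MvPolynomial (Fin 2) ℝ, p.totalDegree ≤ 5 →
      (∀ km ∈ T, eval ![km.1, km.2] p = 0) → p = 0 := by
    intro p hp hpT
    refine eq_zero_of_vanishing_forms_multiples (d := 8) (p₀ := p₀)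
      (S := Set.image (fun km : ℝ × ℝ => ![km.1, km.2]) T) (fun q hq hqS => ?_) (by omega) ?_
    · exact h₀ q hq fun km hkm => hqS _ ⟨km, hkm, rfl⟩
    · rintro _ ⟨km, hkm, rfl⟩
      exact hpT km hkm
  refine ⟨hzero, fun p q hp hq hpq => sub_eq_zero.mp (hzero _ ?_ fun km hkm => ?_)⟩
  · exact (totalDegree_sub p q).trans (max_le hp hq)
  · rw [map_sub, hpq km hkm, sub_self]
end

section
/- Let α, β, γ ∈ ℝ with (α, β, γ) ≠ (0,0,0), and set D = α² + β² + γ² and Q = (−α/D, β/D, γ/D) ∈ ℝ³. Then Q ≠ 0 and, for every k, m ∈ ℝ, the point Q = (x₀, y₀, z₀) satisfies y₀ = k x₀ + (αk + β)(x₀² + y₀² + z₀²) and z₀ = m x₀ + (αm + γ)(x₀² + y₀² + z₀²). In other words, when the coefficient functions A(k,m) = αk + β and B(k,m) = αm + γ are linear of this form, all the circles of the bundle y = kx + A(k,m)(x²+y²+z²), z = mx + B(k,m)(x²+y²+z²) pass through the single common point Q distinct from the origin. -/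
/-- If the coefficient functions `A(k,m) = αk + β`, `B(k,m) = αm + γ`
are linear of this form (with `(α,β,γ) ≠ 0`), then all circles of the bundle
`y = kx + A(k,m)(x²+y²+z²)`, `z = mx + B(k,m)(x²+y²+z²)` pass through the single
common point `Q = (−α/D, β/D, γ/D)` (where `D = α²+β²+γ²`), which is distinct from
the origin. -/
theorem bundle_common_point (α β γ : ℝ) (h : (α, β, γ) ≠ (0, 0, 0)) :
    let D : ℝ := α ^ 2 + β ^ 2 + γ ^ 2
    let x₀ : ℝ := -α / D
    let y₀ : ℝ := β / D
    let z₀ : ℝ := γ / D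
    ((x₀, y₀, z₀) : ℝ × ℝ × ℝ) ≠ (0, 0, 0) ∧
      ∀ k m : ℝ,
        y₀ = k * x₀ + (α * k + β) * (x₀ ^ 2 + y₀ ^ 2 + z₀ ^ 2) ∧
        z₀ = m * x₀ + (α * m + γ) * (x₀ ^ 2 + y₀ ^ 2 + z₀ ^ 2) := by
  intro D x₀ y₀ z₀
  have hD : D ≠ 0 := by
    intro hD
    have hsum : α ^ 2 + β ^ 2 + γ ^ 2 = 0 := hD
    have hα : α = 0 := by nlinarith [sq_nonneg α, sq_nonneg β, sq_nonneg γ]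
    have hβ : β = 0 := by nlinarith [sq_nonneg α, sq_nonneg β, sq_nonneg γ]
    have hγ : γ = 0 := by nlinarith [sq_nonneg α, sq_nonneg β, sq_nonneg γ]
    exact h (by rw [hα, hβ, hγ])
  have hnorm : x₀ ^ 2 + y₀ ^ 2 + z₀ ^ 2 = 1 / D := by
    simp only [x₀, y₀, z₀]
    field_simp
    simp only [D]
  refine ⟨fun hQ => ?_, fun k m => ?_⟩
  · simp only [Prod.mk.injEq] at hQ
    obtain ⟨hx, hy, hz⟩ := hQ
    rw [hx, hy, hz] at hnorm
    exact one_div_ne_zero hD (by simpa using hnorm.symm)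
  · rw [hnorm]
    constructor
    · simp only [x₀, y₀]
      ring
    · simp only [x₀, z₀]
      ring
end

section
/- Let U ⊆ ℝ³ be an open connected set and let L be a family of affine lines in ℝ³ that is rich in U, meaning: (i) every point of U lies on some line of L; and (ii) for every ℓ ∈ L and every point P ∈ ℓ ∩ U, there is an open subset Ω of the unit sphere S² containing a direction vector of ℓ such that every d ∈ Ω is the direction of some line of L passing through P. Let F : U → ℝ³ be a homeomorphism onto its image such that for every ℓ ∈ L the image F(ℓ ∩ U) is contained in an affine line. Then F is the restriction of a projective transformation: there exists an invertible 4×4 real matrix M such that for every x ∈ U, writing M·(x,1) = (u(x), w(x)) ∈ ℝ³ × ℝ, one has w(x) ≠ 0 and F(x) = u(x)/w(x). -/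
open Metric Module

theorem eq_mul_of_additive_on_Icc {f : ℝ → ℝ} {δ : ℝ} (hδ : 0 < δ)
    (hf : ContinuousOn f (Set.Icc (-δ) δ))
    (hadd : ∀ s t, |s| ≤ δ → |t| ≤ δ → |s + t| ≤ δ → f (s + t) = f s + f t) :
    ∃ c, ∀ s, |s| ≤ δ → f s = c * s := by
  set h : ℝ → ℝ := fun s => f s - f δ / δ * s with hh
  have hδ' : |δ| ≤ δ := (abs_of_pos hδ).le
  have hδn : |-δ| ≤ δ := by rw [abs_neg]; exact hδ'
  have h_add : ∀ s t, |s| ≤ δ → |t| ≤ δ → |s + t| ≤ δ → h (s + t) = h s + h t := by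
    intro s t hs ht hst
    simp only [hh, hadd s t hs ht hst]; ring
  have h0 : h 0 = 0 := by
    have := h_add 0 0 (by simp [hδ.le]) (by simp [hδ.le]) (by simp [hδ.le])
    simp only [add_zero] at this; linarith
  have hd : h δ = 0 := by simp only [hh]; field_simp; ring
  have hnd : h (-δ) = 0 := by
    have := h_add δ (-δ) hδ' hδn (by simp [hδ.le])
    rw [add_neg_cancel, h0, hd] at this; linarith
  have hcont : ContinuousOn (fun s => |h s|) (Set.Icc (-δ) δ) := by
    apply ContinuousOn.abs
    exact hf.sub (by fun_prop)
  obtain ⟨m, hm, hmax⟩ := isCompact_Icc.exists_isMaxOn ⟨0, by simp [hδ.le]⟩ hcont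
  have hmax' : ∀ s, |s| ≤ δ → |h s| ≤ |h m| := fun s hs => hmax (abs_le.1 hs)
  have key : ∀ s, |s| ≤ δ / 2 → |h s| = |h m| → |h m| ≤ 0 := by
    intro s hs hsm
    have h1 : |s + s| ≤ δ := by rw [abs_le] at hs ⊢; constructor <;> linarith
    have h2 := h_add s s (by linarith) (by linarith) h1
    have h3 := hmax' _ h1
    rw [h2, ← two_mul, abs_mul, hsm] at h3
    norm_num at h3; linarith
  have hM : |h m| ≤ 0 := by
    rcases le_total (|m|) (δ / 2) with h1 | h1
    · exact key m h1 rfl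
    · rcases le_total 0 m with h2 | h2
      · rw [abs_of_nonneg h2] at h1
        have h3 : |m - δ| ≤ δ / 2 := by rw [abs_le]; constructor <;> linarith [hm.2]
        refine key (m - δ) h3 ?_
        have h4 : |m - δ + δ| ≤ δ := by rw [sub_add_cancel]; exact abs_le.2 hm
        have := h_add (m - δ) δ (by linarith) hδ' h4
        rw [sub_add_cancel, hd, add_zero] at this
        rw [this]
      · rw [abs_of_nonpos h2] at h1
        have h3 : |m + δ| ≤ δ / 2 := by rw [abs_le]; constructor <;> linarith [hm.1]
        refine key (m + δ) h3 ?_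
        have h4 : |m + δ + -δ| ≤ δ := by rw [add_neg_cancel_right]; exact abs_le.2 hm
        have := h_add (m + δ) (-δ) (by linarith) hδn h4
        rw [add_neg_cancel_right, hnd, add_zero] at this
        rw [this]
  refine ⟨f δ / δ, fun s hs => ?_⟩
  have := abs_nonpos_iff.1 ((hmax' s hs).trans hM)
  simp only [hh] at this; linarith

theorem eq_mul_of_proportional_increments {f g : ℝ → ℝ} {δ a b : ℝ} (hδ : 0 < δ)
    (ha : a ≠ 0) (hf : ContinuousOn f (Set.Icc (-δ) δ)) (hf0 : f 0 = 0)
    (h : ∀ s r t, |s| ≤ δ → |r| ≤ δ → |s + t| ≤ δ → |r + t| ≤ δ →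
      a * (f (s + t) - f s) = b * (g (r + t) - g r)) :
    ∃ c, ∀ s, |s| ≤ δ → f s = c * s := by
  refine eq_mul_of_additive_on_Icc hδ hf fun s t hs ht hst => ?_
  have z : |(0 : ℝ)| ≤ δ := by simp [hδ.le]
  have h1 := h s 0 t hs z hst (by simpa using ht)
  have h2 := h 0 0 t z z (by simpa using ht) (by simpa using ht)
  rw [← h2] at h1
  have := mul_left_cancel₀ ha h1
  simp only [zero_add, hf0] at this; linarith

/-- An injective continuous real function vanishing at `0` changes sign there and covers a
neighbourhood of `0`. -/
theorem sign_change_and_cover {f : ℝ → ℝ} {ε : ℝ} (hε : 0 < ε)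
    (hf : ContinuousOn f (Set.Icc (-ε) ε)) (hinj : Set.InjOn f (Set.Icc (-ε) ε))
    (h0 : f 0 = 0) :
    f (-ε) * f ε < 0 ∧ ∃ δ > 0, ∀ y, |y| < δ → ∃ τ ∈ Set.Icc (-ε) ε, f τ = y := by
  have m0 : (0 : ℝ) ∈ Set.Icc (-ε) ε := by simp [hε.le]
  have m1 : -ε ∈ Set.Icc (-ε) ε := by simp [hε.le]
  have m2 : ε ∈ Set.Icc (-ε) ε := by simp [hε.le]
  rcases hf.strictMonoOn_of_injOn_Icc' (by linarith) hinj with h | h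
  · have h1 := h m1 m0 (by linarith)
    have h2 := h m0 m2 hε
    rw [h0] at h1 h2
    refine ⟨mul_neg_of_neg_of_pos h1 h2, min (-f (-ε)) (f ε), lt_min (by linarith) h2, ?_⟩
    intro y hy
    have := abs_lt.1 (hy.trans_le (min_le_left _ _))
    have := abs_lt.1 (hy.trans_le (min_le_right _ _))
    exact intermediate_value_Icc (by linarith) hf ⟨by linarith, by linarith⟩
  · have h1 := h m1 m0 (by linarith)
    have h2 := h m0 m2 hε
    rw [h0] at h1 h2
    refine ⟨mul_neg_of_pos_of_neg h1 h2, min (f (-ε)) (-f ε), lt_min h1 (by linarith), ?_⟩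
    intro y hy
    have := abs_lt.1 (hy.trans_le (min_le_left _ _))
    have := abs_lt.1 (hy.trans_le (min_le_right _ _))
    exact intermediate_value_Icc' (by linarith) hf ⟨by linarith, by linarith⟩

theorem diagonal_of_preserves_pencils {η : (Fin 3 → ℝ) → Fin 3 → ℝ} {ε : ℝ} (hε : 0 < ε)
    (hcont : ContinuousOn η (closedBall 0 ε)) (h0 : η 0 = 0)
    (hax : ∀ i, ∀ ξ ∈ closedBall (0 : Fin 3 → ℝ) ε, ∀ t : ℝ,
      ξ + t • Pi.single i 1 ∈ closedBall (0 : Fin 3 → ℝ) ε →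
      ∃ τ : ℝ, η (ξ + t • Pi.single i 1) = η ξ + τ • Pi.single i 1)
    {i j : Fin 3} (hij : i ≠ j) {θ : ℝ} (hθ0 : θ ≠ 0)
    (hmid : ∀ ξ ∈ closedBall (0 : Fin 3 → ℝ) ε, ∀ t : ℝ,
      ξ + t • (Pi.single i 1 + Pi.single j 1) ∈ closedBall (0 : Fin 3 → ℝ) ε →
      ∃ τ : ℝ, η (ξ + t • (Pi.single i 1 + Pi.single j 1)) =
        η ξ + τ • ((1 - θ) • Pi.single i 1 + θ • Pi.single j 1)) :
    ∃ c : ℝ, ∀ ξ ∈ closedBall (0 : Fin 3 → ℝ) ε, η ξ i = c * ξ i := by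
  have mem : ∀ ξ : Fin 3 → ℝ, ξ ∈ closedBall (0 : Fin 3 → ℝ) ε ↔ ∀ i, |ξ i| ≤ ε := by
    intro ξ
    rw [mem_closedBall_zero_iff, pi_norm_le_iff_of_nonneg hε.le]; rfl
  have updm : ∀ l : Fin 3, ∀ ξ ∈ closedBall (0 : Fin 3 → ℝ) ε,
      Function.update ξ l 0 ∈ closedBall (0 : Fin 3 → ℝ) ε := by
    intro l ξ hξ
    rw [mem] at hξ ⊢
    intro m
    by_cases hm : m = l
    · subst hm; simp [hε.le]
    · simpa [hm] using hξ m
  have upd : ∀ k l : Fin 3, k ≠ l → ∀ ξ ∈ closedBall (0 : Fin 3 → ℝ) ε,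
      η (Function.update ξ l 0) k = η ξ k := by
    intro k l hkl ξ hξ
    have e : Function.update ξ l 0 = ξ + (-ξ l) • Pi.single l 1 := by
      ext m
      by_cases hm : m = l
      · subst hm; simp
      · simp [hm]
    have hm := updm l ξ hξ
    rw [e] at hm ⊢
    obtain ⟨τ, hτ⟩ := hax l ξ hξ _ hm
    rw [hτ]; simp [hkl]
  have sep : ∀ k : Fin 3, ∀ ξ ∈ closedBall (0 : Fin 3 → ℝ) ε,
      η ξ k = η (Pi.single k (ξ k)) k := by
    intro k ξ hξ
    have e : Pi.single k (ξ k) = Function.update (Function.update ξ (k + 1) 0) (k + 2) 0 := by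
      ext m
      fin_cases k <;> fin_cases m <;> simp [Function.update, Pi.single]
    rw [e, upd k (k + 2) (by fin_cases k <;> decide) _ (updm _ _ hξ),
      upd k (k + 1) (by fin_cases k <;> decide) _ hξ]
  have single_mem : ∀ k : Fin 3, ∀ s : ℝ, |s| ≤ ε →
      (Pi.single k s : Fin 3 → ℝ) ∈ closedBall (0 : Fin 3 → ℝ) ε := by
    intro k s hs
    rw [mem]; intro m
    by_cases hm : m = k
    · subst hm; simpa using hs
    · simp [hm, hε.le]
  obtain ⟨c, hc⟩ := eq_mul_of_proportional_increments (f := fun s => η (Pi.single i s) i)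
    (g := fun s => η (Pi.single j s) j) (a := θ) (b := 1 - θ) hε hθ0
    (by
      have : ContinuousOn (fun s : ℝ => η (Pi.single i s)) (Set.Icc (-ε) ε) := by
        refine hcont.comp (Continuous.continuousOn ?_) fun s hs => single_mem i s (abs_le.2 hs)
        exact continuous_single (A := fun _ : Fin 3 => ℝ) i
      exact (continuous_apply i).comp_continuousOn this)
    (by simp [h0])
    (by
      intro s r t hs hr hst hrt
      set ξ : Fin 3 → ℝ := Pi.single i s + Pi.single j r with hξ
      have v1 : ξ i = s := by simp [hξ, hij]
      have v2 : ξ j = r := by simp [hξ, hij.symm]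
      have m1 : ξ ∈ closedBall (0 : Fin 3 → ℝ) ε := by
        rw [mem]; intro m
        by_cases hm : m = i
        · subst hm; rwa [v1]
        by_cases hm' : m = j
        · subst hm'; rwa [v2]
        simp [hξ, hm, hm', hε.le]
      have w1 : (ξ + t • (Pi.single i 1 + Pi.single j 1) : Fin 3 → ℝ) i = s + t := by simp [v1, hij]
      have w2 : (ξ + t • (Pi.single i 1 + Pi.single j 1) : Fin 3 → ℝ) j = r + t := by simp [v2, hij.symm]
      have m2 : ξ + t • (Pi.single i 1 + Pi.single j 1) ∈ closedBall (0 : Fin 3 → ℝ) ε := by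
        rw [mem]; intro m
        by_cases hm : m = i
        · subst hm; rwa [w1]
        by_cases hm' : m = j
        · subst hm'; rwa [w2]
        simp [hξ, hm, hm', hε.le]
      obtain ⟨τ, hτ⟩ := hmid ξ m1 t m2
      have e1 := congrFun hτ i
      have e2 := congrFun hτ j
      rw [sep i _ m2, w1, Pi.add_apply, sep i _ m1, v1] at e1
      rw [sep j _ m2, w2, Pi.add_apply, sep j _ m1, v2] at e2
      simp [hij] at e1
      simp [hij.symm] at e2
      simp only [e1, e2]; ring)
  exact ⟨c, fun ξ hξ => by rw [sep i ξ hξ]; exact hc _ ((mem ξ).1 hξ i)⟩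

/-- The projective chart that sends the plane `∑ x = 1` to infinity. -/
noncomputable def toChart (x : Fin 3 → ℝ) : Fin 3 → ℝ := (1 - ∑ i, x i)⁻¹ • x

/-- The inverse of `toChart`. -/
noncomputable def ofChart (ξ : Fin 3 → ℝ) : Fin 3 → ℝ := (1 + ∑ i, ξ i)⁻¹ • ξ

theorem toChart_pencil {y y' q : Fin 3 → ℝ} {c : ℝ} (hq : ∑ i, q i = 1)
    (h : y' = q + c • (y - q)) (hy : 1 - ∑ i, y i ≠ 0) (hy' : 1 - ∑ i, y' i ≠ 0) :
    ∃ τ : ℝ, toChart y' = toChart y + τ • q := by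
  have e : 1 - ∑ i, y' i = c * (1 - ∑ i, y i) := by
    simp only [h, Pi.add_apply, Pi.smul_apply, Pi.sub_apply, smul_eq_mul, Finset.sum_add_distrib,
      ← Finset.mul_sum, Finset.sum_sub_distrib, hq]
    ring
  have hc : c ≠ 0 := by
    rintro rfl
    exact hy' (by rw [e, zero_mul])
  refine ⟨(1 - c) / (c * (1 - ∑ i, y i)), ?_⟩
  ext i
  simp only [toChart, Pi.smul_apply, Pi.add_apply, smul_eq_mul, e]
  rw [h]
  simp only [Pi.smul_apply, Pi.add_apply, Pi.sub_apply, smul_eq_mul]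
  field_simp
  ring

theorem ofChart_pencil {ξ q : Fin 3 → ℝ} {t : ℝ} (hq : ∑ i, q i = 1)
    (h : 1 + ∑ i, ξ i ≠ 0) (h' : 1 + ∑ i, (ξ + t • q) i ≠ 0) :
    ∃ k : ℝ, ofChart (ξ + t • q) = q + k • (ofChart ξ - q) := by
  have e : ∑ i, (ξ + t • q) i = ∑ i, ξ i + t := by
    simp only [Pi.add_apply, Pi.smul_apply, smul_eq_mul, Finset.sum_add_distrib,
      ← Finset.mul_sum, hq, mul_one]
  rw [e] at h'
  refine ⟨(1 + ∑ i, ξ i) / (1 + (∑ i, ξ i + t)), ?_⟩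
  ext i
  rw [ofChart, e]
  simp only [ofChart, Pi.smul_apply, Pi.add_apply, Pi.sub_apply, smul_eq_mul]
  field_simp
  ring

theorem ofChart_toChart {x : Fin 3 → ℝ} (h : 1 - ∑ i, x i ≠ 0) : ofChart (toChart x) = x := by
  have e : 1 + ∑ i, toChart x i = (1 - ∑ i, x i)⁻¹ := by
    simp only [toChart, Pi.smul_apply, smul_eq_mul, ← Finset.mul_sum]
    field_simp
    ring
  rw [ofChart, e, inv_inv, toChart, smul_smul, mul_inv_cancel₀ h, one_smul]

/-- `Φ` maps the pencil of lines through `q` into the pencil of lines through `q'`, on `S`. -/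
def MapsPencil (Φ : (Fin 3 → ℝ) → Fin 3 → ℝ) (S : Set (Fin 3 → ℝ)) (q q' : Fin 3 → ℝ) : Prop :=
  ∀ x ∈ S, ∀ x' ∈ S, ∀ k : ℝ, x' = q + k • (x - q) → ∃ c : ℝ, Φ x' = q' + c • (Φ x - q')

theorem projective_of_mapsPencil {Φ : (Fin 3 → ℝ) → Fin 3 → ℝ} {δ : ℝ} (hδ : 0 < δ)
    (hcont : ContinuousOn Φ (ball 0 δ)) (hinj : Set.InjOn Φ (ball 0 δ)) (h0 : Φ 0 = 0)
    (hax : ∀ i, MapsPencil Φ (ball 0 δ) (Pi.single i 1) (Pi.single i 1))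
    (hmid : ∀ i, ∃ j, i ≠ j ∧ ∃ θ : ℝ, θ ≠ 0 ∧ MapsPencil Φ (ball 0 δ)
      ((2⁻¹ : ℝ) • (Pi.single i 1 + Pi.single j 1))
      ((1 - θ) • Pi.single i 1 + θ • Pi.single j 1)) :
    ∃ c : Fin 3 → ℝ, (∀ i, c i ≠ 0) ∧ ∀ᶠ x in nhds (0 : Fin 3 → ℝ),
      1 - ∑ i, x i + ∑ i, c i * x i ≠ 0 ∧
      ∀ i, Φ x i = c i * x i / (1 - ∑ i, x i + ∑ i, c i * x i) := by
  have o0 : ofChart 0 = 0 := by simp [ofChart]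
  have ocont : ContinuousAt ofChart 0 := by
    have : ContinuousAt (fun ξ : Fin 3 → ℝ => (1 + ∑ i, ξ i)⁻¹) 0 :=
      ContinuousAt.inv₀ (by fun_prop) (by simp)
    unfold ofChart
    exact this.smul continuousAt_id
  have Φcont : ContinuousAt Φ 0 := hcont.continuousAt (ball_mem_nhds _ hδ)
  have ev : ∀ᶠ ξ in nhds (0 : Fin 3 → ℝ), ofChart ξ ∈ ball (0 : Fin 3 → ℝ) δ ∧
      1 + ∑ i, ξ i ≠ 0 ∧ 1 - ∑ i, Φ (ofChart ξ) i ≠ 0 := by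
    refine Filter.Eventually.and ?_ (Filter.Eventually.and ?_ ?_)
    · exact ocont.eventually_mem (by rw [o0]; exact ball_mem_nhds _ hδ)
    · exact ContinuousAt.eventually_ne (g := fun ξ : Fin 3 → ℝ => 1 + ∑ i, ξ i)
        (by fun_prop) (by simp)
    · have : ContinuousAt (fun ξ => Φ (ofChart ξ)) 0 :=
        ContinuousAt.comp (by rwa [o0]) ocont
      have h2 : ContinuousAt (fun ξ => 1 - ∑ i, Φ (ofChart ξ) i) 0 := by
        exact ContinuousAt.comp (f := fun ξ => Φ (ofChart ξ))
          (g := fun y : Fin 3 → ℝ => 1 - ∑ i, y i) (by fun_prop) this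
      exact h2.eventually_ne (by simp [o0, h0])
  obtain ⟨ε, hε, hball⟩ := Metric.nhds_basis_closedBall.eventually_iff.1 ev
  have hη : ∀ q q' : Fin 3 → ℝ, ∑ i, q i = 1 → ∑ i, q' i = 1 →
      MapsPencil Φ (ball 0 δ) q q' → ∀ ξ ∈ closedBall (0 : Fin 3 → ℝ) ε, ∀ t : ℝ,
      ξ + t • q ∈ closedBall (0 : Fin 3 → ℝ) ε →
      ∃ τ : ℝ, toChart (Φ (ofChart (ξ + t • q))) = toChart (Φ (ofChart ξ)) + τ • q' := by
    intro q q' hq hq' hp ξ hξ t hξt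
    obtain ⟨a1, a2, a3⟩ := hball hξ
    obtain ⟨b1, b2, b3⟩ := hball hξt
    obtain ⟨k, hk⟩ := ofChart_pencil hq a2 b2
    obtain ⟨c, hc⟩ := hp _ a1 _ b1 k hk
    exact toChart_pencil hq' hc a3 b3
  have ηcont : ContinuousOn (fun ξ => toChart (Φ (ofChart ξ))) (closedBall 0 ε) := by
    have c1 : ContinuousOn ofChart (closedBall 0 ε) := by
      unfold ofChart
      exact ContinuousOn.smul (ContinuousOn.inv₀ (by fun_prop) fun ξ hξ => (hball hξ).2.1)
        continuousOn_id
    have c2 : ContinuousOn (fun ξ => Φ (ofChart ξ)) (closedBall 0 ε) :=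
      hcont.comp c1 fun ξ hξ => (hball hξ).1
    unfold toChart
    refine ContinuousOn.smul (ContinuousOn.inv₀ ?_ fun ξ hξ => (hball hξ).2.2) c2
    exact Continuous.comp_continuousOn (g := fun y : Fin 3 → ℝ => 1 - ∑ i, y i) (by fun_prop) c2
  have lin : ∀ i, ∃ c : ℝ, ∀ ξ ∈ closedBall (0 : Fin 3 → ℝ) ε,
      toChart (Φ (ofChart ξ)) i = c * ξ i := by
    intro i
    obtain ⟨j, hij, θ, hθ, hp⟩ := hmid i
    refine diagonal_of_preserves_pencils hε ηcont (by simp [o0, h0, toChart])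
      (fun i => hη _ _ (by simp) (by simp) (hax i)) hij hθ ?_
    intro ξ hξ t ht
    have := hη _ _ (by simp [← Finset.mul_sum, Finset.sum_add_distrib]; norm_num)
      (by simp [← Finset.mul_sum, Finset.sum_add_distrib]) hp ξ hξ (t * 2)
    rw [mul_smul, smul_inv_smul₀ two_ne_zero] at this
    exact this ht
  choose c hc using lin
  have main : ∀ ξ ∈ closedBall (0 : Fin 3 → ℝ) ε,
      Φ (ofChart ξ) = (1 - ∑ i, Φ (ofChart ξ) i) • fun i => c i * ξ i := by
    intro ξ hξ
    have : (fun i => c i * ξ i) = toChart (Φ (ofChart ξ)) := funext fun i => (hc i ξ hξ).symm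
    rw [this, toChart, smul_inv_smul₀ (hball hξ).2.2]
  refine ⟨c, fun i hci => ?_, ?_⟩
  · have m1 : (Pi.single i ε : Fin 3 → ℝ) ∈ closedBall (0 : Fin 3 → ℝ) ε := by
      rw [mem_closedBall_zero_iff, Pi.norm_single, Real.norm_of_nonneg hε.le]
    have h1 := main _ m1
    have z : (fun k => c k * (Pi.single i ε : Fin 3 → ℝ) k) = 0 := by
      ext k
      by_cases hk : k = i
      · subst hk; simp [hci]
      · simp [hk]
    rw [z, smul_zero, ← h0] at h1
    have h2 := hinj (hball m1).1 (mem_ball_self hδ) h1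
    have h3 := congrFun h2 i
    simp only [ofChart, Pi.smul_apply, Pi.single_eq_same, smul_eq_mul, Pi.zero_apply] at h3
    exact (mul_ne_zero (inv_ne_zero (hball m1).2.1) hε.ne') h3
  · have tcont : ContinuousAt toChart 0 := by
      have : ContinuousAt (fun ξ : Fin 3 → ℝ => (1 - ∑ i, ξ i)⁻¹) 0 :=
        ContinuousAt.inv₀ (by fun_prop) (by simp)
      unfold toChart
      exact this.smul continuousAt_id
    have ev1 : ∀ᶠ x in nhds (0 : Fin 3 → ℝ), toChart x ∈ closedBall (0 : Fin 3 → ℝ) ε :=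
      tcont.eventually_mem (by
        rw [show toChart 0 = 0 by simp [toChart]]; exact closedBall_mem_nhds _ hε)
    have ev2 : ∀ᶠ x in nhds (0 : Fin 3 → ℝ), 1 - ∑ i, x i ≠ 0 :=
      ContinuousAt.eventually_ne (g := fun ξ : Fin 3 → ℝ => 1 - ∑ i, ξ i)
        (by fun_prop) (by simp)
    filter_upwards [ev1, ev2] with x hx1 hx2
    have h1 := main _ hx1
    have h3 := (hball hx1).2.2
    rw [ofChart_toChart hx2] at h1 h3
    set D := 1 - ∑ i, Φ x i with hD
    have h2 : ∀ i, Φ x i = D * (c i * x i) / (1 - ∑ i, x i) := by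
      intro i
      rw [h1]
      simp only [toChart, Pi.smul_apply, smul_eq_mul]
      field_simp
    have h4 : 1 - D = D * (∑ i, c i * x i) / (1 - ∑ i, x i) := by
      rw [Finset.mul_sum, Finset.sum_div, hD, sub_sub_cancel]
      exact Finset.sum_congr rfl fun i _ => h2 i
    have h5 : D * (1 - ∑ i, x i + ∑ i, c i * x i) = 1 - ∑ i, x i := by
      field_simp at h4
      linear_combination -h4
    have h6 : 1 - ∑ i, x i + ∑ i, c i * x i ≠ 0 := fun h => hx2 (by rw [← h5, h, mul_zero])
    refine ⟨h6, fun i => ?_⟩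
    rw [h2 i, div_eq_div_iff hx2 h6]
    linear_combination (c i * x i) * h5

section PencilGeometry

variable {E : Type*} [NormedAddCommGroup E] [NormedSpace ℝ E]

/-- `F` maps the part in `W` of every line with direction in `C` into a line. -/
def MapsLines (F : E → E) (W C : Set E) : Prop :=
  ∀ x ∈ W, ∀ d ∈ C, Collinear ℝ (F '' {y | y ∈ W ∧ ∃ t : ℝ, y = x + t • d})

theorem MapsLines.exists_eq_add_smul {F : E → E} {W C : Set E} (hF : MapsLines F W C)
    (hinj : Set.InjOn F W) {y d : E} {a b : ℝ} (hd : d ∈ C) (ha : a ≠ 0) (hy : y ∈ W)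
    (hya : y + a • d ∈ W) (hyb : y + b • d ∈ W) :
    ∃ c : ℝ, F (y + b • d) = F y + c • (F (y + a • d) - F y) := by
  by_cases hd0 : d = 0
  · exact ⟨0, by simp [hd0]⟩
  have key := hF y hy d hd
  have hmem : F y ∈ F '' {z | z ∈ W ∧ ∃ t : ℝ, z = y + t • d} :=
    ⟨y, ⟨hy, 0, by simp⟩, rfl⟩
  obtain ⟨v, hv⟩ := (collinear_iff_of_mem hmem).1 key
  obtain ⟨r, hr⟩ := hv _ ⟨_, ⟨hya, a, rfl⟩, rfl⟩
  obtain ⟨s, hs⟩ := hv _ ⟨_, ⟨hyb, b, rfl⟩, rfl⟩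
  simp only [vadd_eq_add] at hr hs
  have hr0 : r ≠ 0 := by
    rintro rfl
    rw [zero_smul, zero_add] at hr
    have := hinj hya hy hr
    simp [ha, hd0] at this
  refine ⟨s / r, ?_⟩
  rw [hr, hs, add_sub_cancel_right, smul_smul, div_mul_cancel₀ _ hr0, add_comm]

theorem MapsLines.ray {F : E → E} {W C : Set E} (hF : MapsLines F W C)
    (hcont : ContinuousOn F W) (hinj : Set.InjOn F W) {p w : E} {a ε : ℝ} (hp : p ∈ W)
    (hw : w ∈ C) (hw0 : w ≠ 0) (ha : a ≠ 0) (haW : p + a • w ∈ W) {φ : E →L[ℝ] ℝ}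
    (hφ : φ (F (p + a • w) - F p) = 1) (hε : ∀ τ ∈ Set.Icc (-ε) ε, p + τ • w ∈ W) :
    ContinuousOn (fun τ : ℝ => φ (F (p + τ • w) - F p)) (Set.Icc (-ε) ε) ∧
    Set.InjOn (fun τ : ℝ => φ (F (p + τ • w) - F p)) (Set.Icc (-ε) ε) ∧
    ∀ τ ∈ Set.Icc (-ε) ε, F (p + τ • w) - F p =
      φ (F (p + τ • w) - F p) • (F (p + a • w) - F p) := by
  have rep : ∀ τ ∈ Set.Icc (-ε) ε, F (p + τ • w) - F p =
      φ (F (p + τ • w) - F p) • (F (p + a • w) - F p) := by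
    intro τ hτ
    obtain ⟨c, hc⟩ := hF.exists_eq_add_smul hinj hw ha hp haW (hε τ hτ)
    rw [hc, add_sub_cancel_left, map_smul, hφ, smul_eq_mul, mul_one]
  refine ⟨?_, ?_, rep⟩
  · refine φ.continuous.comp_continuousOn (ContinuousOn.sub ?_ continuousOn_const)
    exact hcont.comp (by fun_prop) hε
  · intro s hs t ht hst
    have h1 : F (p + s • w) - F p = F (p + t • w) - F p := by
      rw [rep s hs, rep t ht]
      simp only at hst
      rw [hst]
    have h2 := hinj (hε s hs) (hε t ht) (sub_left_injective h1)
    exact smul_left_injective ℝ hw0 (add_left_cancel h2)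

theorem exists_Icc_mapsTo {W : Set E} (hW : IsOpen W) {p : E} (hp : p ∈ W) (w : E) :
    ∀ᶠ ε in nhdsWithin (0 : ℝ) (Set.Ioi 0), ∀ τ ∈ Set.Icc (-ε) ε, p + τ • w ∈ W := by
  have : ContinuousAt (fun τ : ℝ => p + τ • w) 0 := by fun_prop
  have h := this.eventually_mem (s := W) (by simpa using hW.mem_nhds hp)
  obtain ⟨δ, hδ, hb⟩ := Metric.nhds_basis_closedBall.eventually_iff.1 h
  filter_upwards [Ioo_mem_nhdsGT hδ] with ε hε τ hτ
  refine hb ?_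
  rw [mem_closedBall_zero_iff, Real.norm_eq_abs, abs_le]
  exact ⟨by linarith [hτ.1, hε.2], by linarith [hτ.2, hε.2]⟩

theorem MapsLines.not_parallel {F : E → E} {W C : Set E} (hF : MapsLines F W C)
    (hW : IsOpen W) (hcont : ContinuousOn F W) (hinj : Set.InjOn F W) {p w₁ w₂ : E} {a : ℝ}
    (hp : p ∈ W) (hw₁ : w₁ ∈ C) (hw₂ : w₂ ∈ C) (hli : LinearIndependent ℝ ![w₁, w₂])
    (ha : a ≠ 0) (ha₁ : p + a • w₁ ∈ W) (ha₂ : p + a • w₂ ∈ W) :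
    LinearIndependent ℝ ![F (p + a • w₁) - F p, F (p + a • w₂) - F p] := by
  have w10 : w₁ ≠ 0 := hli.ne_zero 0
  have w20 : w₂ ≠ 0 := hli.ne_zero 1
  have v10 : F (p + a • w₁) - F p ≠ 0 := fun h => by
    have := hinj ha₁ hp (sub_eq_zero.1 h)
    simp [ha, w10] at this
  have v20 : F (p + a • w₂) - F p ≠ 0 := fun h => by
    have := hinj ha₂ hp (sub_eq_zero.1 h)
    simp [ha, w20] at this
  rw [LinearIndependent.pair_iff' v10]
  intro k hk
  have hk0 : k ≠ 0 := by
    rintro rfl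
    exact v20 (by rw [← hk, zero_smul])
  obtain ⟨φ, hφ⟩ := SeparatingDual.exists_eq_one (R := ℝ) v10
  have hφ₂ : (k⁻¹ • φ) (F (p + a • w₂) - F p) = 1 := by
    rw [← hk, smul_apply, map_smul, hφ]
    simp [hk0]
  obtain ⟨ε, ⟨hε₁, hε₂⟩, hε⟩ := (((exists_Icc_mapsTo hW hp w₁).and
    (exists_Icc_mapsTo hW hp w₂)).and self_mem_nhdsWithin).exists
  obtain ⟨c₁, i₁, r₁⟩ := hF.ray hcont hinj hp hw₁ w10 ha ha₁ hφ hε₁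
  obtain ⟨c₂, i₂, r₂⟩ := hF.ray hcont hinj hp hw₂ w20 ha ha₂ hφ₂ hε₂
  obtain ⟨-, δ, hδ, hcov⟩ := sign_change_and_cover hε c₁ i₁ (by simp)
  have ct : ContinuousAt (fun τ : ℝ => k * (k⁻¹ • φ) (F (p + τ • w₂) - F p)) 0 :=
    continuousAt_const.mul (c₂.continuousAt (Icc_mem_nhds (by simpa using hε) hε))
  have ev : ∀ᶠ τ in nhdsWithin (0 : ℝ) (Set.Ioi 0),
      k * (k⁻¹ • φ) (F (p + τ • w₂) - F p) ∈ ball (0 : ℝ) δ :=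
    nhdsWithin_le_nhds (ct.eventually_mem (by simpa using ball_mem_nhds (0 : ℝ) hδ))
  obtain ⟨τ, hτ, hτ'⟩ := (ev.and (Ioo_mem_nhdsGT hε)).exists
  rw [mem_ball_zero_iff, Real.norm_eq_abs] at hτ
  obtain ⟨τ₁, hτ₁, e⟩ := hcov _ hτ
  have mτ : τ ∈ Set.Icc (-ε) ε := ⟨by linarith [hτ'.1], hτ'.2.le⟩
  have h1 := r₁ τ₁ hτ₁
  have h2 := r₂ τ mτ
  rw [← hk, smul_smul, mul_comm, ← e, ← h1] at h2
  have h3 := add_left_cancel (hinj (hε₂ τ mτ) (hε₁ τ₁ hτ₁) (sub_left_injective h2))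
  have h4 := LinearIndependent.pair_iff.1 hli τ₁ (-τ) (by rw [neg_smul, h3, add_neg_cancel])
  linarith [h4.2, hτ'.1]

theorem exists_dual_eq_one_eq_zero [FiniteDimensional ℝ E] {v w : E}
    (h : LinearIndependent ℝ ![w, v]) : ∃ φ : E →L[ℝ] ℝ, φ v = 1 ∧ φ w = 0 := by
  have hv : v ∉ Submodule.span ℝ {w} := by
    rw [Submodule.mem_span_singleton]
    rintro ⟨a, ha⟩
    exact (LinearIndependent.pair_iff' (h.ne_zero 0)).1 h a ha
  obtain ⟨f, hf, hle⟩ := Submodule.exists_le_ker_of_notMem hv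
  refine ⟨(f v)⁻¹ • LinearMap.toContinuousLinearMap f, by simp [hf], ?_⟩
  have : f w = 0 := hle (Submodule.mem_span_singleton_self w)
  simp [this]

theorem MapsLines.not_coplanar [FiniteDimensional ℝ E] {F : E → E} {W C : Set E}
    (hF : MapsLines F W C) (hW : IsOpen W) (hC : IsOpen C) (hcont : ContinuousOn F W)
    (hinj : Set.InjOn F W) {p : E} {w : Fin 3 → E} {a : ℝ} (hp : p ∈ W) (hw : ∀ i, w i ∈ C)
    (hli : LinearIndependent ℝ w) (ha : a ≠ 0) (haW : ∀ i, p + a • w i ∈ W) :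
    LinearIndependent ℝ fun i => F (p + a • w i) - F p := by
  set v : Fin 3 → E := fun i => F (p + a • w i) - F p with hv
  have hli3 : ∀ x y z : ℝ, x • w 0 + y • w 1 + z • w 2 = 0 → x = 0 ∧ y = 0 ∧ z = 0 := by
    intro x y z h
    have := Fintype.linearIndependent_iff.1 hli ![x, y, z] (by simpa [Fin.sum_univ_three] using h)
    exact ⟨this 0, this 1, this 2⟩
  have pair : LinearIndependent ℝ ![w 0, w 1] := by
    rw [LinearIndependent.pair_iff]
    intro x y h
    have := hli3 x y 0 (by simpa using h)
    exact ⟨this.1, this.2.1⟩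
  have vpair : LinearIndependent ℝ ![v 0, v 1] :=
    hF.not_parallel hW hcont hinj hp (hw 0) (hw 1) pair ha (haW 0) (haW 1)
  have vpair' : LinearIndependent ℝ ![v 1, v 0] := LinearIndependent.pair_symm_iff.1 vpair
  suffices H : ∀ α β : ℝ, v 2 ≠ α • v 0 + β • v 1 by
    rw [Fintype.linearIndependent_iff]
    intro g hg
    rw [Fin.sum_univ_three] at hg
    have g2 : g 2 = 0 := by
      by_contra h
      refine H (-g 0 / g 2) (-g 1 / g 2) ?_
      have : g 2 • (v 2 - ((-g 0 / g 2) • v 0 + (-g 1 / g 2) • v 1)) = 0 := by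
        rw [smul_sub, smul_add, smul_smul, smul_smul, mul_div_cancel₀ _ h, mul_div_cancel₀ _ h,
          ← hg]
        module
      exact sub_eq_zero.1 ((smul_eq_zero.1 this).resolve_left h)
    rw [g2, zero_smul, add_zero] at hg
    have := LinearIndependent.pair_iff.1 vpair _ _ hg
    intro i
    fin_cases i
    exacts [this.1, this.2, g2]
  intro α β hαβ
  obtain ⟨φ₀, h00, h01⟩ := exists_dual_eq_one_eq_zero vpair'
  obtain ⟨φ₁, h11, h10⟩ := exists_dual_eq_one_eq_zero vpair
  obtain ⟨ε, ⟨hε₀, hε₁⟩, hε⟩ := (((exists_Icc_mapsTo hW hp (w 0)).and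
    (exists_Icc_mapsTo hW hp (w 1))).and self_mem_nhdsWithin).exists
  have hε : 0 < ε := hε
  obtain ⟨c₀, i₀, r₀⟩ := hF.ray hcont hinj hp (hw 0) (hli.ne_zero 0) ha (haW 0) h00 hε₀
  obtain ⟨c₁, i₁, r₁⟩ := hF.ray hcont hinj hp (hw 1) (hli.ne_zero 1) ha (haW 1) h11 hε₁
  obtain ⟨sgn, -⟩ := sign_change_and_cover hε c₀ i₀ (by simp)
  obtain ⟨-, δ, hδ, hcov⟩ := sign_change_and_cover hε c₁ i₁ (by simp)
  set e : ℝ → ℝ → E := fun s t => p + s • w 0 + (t * (s + ε)) • w 2 with he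
  have econt : Continuous fun z : ℝ × ℝ => e z.2 z.1 := by fun_prop
  have e0 : ∀ s, e s 0 = p + s • w 0 := fun s => by simp [he]
  have Fe : ∀ s ∈ Set.Icc (-ε) ε,
      ContinuousAt (fun z : ℝ × ℝ => F (e z.2 z.1)) ((0 : ℝ), s) := by
    intro s hs
    have m : e s 0 ∈ W := by rw [e0]; exact hε₀ s hs
    exact ContinuousAt.comp (f := fun z : ℝ × ℝ => e z.2 z.1) (x := ((0 : ℝ), s))
      (hcont.continuousAt (hW.mem_nhds m)) econt.continuousAt
  have ev1 : ∀ᶠ t in nhds (0 : ℝ), ∀ s ∈ Set.Icc (-ε) ε,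
      e s t ∈ W ∧ |φ₁ (F (e s t) - F p)| < δ := by
    refine isCompact_Icc.eventually_forall_of_forall_eventually fun s hs => ?_
    have m : e s 0 ∈ W := by rw [e0]; exact hε₀ s hs
    refine Filter.Eventually.and ?_ ?_
    · exact econt.continuousAt.eventually_mem (x := ((0 : ℝ), s)) (hW.mem_nhds m)
    · have h1 : ContinuousAt (fun z : ℝ × ℝ => |φ₁ (F (e z.2 z.1) - F p)|) ((0 : ℝ), s) :=
        (φ₁.continuous.continuousAt.comp ((Fe s hs).sub continuousAt_const)).abs
      refine h1.eventually_lt_const ?_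
      simp only [e0]
      rw [r₀ s hs, map_smul]
      change |_ • φ₁ (v 0)| < δ
      simpa [h10] using hδ
  have mε : ε ∈ Set.Icc (-ε) ε := ⟨by linarith, le_rfl⟩
  have mε' : -ε ∈ Set.Icc (-ε) ε := ⟨le_rfl, by linarith⟩
  have m0 : (0 : ℝ) ∈ Set.Icc (-ε) ε := ⟨by linarith, hε.le⟩
  have ev2 : ∀ᶠ t in nhds (0 : ℝ),
      φ₀ (F (p + (-ε) • w 0) - F p) * φ₀ (F (e ε t) - F p) < 0 := by
    have h1 : ContinuousAt (fun t : ℝ => F (e ε t)) 0 :=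
      ContinuousAt.comp (f := fun t : ℝ => (t, ε)) (x := (0 : ℝ)) (Fe ε mε) (by fun_prop)
    have h2 : ContinuousAt (fun t : ℝ =>
        φ₀ (F (p + (-ε) • w 0) - F p) * φ₀ (F (e ε t) - F p)) 0 :=
      continuousAt_const.mul (φ₀.continuous.continuousAt.comp (h1.sub continuousAt_const))
    refine h2.eventually_lt_const ?_
    simpa only [e0] using sgn
  have ev3 : ∀ᶠ t in nhds (0 : ℝ), w 0 + t • w 2 ∈ C := by
    have h1 : ContinuousAt (fun t : ℝ => w 0 + t • w 2) 0 := by fun_prop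
    exact h1.eventually_mem (by simpa using hC.mem_nhds (hw 0))
  obtain ⟨t, ⟨ht1, ht2, ht3⟩, ht0⟩ := (((ev1.and (ev2.and ev3)).filter_mono
    (nhdsWithin_le_nhds (s := {0}ᶜ))).and self_mem_nhdsWithin).exists
  have ht0 : t ≠ 0 := ht0
  have es : ∀ s, e s t = p + (-ε) • w 0 + (s + ε) • (w 0 + t • w 2) := by
    intro s; simp only [he]; module
  have eε : e (-ε) t = p + (-ε) • w 0 := by rw [es]; simp
  have plane : ∀ s ∈ Set.Icc (-ε) ε, F (e s t) - F p =
      φ₀ (F (e s t) - F p) • v 0 + φ₁ (F (e s t) - F p) • v 1 := by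
    intro s hs
    have m1 := (ht1 (-ε) mε').1
    have m2 := (ht1 0 m0).1
    have m3 := (ht1 s hs).1
    have e2 : e 0 t = p + (t * ε) • w 2 := by simp [he]
    obtain ⟨c₂, hc₂⟩ := hF.exists_eq_add_smul hinj (hw 2) ha hp (haW 2) (by rwa [← e2])
    rw [← e2] at hc₂
    obtain ⟨c, hc⟩ := hF.exists_eq_add_smul hinj ht3 (a := ε) (b := s + ε)
      (y := p + (-ε) • w 0) hε.ne' (by rwa [← eε]) (by simpa [es] using m2) (by rwa [← es])
    rw [← es, show p + (-ε) • w 0 + ε • (w 0 + t • w 2) = e 0 t by simp [es], hc₂,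
      ← eε] at hc
    have h4 := r₀ (-ε) mε'
    rw [← eε] at h4
    change _ = _ • v 0 at h4
    change _ = F _ + c • (F p + c₂ • v 2 - _) at hc
    obtain ⟨x, y, hxy⟩ : ∃ x y : ℝ, F (e s t) - F p = x • v 0 + y • v 1 := by
      rw [sub_eq_iff_eq_add] at h4
      refine ⟨φ₀ (F (e (-ε) t) - F p) + c * (c₂ * α - φ₀ (F (e (-ε) t) - F p)), c * (c₂ * β), ?_⟩
      generalize φ₀ (F (e (-ε) t) - F p) = m at h4 ⊢
      rw [hc, h4, hαβ]
      module
    rw [hxy]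
    simp [h00, h01, h10, h11]
  have Acont : ContinuousOn (fun s => φ₀ (F (e s t) - F p)) (Set.Icc (-ε) ε) := by
    refine φ₀.continuous.comp_continuousOn (ContinuousOn.sub ?_ continuousOn_const)
    exact hcont.comp (by fun_prop) fun s hs => (ht1 s hs).1
  obtain ⟨s, hs, hs0⟩ : ∃ s ∈ Set.Icc (-ε) ε, φ₀ (F (e s t) - F p) = 0 := by
    rw [← eε] at ht2
    rcases mul_neg_iff.1 ht2 with ⟨h1, h2⟩ | ⟨h1, h2⟩
    · exact intermediate_value_Icc' (by linarith) Acont ⟨h2.le, h1.le⟩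
    · exact intermediate_value_Icc (by linarith) Acont ⟨h1.le, h2.le⟩
  obtain ⟨τ, hτ, hτe⟩ := hcov _ (ht1 s hs).2
  have h5 := plane s hs
  rw [hs0, zero_smul, zero_add, ← hτe] at h5
  have h6 := (r₁ τ hτ).symm
  rw [← h5] at h6
  have h7 := hinj (ht1 s hs).1 (hε₁ τ hτ) (sub_left_injective h6)
  have h8 : s • w 0 + (-τ) • w 1 + (t * (s + ε)) • w 2 = 0 := by
    have : e s t - (p + τ • w 1) = 0 := sub_eq_zero.2 h7
    rw [← this]; simp only [he]; module
  obtain ⟨hs', -, h9⟩ := hli3 _ _ _ h8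
  rw [hs', zero_add] at h9
  exact (mul_ne_zero ht0 hε.ne') h9

end PencilGeometry

section LocallyProjective

variable {E : Type*} [NormedAddCommGroup E] [NormedSpace ℝ E]

/-- At `x`, the map `F` agrees with the projective map induced by `T`. -/
def AgreesWithProjective (T : E × ℝ →ₗ[ℝ] E × ℝ) (F : E → E) (x : E) : Prop :=
  (T (x, 1)).2 ≠ 0 ∧ (T (x, 1)).1 = (T (x, 1)).2 • F x

/-- Near `p`, the map `F` is the restriction of a projective transformation. -/
def LocallyProjectiveAt (F : E → E) (p : E) : Prop :=
  ∃ T : E × ℝ →ₗ[ℝ] E × ℝ, Function.Injective T ∧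
    ∀ᶠ x in nhds p, AgreesWithProjective T F x

theorem exists_frame_in_cone (hE : finrank ℝ E = 3) {C : Set E} (hC : IsOpen C)
    (hCne : C.Nonempty) (hCone : ∀ d ∈ C, ∀ r : ℝ, 0 < r → r • d ∈ C) :
    ∃ w : Fin 3 → E, LinearIndependent ℝ w ∧ (∀ i, w i ∈ C) ∧
      ∀ i, ∃ j, i ≠ j ∧ w i + w j ∈ C ∧ ∃ d ∈ C, ∃ r : ℝ, r ≠ 0 ∧ w j - w i = r • d := by
  obtain ⟨d, hd⟩ := hCne
  have : FiniteDimensional ℝ E := Module.finite_of_finrank_pos (by omega)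
  let b : Basis (Fin 3) ℝ E := finBasisOfFinrankEq ℝ E hE
  let m : Fin 3 → ℝ := ![1, 2, 3]
  have hm : ∀ i, 0 < m i := by intro i; fin_cases i <;> norm_num [m]
  let w : ℝ → Fin 3 → E := fun κ i => m i • d + κ • b i
  have near : ∀ (r : ℝ) (e : E), 0 < r → ∀ᶠ κ in nhds (0 : ℝ), r • d + κ • e ∈ C := by
    intro r e hr
    have h1 : ContinuousAt (fun κ : ℝ => r • d + κ • e) 0 := by fun_prop
    exact h1.eventually_mem (by simpa using hC.mem_nhds (hCone d hd r hr))
  have ev : ∀ᶠ κ in nhdsWithin (0 : ℝ) {0}ᶜ,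
      κ ∈ ({-∑ i, m i * b.repr d i} : Set ℝ)ᶜ ∧ κ ≠ 0 := by
    refine Filter.Eventually.and ?_ self_mem_nhdsWithin
    by_cases h : (0 : ℝ) = -∑ i, m i * b.repr d i
    · rw [← h]; exact self_mem_nhdsWithin
    · exact nhdsWithin_le_nhds (isOpen_compl_singleton.mem_nhds h)
  have evC : ∀ᶠ κ in nhds (0 : ℝ), (∀ i, w κ i ∈ C) ∧ w κ 0 + w κ 1 ∈ C ∧
      w κ 1 + w κ 2 ∈ C ∧ w κ 1 - w κ 0 ∈ C ∧ w κ 2 - w κ 1 ∈ C := by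
    filter_upwards [Filter.eventually_all.2 fun i => near (m i) (b i) (hm i),
      near 3 (b 0 + b 1) (by norm_num), near 5 (b 1 + b 2) (by norm_num),
      near 1 (b 1 - b 0) (by norm_num), near 1 (b 2 - b 1) (by norm_num)] with κ h1 h2 h3 h4 h5
    refine ⟨h1, ?_, ?_, ?_, ?_⟩
    · convert h2 using 1; simp [w, m]; module
    · convert h3 using 1; simp [w, m]; module
    · convert h4 using 1; simp [w, m]; module
    · convert h5 using 1; simp [w, m]; module
  obtain ⟨κ, ⟨hκ, hκ0⟩, h1, h2, h3, h4, h5⟩ :=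
    (ev.and (nhdsWithin_le_nhds evC)).exists
  refine ⟨w κ, ?_, h1, ?_⟩
  · rw [Fintype.linearIndependent_iff]
    intro g hg
    have h6 : ∀ i, (∑ k, g k * m k) * b.repr d i + κ * g i = 0 := by
      intro i
      have := congrArg (fun x => b.repr x i) hg
      simp only [w, smul_add, Finset.sum_add_distrib, smul_smul, map_add, map_sum, map_smul,
        ← Finset.sum_smul, map_zero, Finsupp.add_apply, Finsupp.smul_apply, smul_eq_mul,
        Finsupp.finsetSum_apply, Basis.repr_self, Finsupp.zero_apply] at this
      have hsum : ∑ k, g k * κ * (Finsupp.single k (1 : ℝ)) i = κ * g i := by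
        rw [Finset.sum_eq_single i (by intro k _ hk; simp [hk]) (by simp)]
        simp [mul_comm]
      rwa [hsum] at this
    have h7 : (∑ k, g k * m k) * (κ + ∑ i, m i * b.repr d i) = 0 := by
      have : ∑ i, m i * ((∑ k, g k * m k) * b.repr d i + κ * g i) = 0 :=
        Finset.sum_eq_zero fun i _ => by rw [h6 i, mul_zero]
      rw [← this]
      simp only [Fin.sum_univ_three]
      ring
    have h8 : ∑ k, g k * m k = 0 := by
      refine (mul_eq_zero.1 h7).resolve_right fun h => hκ ?_
      rw [Set.mem_singleton_iff]; linarith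
    intro i
    have := h6 i
    rw [h8, zero_mul, zero_add] at this
    exact (mul_eq_zero.1 this).resolve_left hκ0
  · intro i
    fin_cases i
    · exact ⟨1, by decide, h2, _, h4, 1, one_ne_zero, by simp⟩
    · exact ⟨2, by decide, h3, _, h5, 1, one_ne_zero, by simp⟩
    · refine ⟨1, by decide, ?_, _, h5, -1, by norm_num, by simp⟩
      rw [add_comm]; exact h3

theorem MapsLines.locallyProjectiveAt (hE : finrank ℝ E = 3) {F : E → E} {W C : Set E}
    (hF : MapsLines F W C) (hW : IsOpen W) (hcont : ContinuousOn F W) (hinj : Set.InjOn F W)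
    (hC : IsOpen C) (hCne : C.Nonempty) (hCone : ∀ d ∈ C, ∀ r : ℝ, 0 < r → r • d ∈ C)
    {p : E} (hp : p ∈ W) : LocallyProjectiveAt F p := by
  have : FiniteDimensional ℝ E := Module.finite_of_finrank_pos (by omega)
  obtain ⟨w, hli, hwC, hwmid⟩ := exists_frame_in_cone hE hC hCne hCone
  obtain ⟨σ, ⟨hσ1, hσ2⟩, hσ⟩ : ∃ σ : ℝ, ((∀ i, p + (-σ) • w i ∈ W) ∧
      ∀ i j, p + (-σ) • (2⁻¹ : ℝ) • (w i + w j) ∈ W) ∧ 0 < σ := by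
    have h : ∀ e : E, ∀ᶠ σ in nhdsWithin (0 : ℝ) (Set.Ioi 0), p + (-σ) • e ∈ W := by
      intro e
      filter_upwards [exists_Icc_mapsTo hW hp e, self_mem_nhdsWithin] with σ h1 h2
      exact h1 _ ⟨le_rfl, by linarith [Set.mem_Ioi.1 h2]⟩
    exact (((Filter.eventually_all.2 fun i => h (w i)).and (Filter.eventually_all.2 fun i =>
      Filter.eventually_all.2 fun j => h _)).and self_mem_nhdsWithin).exists
  have hσ' : -σ ≠ 0 := neg_ne_zero.2 hσ.ne'
  have vli := hF.not_coplanar hW hC hcont hinj hp hwC hli hσ' hσ1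
  have bli : LinearIndependent ℝ fun i => (-σ) • w i :=
    hli.units_smul (fun _ => Units.mk0 (-σ) hσ')
  let b : Basis (Fin 3) ℝ E := basisOfLinearIndependentOfCardEqFinrank bli (by simp [hE])
  let v : Basis (Fin 3) ℝ E := basisOfLinearIndependentOfCardEqFinrank vli (by simp [hE])
  have hb : ∀ i, b i = (-σ) • w i := fun i => by simp [b]
  have hv : ∀ i, v i = F (p + b i) - F p := fun i => by simp [v, b]
  let B : (Fin 3 → ℝ) ≃L[ℝ] E := b.equivFun.symm.toContinuousLinearEquiv
  let V : E ≃L[ℝ] (Fin 3 → ℝ) := v.equivFun.toContinuousLinearEquiv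
  have hB : ∀ i, B (Pi.single i 1) = b i := fun i => by
    simp [B, Basis.equivFun_symm_apply, Pi.single_apply]
  have hV : ∀ i, V (v i) = Pi.single i 1 := fun i => by
    ext j
    simp [V, Pi.single_apply, eq_comm]
  let Φ : (Fin 3 → ℝ) → Fin 3 → ℝ := fun a => V (F (p + B a) - F p)
  -- a vertex `p + B q` sees all points near `p` along directions of `C`
  let Sees : (Fin 3 → ℝ) → (Fin 3 → ℝ) → Prop := fun q a => B a - B q ∈ C
  have sees : ∀ q, -B q ∈ C → ∀ᶠ a in nhds (0 : Fin 3 → ℝ), Sees q a := by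
    intro q hq
    have h1 : ContinuousAt (fun a => B a - B q) 0 := by fun_prop
    exact h1.eventually_mem (by simpa using hC.mem_nhds hq)
  have pencil : ∀ S : Set (Fin 3 → ℝ), ∀ q, p + B q ∈ W → (∀ a ∈ S, p + B a ∈ W ∧ Sees q a) →
      MapsPencil Φ S q (Φ q) := by
    intro S q hq hS x hx x' hx' k hk
    have e1 : p + B q + (1 : ℝ) • (B x - B q) = p + B x := by module
    have e2 : p + B q + k • (B x - B q) = p + B x' := by
      rw [hk, map_add, map_smul, map_sub]; module
    obtain ⟨c, hc⟩ := hF.exists_eq_add_smul hinj (hS x hx).2 one_ne_zero (b := k) hq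
      (by rw [e1]; exact (hS x hx).1) (by rw [e2]; exact (hS x' hx').1)
    rw [e1, e2] at hc
    refine ⟨c, ?_⟩
    simp only [Φ]
    rw [hc]
    simp only [map_sub, map_add, map_smul]
    module
  have hΦs : ∀ i, Φ (Pi.single i 1) = Pi.single i 1 := fun i => by
    simp only [Φ, hB, ← hv, hV]
  choose j hij hjC d hd r hr hrd using hwmid
  let q : Fin 3 → Fin 3 → ℝ := fun i => (2⁻¹ : ℝ) • (Pi.single i 1 + Pi.single (j i) 1)
  have hBq : ∀ i, B (q i) = (-σ) • (2⁻¹ : ℝ) • (w i + w (j i)) := by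
    intro i
    simp only [q, map_smul, map_add, hB, hb]; module
  have hΦq : ∀ i, ∃ θ : ℝ, θ ≠ 0 ∧
      Φ (q i) = (1 - θ) • Pi.single i 1 + θ • Pi.single (j i) 1 := by
    intro i
    have e1 : p + b i + (-σ * r i) • d i = p + b (j i) := by
      rw [mul_smul, ← hrd, hb, hb]; module
    have e2 : p + b i + (-σ * r i / 2) • d i = p + B (q i) := by
      rw [hBq, hb, div_eq_mul_inv, mul_comm, mul_smul, mul_smul, ← hrd]; module
    have m0 : p + b i ∈ W := by rw [hb]; exact hσ1 i
    have m2 : p + B (q i) ∈ W := by rw [hBq]; exact hσ2 i (j i)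
    obtain ⟨θ, hθ⟩ := hF.exists_eq_add_smul hinj (hd i) (mul_ne_zero hσ' (hr i))
      (b := -σ * r i / 2) m0 (by rw [e1, hb]; exact hσ1 _) (by rw [e2]; exact m2)
    rw [e1, e2] at hθ
    refine ⟨θ, ?_, ?_⟩
    · rintro rfl
      rw [zero_smul, add_zero] at hθ
      have h1 := add_left_cancel (hinj m2 m0 hθ)
      rw [← hB] at h1
      have h2 := congrFun (B.injective h1) (j i)
      simp [q, (hij i).symm] at h2
    · have : F (p + B (q i)) - F p = (1 - θ) • v i + θ • v (j i) := by
        rw [hθ, hv, hv]; module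
      simp only [Φ, this, map_add, map_smul, hV]
  have evW : ∀ᶠ a in nhds (0 : Fin 3 → ℝ), p + B a ∈ W := by
    have h1 : ContinuousAt (fun a => p + B a) 0 := by fun_prop
    exact h1.eventually_mem (by simpa using hW.mem_nhds hp)
  have ev1 : ∀ i, ∀ᶠ a in nhds (0 : Fin 3 → ℝ), Sees (Pi.single i 1) a := fun i =>
    sees _ (by rw [hB, hb, neg_smul, neg_neg]; exact hCone _ (hwC i) _ hσ)
  have ev2 : ∀ i, ∀ᶠ a in nhds (0 : Fin 3 → ℝ), Sees (q i) a := fun i =>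
    sees _ (by
      rw [hBq, neg_smul, neg_neg]
      exact hCone _ (hCone _ (hjC i) _ (by norm_num)) _ hσ)
  obtain ⟨δ, hδ, hball⟩ := Metric.nhds_basis_ball.eventually_iff.1
    (evW.and ((Filter.eventually_all.2 ev1).and (Filter.eventually_all.2 ev2)))
  obtain ⟨c, hc0, hc⟩ := projective_of_mapsPencil (Φ := Φ) hδ
    (by
      refine V.continuous.comp_continuousOn (ContinuousOn.sub ?_ continuousOn_const)
      exact hcont.comp (by fun_prop) fun a ha => (hball ha).1)
    (by
      intro a ha a' ha' h
      have h1 := sub_left_injective (V.injective h)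
      exact B.injective (add_left_cancel (hinj (hball ha).1 (hball ha').1 h1)))
    (by simp [Φ])
    (by
      intro i
      have := pencil (ball 0 δ) (Pi.single i 1) (by rw [hB, hb]; exact hσ1 i)
        fun a ha => ⟨(hball ha).1, (hball ha).2.1 i⟩
      rwa [hΦs] at this)
    (by
      intro i
      obtain ⟨θ, hθ, h⟩ := hΦq i
      refine ⟨j i, hij i, θ, hθ, ?_⟩
      rw [← h]
      exact pencil (ball 0 δ) (q i) (by rw [hBq]; exact hσ2 _ _)
        fun a ha => ⟨(hball ha).1, (hball ha).2.2 i⟩)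
  let A : E × ℝ →ₗ[ℝ] (Fin 3 → ℝ) :=
    B.symm.toLinearMap ∘ₗ (LinearMap.fst ℝ E ℝ - (LinearMap.snd ℝ E ℝ).smulRight p)
  have hA : ∀ z, A z = B.symm (z.1 - z.2 • p) := fun z => by simp [A]
  let s : (Fin 3 → ℝ) →ₗ[ℝ] ℝ := ∑ i, LinearMap.proj i
  have hs : ∀ a, s a = ∑ i, a i := fun a => by simp [s]
  let M : (Fin 3 → ℝ) →ₗ[ℝ] (Fin 3 → ℝ) := LinearMap.pi fun i => c i • LinearMap.proj i
  have hM : ∀ a i, M a i = c i * a i := fun a i => by simp [M]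
  let ω : E × ℝ →ₗ[ℝ] ℝ := LinearMap.snd ℝ E ℝ - s ∘ₗ A + s ∘ₗ M ∘ₗ A
  have hω : ∀ z, ω z = z.2 - ∑ i, A z i + ∑ i, c i * A z i := fun z => by
    simp [ω, hs, hM]
  let T : E × ℝ →ₗ[ℝ] E × ℝ :=
    (ω.smulRight (F p) + V.symm.toLinearMap ∘ₗ M ∘ₗ A).prod ω
  have hT1 : ∀ z, (T z).1 = ω z • F p + V.symm (M (A z)) := fun z => by simp [T]
  have hT2 : ∀ z, (T z).2 = ω z := fun z => by simp [T]
  refine ⟨T, ?_, ?_⟩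
  · rw [injective_iff_map_eq_zero]
    intro z hz
    have h2 : ω z = 0 := by rw [← hT2, hz]; rfl
    have h1 : V.symm (M (A z)) = 0 := by
      have := hT1 z
      rw [hz, h2, zero_smul, zero_add] at this
      exact this.symm
    have h3 : M (A z) = 0 := by simpa using h1
    have h4 : A z = 0 := by
      ext i
      have := congrFun h3 i
      rw [hM] at this
      exact (mul_eq_zero.1 this).resolve_left (hc0 i)
    have h5 : z.2 = 0 := by
      have := hω z
      rw [h2, h4] at this
      simpa using this.symm
    have h6 : z.1 = 0 := by
      rw [hA, h5] at h4
      simpa using h4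
    exact Prod.ext h6 h5
  · have hcA : ContinuousAt (fun x : E => A (x, 1)) p := by
      simp only [hA]; fun_prop
    have h0 : A (p, 1) = 0 := by simp [hA]
    have := hcA.tendsto.eventually (by rw [h0]; exact hc)
    filter_upwards [this] with x hx
    have hωx : ω (x, 1) = 1 - ∑ i, A (x, 1) i + ∑ i, c i * A (x, 1) i := hω (x, 1)
    rw [← hωx] at hx
    refine ⟨by rw [hT2]; exact hx.1, ?_⟩
    have hBA : p + B (A (x, 1)) = x := by simp [hA]
    have h7 : ω (x, 1) • V (F x - F p) = M (A (x, 1)) := by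
      ext i
      have := hx.2 i
      simp only [Φ, hBA] at this
      rw [Pi.smul_apply, this, hM, smul_eq_mul, mul_div_cancel₀ _ hx.1]
    rw [hT1, hT2, ← h7, map_smul, ContinuousLinearEquiv.symm_apply_apply]
    module

end LocallyProjective

section Globalization

variable {E : Type*} [NormedAddCommGroup E] [NormedSpace ℝ E]

theorem map_add_smul_one (T : E × ℝ →ₗ[ℝ] E × ℝ) (x d : E) (t : ℝ) :
    T (x + t • d, 1) = T (x, 1) + t • T (d, 0) := by
  rw [← map_smul, ← map_add]; simp

theorem smul_fst_eq_of_eventually {T T' : E × ℝ →ₗ[ℝ] E × ℝ} {z : E}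
    (h : ∀ᶠ y in nhds z, (T' (y, 1)).2 • (T (y, 1)).1 = (T (y, 1)).2 • (T' (y, 1)).1) (y : E) :
    (T' (y, 1)).2 • (T (y, 1)).1 = (T (y, 1)).2 • (T' (y, 1)).1 := by
  have hc : ∀ s : ℝ, Filter.Tendsto (fun t : ℝ => z + (s * t) • (y - z))
      (nhdsWithin 0 (Set.Ioi 0)) (nhds z) := fun s => by
    have : ContinuousAt (fun t : ℝ => z + (s * t) • (y - z)) 0 := by fun_prop
    simpa [ContinuousAt] using this.tendsto.mono_left (nhdsWithin_le_nhds (s := Set.Ioi (0 : ℝ)))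
  obtain ⟨ε, ⟨h1, h2⟩, hε⟩ := ((((hc 1).eventually h).and ((hc (-1)).eventually h)).and
    self_mem_nhdsWithin).exists
  have h0 := h.self_of_nhds
  have hε : ε ≠ 0 := ne_of_gt hε
  have hy : y = z + (1 : ℝ) • (y - z) := by module
  rw [hy]
  rw [map_add_smul_one, map_add_smul_one] at h1 h2 ⊢
  generalize T (z, 1) = A at *
  generalize T' (z, 1) = A' at *
  generalize T (y - z, 0) = D at *
  generalize T' (y - z, 0) = D' at *
  simp only [Prod.fst_add, Prod.snd_add, Prod.smul_fst, Prod.smul_snd, smul_eq_mul] at *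
  have hβ : D'.2 • A.1 + A'.2 • D.1 - D.2 • A'.1 - A.2 • D'.1 = 0 := by
    have : (2 * ε) • (D'.2 • A.1 + A'.2 • D.1 - D.2 • A'.1 - A.2 • D'.1) = 0 := by
      linear_combination (norm := module) h1 - h2
    exact (smul_eq_zero.1 this).resolve_left (by simpa using hε)
  have hγ : D'.2 • D.1 - D.2 • D'.1 = 0 := by
    have : (2 * ε ^ 2) • (D'.2 • D.1 - D.2 • D'.1) = 0 := by
      linear_combination (norm := module) h1 + h2 - (2 : ℝ) • h0
    exact (smul_eq_zero.1 this).resolve_left (by simpa using hε)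
  linear_combination (norm := module) h0 + hβ + hγ

/-- Local projective representations on a preconnected set glue to a single one. -/
theorem exists_projective_of_locallyProjectiveAt {F : E → E} {S : Set E}
    (hS : IsPreconnected S) (hne : S.Nonempty) (hF : ∀ x ∈ S, LocallyProjectiveAt F x) :
    ∃ T : E × ℝ →ₗ[ℝ] E × ℝ, Function.Injective T ∧ ∀ x ∈ S, AgreesWithProjective T F x := by
  obtain ⟨x₀, hx₀⟩ := hne
  obtain ⟨T, hT, hx₀T⟩ := hF x₀ hx₀
  refine ⟨T, hT, ?_⟩
  suffices h : S ⊆ {x | ∀ᶠ y in nhds x, AgreesWithProjective T F y} from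
    fun x hx => (h hx).self_of_nhds
  refine hS.subset_of_closure_inter_subset isOpen_setOfPred_eventually_nhds ⟨x₀, hx₀, hx₀T⟩ ?_
  rintro x ⟨hx, hxS⟩
  obtain ⟨T', hT', hxT'⟩ := hF x hxS
  obtain ⟨z, hz', hz⟩ := mem_closure_iff_nhds.1 hx _ (eventually_eventually_nhds.2 hxT')
  have key := smul_fst_eq_of_eventually (T := T) (T' := T') (z := z) (by
    filter_upwards [hz, hz'] with y h h'
    rw [h.2, h'.2, smul_comm])
  filter_upwards [hxT'] with y hy
  have h1 : (T (y, 1)).1 = (T (y, 1)).2 • F y := by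
    have := key y
    rw [hy.2, smul_comm] at this
    exact smul_right_injective E hy.1 this
  refine ⟨fun h2 => ?_, h1⟩
  rw [h2, zero_smul] at h1
  have := (injective_iff_map_eq_zero T).1 hT (y, 1) (Prod.ext h1 h2)
  simp at this

theorem collinear_image_of_agreesWithProjective {T : E × ℝ →ₗ[ℝ] E × ℝ} {F : E → E} {W : Set E}
    {x d : E} (hx : x ∈ W)
    (h : ∀ y ∈ {y | y ∈ W ∧ ∃ t : ℝ, y = x + t • d}, AgreesWithProjective T F y) :
    Collinear ℝ (F '' {y | y ∈ W ∧ ∃ t : ℝ, y = x + t • d}) := by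
  have hx' : x ∈ {y | y ∈ W ∧ ∃ t : ℝ, y = x + t • d} := ⟨hx, 0, by simp⟩
  rw [collinear_iff_of_mem (Set.mem_image_of_mem F hx')]
  have h0 := h x hx'
  refine ⟨(T (x, 1)).2 • (T (d, 0)).1 - (T (d, 0)).2 • (T (x, 1)).1, ?_⟩
  rintro _ ⟨_, ⟨hy, t, rfl⟩, rfl⟩
  have ht := h _ ⟨hy, t, rfl⟩
  rw [AgreesWithProjective, map_add_smul_one] at ht
  rw [AgreesWithProjective] at h0
  generalize T (x, 1) = A at *
  generalize T (d, 0) = D at *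
  simp only [Prod.fst_add, Prod.snd_add, Prod.smul_fst, Prod.smul_snd, smul_eq_mul] at *
  refine ⟨t / (A.2 * (A.2 + t * D.2)), ?_⟩
  refine smul_right_injective E (mul_ne_zero h0.1 ht.1) ?_
  simp only [vadd_eq_add, smul_add, smul_smul]
  rw [mul_div_cancel₀ _ (mul_ne_zero h0.1 ht.1)]
  linear_combination (norm := module) (A.2 + t * D.2) • h0.2 - A.2 • ht.2

end Globalization

section Baire

variable {E : Type*} [NormedAddCommGroup E] [NormedSpace ℝ E]

/-- Collinearity as the vanishing of all minors. -/
theorem collinear_iff_dual_mul_eq {S : Set E} {p : E} (hp : p ∈ S) :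
    Collinear ℝ S ↔ ∀ x ∈ S, ∀ y ∈ S, ∀ φ ψ : StrongDual ℝ E,
      φ (x - p) * ψ (y - p) - φ (y - p) * ψ (x - p) = 0 := by
  rw [collinear_iff_of_mem hp]
  constructor
  · rintro ⟨v, hv⟩ x hx y hy φ ψ
    obtain ⟨r, rfl⟩ := hv x hx
    obtain ⟨s, rfl⟩ := hv y hy
    simp only [vadd_eq_add, add_sub_cancel_right, map_smul, smul_eq_mul]
    ring
  · intro h
    by_cases hS : ∃ x ∈ S, x ≠ p
    · obtain ⟨x, hx, hxp⟩ := hS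
      obtain ⟨φ, hφ⟩ := SeparatingDual.exists_eq_one (R := ℝ) (sub_ne_zero.2 hxp)
      refine ⟨x - p, fun y hy => ⟨φ (y - p), ?_⟩⟩
      rw [vadd_eq_add, ← sub_eq_iff_eq_add]
      refine (SeparatingDual.eq_iff_forall_dual_eq (R := ℝ)).2 fun ψ => ?_
      have := h x hx y hy φ ψ
      rw [hφ] at this
      rw [map_smul, smul_eq_mul]
      linarith
    · push Not at hS
      exact ⟨0, fun y hy => ⟨0, by simp [hS y hy]⟩⟩

theorem isClosed_setOf_collinear_image {F : E → E} {U K : Set E} (hU : IsOpen U)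
    (hcont : ContinuousOn F U) (hK : K ⊆ U) (v : E) :
    IsClosed {k : K | Collinear ℝ (F '' {y | y ∈ U ∧ ∃ t : ℝ, y = (k : E) + t • v})} := by
  have hmem : ∀ k : K, F k ∈ F '' {y | y ∈ U ∧ ∃ t : ℝ, y = (k : E) + t • v} := fun k =>
    ⟨k, ⟨hK k.2, 0, by simp⟩, rfl⟩
  refine isClosed_of_closure_subset fun k hk => ?_
  rw [mem_closure_iff_frequently] at hk
  rw [Set.mem_ofPred_eq, collinear_iff_dual_mul_eq (hmem k)]
  rintro _ ⟨_, ⟨hs, s, rfl⟩, rfl⟩ _ ⟨_, ⟨ht, t, rfl⟩, rfl⟩ φ ψ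
  have hFt : ∀ {t : ℝ}, (k : E) + t • v ∈ U →
      ContinuousAt (fun k' : K => F ((k' : E) + t • v)) k := fun {t} h =>
    ContinuousAt.comp (f := fun k' : K => (k' : E) + t • v)
      (hcont.continuousAt (hU.mem_nhds h)) (by fun_prop)
  have hev : ∀ {t : ℝ}, (k : E) + t • v ∈ U → ∀ᶠ k' : K in nhds k, (k' : E) + t • v ∈ U :=
    fun {t} h => ContinuousAt.eventually_mem (f := fun k' : K => (k' : E) + t • v)
      (by fun_prop) (hU.mem_nhds h)
  have hF0 : ContinuousAt (fun k' : K => F k') k :=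
    ContinuousAt.comp (f := fun k' : K => (k' : E))
      (hcont.continuousAt (hU.mem_nhds (hK k.2))) (by fun_prop)
  have hdual : ∀ (χ : StrongDual ℝ E) {t : ℝ}, (k : E) + t • v ∈ U →
      ContinuousAt (fun k' : K => χ (F ((k' : E) + t • v) - F k')) k := fun χ _ h =>
    χ.continuous.continuousAt.comp ((hFt h).sub hF0)
  have hG : ContinuousAt (fun k' : K =>
      φ (F ((k' : E) + s • v) - F k') * ψ (F ((k' : E) + t • v) - F k') -
      φ (F ((k' : E) + t • v) - F k') * ψ (F ((k' : E) + s • v) - F k')) k :=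
    ((hdual φ hs).mul (hdual ψ ht)).sub ((hdual φ ht).mul (hdual ψ hs))
  refine isClosed_singleton.mem_of_frequently_of_tendsto (s := {(0 : ℝ)}) ?_ hG
  refine (hk.and_eventually ((hev hs).and (hev ht))).mono ?_
  rintro k' ⟨h1, h2, h3⟩
  exact (collinear_iff_dual_mul_eq (hmem k')).1 h1 _ ⟨_, ⟨h2, s, rfl⟩, rfl⟩
    _ ⟨_, ⟨h3, t, rfl⟩, rfl⟩ φ ψ

theorem locallyProjectiveAt_of_open_directions (hE : finrank ℝ E = 3) {F : E → E} {U : Set E}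
    (hU : IsOpen U) (hcont : ContinuousOn F U) (hinj : Set.InjOn F U)
    (hdir : ∀ p ∈ U, ∃ O : Set E, IsOpen O ∧ O.Nonempty ∧
      ∀ v ∈ O, Collinear ℝ (F '' {y | y ∈ U ∧ ∃ t : ℝ, y = p + t • v}))
    {p : E} (hp : p ∈ U) : LocallyProjectiveAt F p := by
  have : FiniteDimensional ℝ E := Module.finite_of_finrank_pos (by omega)
  have : ProperSpace E := FiniteDimensional.proper ℝ E
  by_contra hpV
  let V : Set E := {x | LocallyProjectiveAt F x}
  have hV : IsOpen V := by
    rw [isOpen_iff_mem_nhds]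
    rintro x ⟨T, hT, h⟩
    filter_upwards [eventually_eventually_nhds.2 h] with y hy using ⟨T, hT, hy⟩
  let K : Set E := U \ V
  have hKU : K ⊆ U := Set.sdiff_subset
  have : LocallyCompactSpace K :=
    (hU.isLocallyClosed.inter hV.isClosed_compl.isLocallyClosed).locallyCompactSpace
  have : Nonempty K := ⟨⟨p, hp, hpV⟩⟩
  obtain ⟨⟨b, hb⟩, k, hk⟩ := nonempty_interior_of_iUnion_of_closed
    (f := fun b : TopologicalSpace.countableBasis E => ⋂ v ∈ (b : Set E),
      {k : K | Collinear ℝ (F '' {y | y ∈ U ∧ ∃ t : ℝ, y = (k : E) + t • v})})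
    (fun b => isClosed_biInter fun v _ => isClosed_setOf_collinear_image hU hcont hKU v)
    (by
      refine Set.eq_univ_of_forall fun k => ?_
      obtain ⟨O, hO, ⟨v, hv⟩, h⟩ := hdir k (hKU k.2)
      obtain ⟨b, hb, -, hbO⟩ :=
        (TopologicalSpace.isBasis_countableBasis E).exists_subset_of_mem_open hv hO
      exact Set.mem_iUnion.2 ⟨⟨b, hb⟩, Set.mem_iInter₂.2 fun v hv => h v (hbO hv)⟩)
  rw [mem_interior_iff_mem_nhds, mem_nhds_subtype] at hk
  obtain ⟨N, hN, hNk⟩ := hk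
  obtain ⟨ρ, hρ, hball⟩ := Metric.mem_nhds_iff.1 (Filter.inter_mem hN (hU.mem_nhds (hKU k.2)))
  let C : Set E := ⋃ r : Set.Ioi (0 : ℝ), (fun v : E => (r : ℝ) • v) ⁻¹' b
  have hbopen : IsOpen b := TopologicalSpace.isOpen_of_mem_countableBasis hb
  have hC : IsOpen C := isOpen_iUnion fun r => hbopen.preimage (by fun_prop)
  have hmemC : ∀ {d}, d ∈ C ↔ ∃ r : ℝ, 0 < r ∧ r • d ∈ b := by simp [C]
  have hlines : MapsLines F (ball (k : E) ρ) C := by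
    intro x hx d hd
    obtain ⟨r, hr, hrd⟩ := hmemC.1 hd
    by_cases hK : ∃ s : ℝ, x + s • d ∈ ball (k : E) ρ ∧ x + s • d ∈ K
    · obtain ⟨s, hs, hsK⟩ := hK
      have h : (⟨x + s • d, hsK⟩ : K) ∈ Subtype.val ⁻¹' N := (hball hs).1
      refine (Set.mem_iInter₂.1 (hNk h) (r • d) hrd).subset (Set.image_mono ?_)
      rintro _ ⟨hy, t, rfl⟩
      refine ⟨(hball hy).2, (t - s) / r, ?_⟩
      rw [smul_smul, div_mul_cancel₀ _ hr.ne']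
      module
    · have hconv : Convex ℝ {y | y ∈ ball (k : E) ρ ∧ ∃ t : ℝ, y = x + t • d} := by
        have : {y | y ∈ ball (k : E) ρ ∧ ∃ t : ℝ, y = x + t • d} =
            ball (k : E) ρ ∩ AffineMap.lineMap (k := ℝ) x (x + d) '' Set.univ := by
          ext y
          simp [AffineMap.lineMap_apply, eq_comm, add_comm]
        rw [this]
        exact (convex_ball _ _).inter (convex_univ.affine_image _)
      obtain ⟨T, -, hT⟩ := exists_projective_of_locallyProjectiveAt (F := F)
        hconv.isPreconnected ⟨x, hx, 0, by simp⟩ (by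
          rintro _ ⟨hy, t, rfl⟩
          by_contra h
          exact hK ⟨t, hy, (hball hy).2, h⟩)
      exact collinear_image_of_agreesWithProjective hx hT
  have hsub : ball (k : E) ρ ⊆ U := fun y hy => (hball hy).2
  refine k.2.2 (hlines.locallyProjectiveAt hE isOpen_ball (hcont.mono hsub) (hinj.mono hsub)
    hC ?_ ?_ (mem_ball_self hρ))
  · obtain ⟨v, hv⟩ := TopologicalSpace.nonempty_of_mem_countableBasis hb
    exact ⟨v, hmemC.2 ⟨1, one_pos, by simpa using hv⟩⟩
  · intro d hd r hr
    obtain ⟨s, hs, hsd⟩ := hmemC.1 hd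
    exact hmemC.2 ⟨s / r, div_pos hs hr, by rwa [smul_smul, div_mul_cancel₀ _ hr.ne']⟩

end Baire

section Coordinates

/-- Homogeneous coordinates on `ℝ³ × ℝ`. -/
noncomputable def homogeneousCoords : (EuclideanSpace ℝ (Fin 3) × ℝ) ≃ₗ[ℝ] (Fin 4 → ℝ) where
  toFun z := ![z.1 0, z.1 1, z.1 2, z.2]
  invFun a := (!₂[a 0, a 1, a 2], a 3)
  map_add' z z' := by ext i; fin_cases i <;> simp
  map_smul' r z := by ext i; fin_cases i <;> simp
  left_inv z := by
    refine Prod.ext ?_ rfl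
    ext i; fin_cases i <;> simp
  right_inv a := by ext i; fin_cases i <;> simp

theorem homogeneousCoords_castSucc (z : EuclideanSpace ℝ (Fin 3) × ℝ) (i : Fin 3) :
    homogeneousCoords z i.castSucc = z.1 i := by
  fin_cases i <;> rfl

theorem homogeneousCoords_last (z : EuclideanSpace ℝ (Fin 3) × ℝ) :
    homogeneousCoords z 3 = z.2 := rfl

/-- The matrix in homogeneous coordinates of a linear endomorphism of `ℝ³ × ℝ`. -/
theorem exists_matrix_of_injective
    {T : EuclideanSpace ℝ (Fin 3) × ℝ →ₗ[ℝ] EuclideanSpace ℝ (Fin 3) × ℝ}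
    (hT : Function.Injective T) :
    ∃ M : Matrix (Fin 4) (Fin 4) ℝ, IsUnit M.det ∧ ∀ x : EuclideanSpace ℝ (Fin 3),
      M.mulVec ![x 0, x 1, x 2, 1] = homogeneousCoords (T (x, 1)) := by
  let S : (Fin 4 → ℝ) →ₗ[ℝ] (Fin 4 → ℝ) :=
    homogeneousCoords.toLinearMap ∘ₗ T ∘ₗ homogeneousCoords.symm.toLinearMap
  have hS : Function.Injective S :=
    homogeneousCoords.injective.comp (hT.comp homogeneousCoords.symm.injective)
  refine ⟨LinearMap.toMatrix' S, ?_, fun x => ?_⟩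
  · rw [LinearMap.det_toMatrix', ← LinearMap.isUnit_iff_isUnit_det, LinearMap.isUnit_iff_ker_eq_bot]
    exact LinearMap.ker_eq_bot.2 hS
  · rw [← Matrix.toLin'_apply, Matrix.toLin'_toMatrix']
    have : (![x 0, x 1, x 2, 1] : Fin 4 → ℝ) = homogeneousCoords (x, 1) := rfl
    rw [this]
    simp [S]

end Coordinates

theorem collinear_of_subset_line {E : Type*} [NormedAddCommGroup E] [NormedSpace ℝ E]
    {ℓ : AffineSubspace ℝ E} (hℓ : finrank ℝ ℓ.direction = 1) {S : Set E}
    (hS : S ⊆ (ℓ : Set E)) : Collinear ℝ S := by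
  have : FiniteDimensional ℝ ℓ.direction := Module.finite_of_finrank_pos (by omega)
  have : FiniteDimensional ℝ (vectorSpan ℝ (ℓ : Set E)) := this
  exact (collinear_iff_finrank_le_one.2 hℓ.le).subset hS

/-- Let `U ⊆ ℝ³` be open and connected and `L` a rich family of affine
lines in `U`: every point of `U` lies on a line of `L`, and for every `ℓ ∈ L` and
`p ∈ ℓ ∩ U` there is a relatively open subset `Ω` of the unit sphere containing a unit
direction vector of `ℓ` such that every `d ∈ Ω` is the direction of some line of `L`
through `p`.  If `F : U → ℝ³` is a homeomorphism onto its image mapping every `ℓ ∩ U`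
into an affine line, then `F` is the restriction of a projective transformation: there
is an invertible `4×4` matrix `M` such that, writing `M·(x,1) = (u(x), w(x))`, one has
`w(x) ≠ 0` and `F(x) = u(x)/w(x)` for all `x ∈ U`. -/
theorem rich_family_of_lines_to_lines_is_projective
    (U : Set (EuclideanSpace ℝ (Fin 3))) (hUopen : IsOpen U) (hUconn : IsConnected U)
    (L : Set (AffineSubspace ℝ (EuclideanSpace ℝ (Fin 3))))
    (hlines : ∀ ℓ ∈ L, finrank ℝ ℓ.direction = 1)
    -- (i) every point of `U` lies on some line of `L`
    (hcover : ∀ p ∈ U, ∃ ℓ ∈ L, p ∈ ℓ)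
    -- (ii) richness: open cones of directions of lines of the family
    (hrich : ∀ ℓ ∈ L, ∀ p, p ∈ ℓ → p ∈ U →
      ∃ Ω : Set (EuclideanSpace ℝ (Fin 3)),
        (∃ O : Set (EuclideanSpace ℝ (Fin 3)), IsOpen O ∧
          Ω = O ∩ sphere (0 : EuclideanSpace ℝ (Fin 3)) 1) ∧
        (∃ d ∈ Ω, d ∈ ℓ.direction) ∧
        (∀ d ∈ Ω, ∃ ℓ' ∈ L, p ∈ ℓ' ∧ d ∈ ℓ'.direction))
    -- `F` is a homeomorphism of `U` onto its image
    (F : EuclideanSpace ℝ (Fin 3) → EuclideanSpace ℝ (Fin 3))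
    (hFcont : ContinuousOn F U) (hFinj : Set.InjOn F U)
    (hFinv : ∃ G, ContinuousOn G (F '' U) ∧ ∀ x ∈ U, G (F x) = x)
    -- `F` maps every line of the family into an affine line
    (hFlines : ∀ ℓ ∈ L, ∃ ℓ' : AffineSubspace ℝ (EuclideanSpace ℝ (Fin 3)),
      finrank ℝ ℓ'.direction = 1 ∧
      F '' ((ℓ : Set (EuclideanSpace ℝ (Fin 3))) ∩ U) ⊆
        (ℓ' : Set (EuclideanSpace ℝ (Fin 3)))) :
    ∃ M : Matrix (Fin 4) (Fin 4) ℝ, IsUnit M.det ∧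
      ∀ x ∈ U,
        M.mulVec ![x 0, x 1, x 2, 1] 3 ≠ 0 ∧
        ∀ i : Fin 3, F x i =
          M.mulVec ![x 0, x 1, x 2, 1] i.castSucc / M.mulVec ![x 0, x 1, x 2, 1] 3 := by
  have hE : finrank ℝ (EuclideanSpace ℝ (Fin 3)) = 3 := by simp
  have hdir : ∀ p ∈ U, ∃ O : Set (EuclideanSpace ℝ (Fin 3)), IsOpen O ∧ O.Nonempty ∧
      ∀ v ∈ O, Collinear ℝ (F '' {y | y ∈ U ∧ ∃ t : ℝ, y = p + t • v}) := by
    intro p hp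
    obtain ⟨ℓ, hℓ, hpℓ⟩ := hcover p hp
    obtain ⟨_, ⟨O, hO, rfl⟩, ⟨d, ⟨hdO, hd⟩, -⟩, h⟩ := hrich ℓ hℓ p hpℓ hp
    have hcontOn : ContinuousOn (fun v : EuclideanSpace ℝ (Fin 3) => ‖v‖⁻¹ • v) {0}ᶜ :=
      (continuousOn_id.norm.inv₀ fun v hv => norm_ne_zero_iff.2 hv).smul continuousOn_id
    have hd1 : ‖d‖ = 1 := by simpa using hd
    refine ⟨_, hcontOn.isOpen_inter_preimage isOpen_compl_singleton hO,
      ⟨d, ?_, by simpa [hd1] using hdO⟩, ?_⟩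
    · rintro rfl
      simp at hd1
    · rintro v ⟨hv0, hvO⟩
      have hv : ‖v‖ ≠ 0 := norm_ne_zero_iff.2 hv0
      obtain ⟨ℓ', hℓ', hpℓ', hdir⟩ := h (‖v‖⁻¹ • v) ⟨hvO, by simp [norm_smul, hv]⟩
      obtain ⟨m, hm, hFm⟩ := hFlines ℓ' hℓ'
      refine collinear_of_subset_line hm ((Set.image_mono ?_).trans hFm)
      rintro _ ⟨hy, t, rfl⟩
      refine ⟨?_, hy⟩
      have hv' : v ∈ ℓ'.direction := by
        simpa [smul_smul, hv] using ℓ'.direction.smul_mem ‖v‖ hdir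
      rw [add_comm]
      exact AffineSubspace.vadd_mem_of_mem_direction (ℓ'.direction.smul_mem t hv') hpℓ'
  obtain ⟨T, hT, hTF⟩ := exists_projective_of_locallyProjectiveAt hUconn.isPreconnected
    hUconn.nonempty fun p hp =>
      locallyProjectiveAt_of_open_directions hE hUopen hFcont hFinj hdir hp
  obtain ⟨M, hM, hMT⟩ := exists_matrix_of_injective hT
  refine ⟨M, hM, fun x hx => ?_⟩
  obtain ⟨h2, h1⟩ := hTF x hx
  rw [hMT, homogeneousCoords_last]
  refine ⟨h2, fun i => ?_⟩
  rw [homogeneousCoords_castSucc, h1, PiLp.smul_apply, smul_eq_mul, mul_div_cancel_left₀ _ h2]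
end
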